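/- For every κ > 0 and W > 0 there exist ε₀ > 0, constants L₁, L₂, C > 0, and a family (ψ_ε, μ_ε, z₁(ε)) indexed by ε ∈ (0, ε₀] with μ_ε > 0 and z₁(ε) > 0 such that for each ε ∈ (0, ε₀]: ψ_ε is a centralized stream function of a steady vortex ring with parameters (ε, W, μ_ε); its cross-section A_ε is convex and satisfies B_{r₋(ε)}(z_ε) ⊆ A_ε ⊆ B_{r₊(ε)}(z_ε), where z_ε = (z₁(ε), 0), r₋(ε) = √(κ/(π z₁(ε))) · ε (1 − L₁ ε ln(1/ε)) and r₊(ε) = √(κ/(π z₁(ε))) · ε (1 + L₂ ε ln(1/ε)); |z₁(ε) − κ/(4πW)| ≤ C / ln(1/ε); and the circulations κ_ε := ε^{−2} ∫_{A_ε} x₁ dx converge to κ as ε → 0⁺. -/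

import Mathlib

open MeasureTheory Real Filter
open scoped RealInnerProductSpace

noncomputable section

/-- The plane `ℝ²` with the Euclidean norm. -/
abbrev Plane : Type := EuclideanSpace ℝ (Fin 2)

/-- The point `(a, b)` of the plane. -/
def mk2 (a b : ℝ) : Plane := (WithLp.equiv 2 (Fin 2 → ℝ)).symm ![a, b]

/-- The open right half plane `Π = {x : x₁ > 0}`. -/
def halfPlane : Set Plane := {x : Plane | 0 < x 0}

/-- The reflection `x̄ = (−x₁, x₂)` of a point `x = (x₁, x₂)`. -/
def reflPt (x : Plane) : Plane := mk2 (-(x 0)) (x 1)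

/-- The Green function `G_*` on the half plane of the operator `−(1/x₁)div((1/x₁)∇)`. -/
def Gstar (x x' : Plane) : ℝ :=
  x 0 * (x' 0) ^ 2 / (4 * π) *
    ∫ θ in (-π)..π, Real.cos θ /
      Real.sqrt ((x 1 - x' 1) ^ 2 + (x 0) ^ 2 + (x' 0) ^ 2 - 2 * x 0 * x' 0 * Real.cos θ)

/-- The Green function of `−Δ` on the half plane. -/
def Gfun (x x' : Plane) : ℝ :=
  (1 / (4 * π)) * Real.log
    (((x 0 + x' 0) ^ 2 + (x 1 - x' 1) ^ 2) / ((x 0 - x' 0) ^ 2 + (x 1 - x' 1) ^ 2))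

/-- The regular part `H_c(x,x') = G_*(x,x') − c² G(x,x')`. -/
def Hker (c : ℝ) (x x' : Plane) : ℝ := Gstar x x' - c ^ 2 * Gfun x x'

/-- The regular part `H_c`, extended continuously to the diagonal. -/
def HkerExt (c : ℝ) (x x' : Plane) : ℝ := by
  classical
  exact if x = x' then limUnder (nhdsWithin x' {x'}ᶜ) (fun y => Hker c y x')
    else Hker c x x'

/-- The cross-section `A = {x ∈ Π : ψ(x) − (W/2) x₁² ln(1/ε) > μ}`. -/
def crossSection (ψ : Plane → ℝ) (ε W μ : ℝ) : Set Plane :=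
  {x : Plane | x ∈ halfPlane ∧ μ < ψ x - W / 2 * (x 0) ^ 2 * Real.log (1 / ε)}

/-- `ψ` is a stream function of a steady vortex ring with parameters `(ε, W, μ)`. -/
structure IsVortexRingStream (ψ : Plane → ℝ) (ε W μ : ℝ) : Prop where
  continuousOn : ContinuousOn ψ halfPlane
  bounded : Bornology.IsBounded (crossSection ψ ε W μ)
  closure_subset : closure (crossSection ψ ε W μ) ⊆ halfPlane
  repr : ∀ x ∈ halfPlane, ψ x = (∫ x' in crossSection ψ ε W μ, Gstar x x') / ε ^ 2

/-- The circulation `ε⁻² ∫_A x₁ dx` of a vortex ring. -/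
def circulation (ψ : Plane → ℝ) (ε W μ : ℝ) : ℝ :=
  (∫ x in crossSection ψ ε W μ, x 0) / ε ^ 2

/-- `ψ` is centralized: it is even in the second variable. -/
def Centralized (ψ : Plane → ℝ) : Prop :=
  ∀ a b : ℝ, ψ (mk2 a (-b)) = ψ (mk2 a b)

namespace VortexRing

open Metric

/-- The profile of the ring kernel as a function of the relative squared distance. -/
def ringF (t : ℝ) : ℝ := ∫ θ in (-π)..π, cos θ / √(t + 2 - 2 * cos θ)

/-- Half chord of the unit circle at angle `θ`, doubled. -/
def chord (θ : ℝ) : ℝ := 2 * |sin (θ / 2)|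

/-- Numerator of the regular part of the profile. -/
def ringNum (θ : ℝ) : ℝ := cos θ - cos (θ / 2)

/-- The regular integral part of the profile. -/
def ringH (t : ℝ) : ℝ := ∫ θ in (-π)..π, ringNum θ / √(t + chord θ ^ 2)

/-- The profile with its logarithmic singularity removed. -/
def ringJ (t : ℝ) : ℝ := ringH t + 2 * log (2 + √(4 + t))

lemma chord_nonneg (θ : ℝ) : 0 ≤ chord θ := by unfold chord; positivity

lemma chord_le_two (θ : ℝ) : chord θ ≤ 2 := by
  unfold chord; have := abs_sin_le_one (θ / 2); linarith

lemma chord_sq (θ : ℝ) : chord θ ^ 2 = 2 - 2 * cos θ := by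
  have h : cos θ = 1 - 2 * sin (θ / 2) ^ 2 := by
    have := cos_two_mul (θ / 2)
    have h2 := sin_sq_add_cos_sq (θ / 2)
    rw [show 2 * (θ / 2) = θ by ring] at this
    linarith
  unfold chord; rw [mul_pow, sq_abs]; linarith

lemma cos_half_nonneg {θ : ℝ} (h : θ ∈ Set.Icc (-π) π) : 0 ≤ cos (θ / 2) :=
  cos_nonneg_of_mem_Icc ⟨by linarith [h.1], by linarith [h.2]⟩

lemma one_sub_cos_half_le {θ : ℝ} (h : θ ∈ Set.Icc (-π) π) :
    1 - cos (θ / 2) ≤ chord θ ^ 2 / 4 := by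
  have h0 := cos_half_nonneg h
  have h1 := cos_le_one (θ / 2)
  have h2 := sin_sq_add_cos_sq (θ / 2)
  unfold chord; rw [mul_pow, sq_abs]; nlinarith

lemma abs_ringNum_le {θ : ℝ} (h : θ ∈ Set.Icc (-π) π) : |ringNum θ| ≤ chord θ ^ 2 / 2 := by
  have h1 := one_sub_cos_half_le h
  have h2 := chord_sq θ
  have h3 := cos_le_one (θ / 2)
  unfold ringNum
  rw [abs_le]; constructor <;> nlinarith [sq_nonneg (chord θ)]

lemma continuous_chord : Continuous chord := by unfold chord; fun_prop
lemma continuous_ringNum : Continuous ringNum := by unfold ringNum; fun_prop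

lemma intervalIntegrable_of_bdd {f : ℝ → ℝ} (hf : Measurable f) {C : ℝ}
    (h : ∀ θ ∈ Set.Icc (-π) π, |f θ| ≤ C) : IntervalIntegrable f volume (-π) π := by
  have hpi : -π ≤ π := by linarith [pi_pos]
  rw [intervalIntegrable_iff_integrableOn_Icc_of_le hpi]
  refine Measure.integrableOn_of_bounded (M := C) (by simp) hf.aestronglyMeasurable ?_
  filter_upwards [ae_restrict_mem measurableSet_Icc] with θ hθ using h θ hθ

lemma abs_integral_le_of_bdd {f : ℝ → ℝ} {C : ℝ}
    (h : ∀ θ ∈ Set.Icc (-π) π, |f θ| ≤ C) : |∫ θ in (-π)..π, f θ| ≤ 2 * π * C := by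
  have hpi : -π ≤ π := by linarith [pi_pos]
  have := intervalIntegral.norm_integral_le_of_norm_le_const (f := f) (a := -π) (b := π) (C := C)
    (fun x hx => by rw [Set.uIoc_of_le hpi] at hx; exact h x ⟨hx.1.le, hx.2⟩)
  rw [Real.norm_eq_abs, abs_of_nonneg (by linarith : 0 ≤ π - -π)] at this
  linarith

lemma chord_le_sqrt {t : ℝ} (ht : 0 ≤ t) (θ : ℝ) : chord θ ≤ √(t + chord θ ^ 2) :=
  Real.le_sqrt_of_sq_le (by linarith)

lemma sqrt_le_sqrt_add_chord (t : ℝ) (θ : ℝ) : √t ≤ √(t + chord θ ^ 2) :=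
  Real.sqrt_le_sqrt (by nlinarith [sq_nonneg (chord θ)])

lemma abs_sqrt_add_sub_le {a b c : ℝ} (ha : 0 ≤ a) (hb : 0 ≤ b) (hc : 0 ≤ c) :
    |√(a + c) - √(b + c)| ≤ |√a - √b| := by
  have key : ∀ a b : ℝ, 0 ≤ a → 0 ≤ b → a ≤ b → √(b + c) - √(a + c) ≤ √b - √a := by
    intro a b ha hb hab
    have h1 := Real.sqrt_le_sqrt (show a ≤ a + c by linarith)
    have h2 := Real.sqrt_le_sqrt (show b ≤ b + c by linarith)
    have h3 := Real.sqrt_le_sqrt hab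
    have h4 := Real.sqrt_le_sqrt (show a + c ≤ b + c by linarith)
    have e1 := Real.sq_sqrt ha
    have e2 := Real.sq_sqrt hb
    have e3 := Real.sq_sqrt (show 0 ≤ a + c by linarith)
    have e4 := Real.sq_sqrt (show 0 ≤ b + c by linarith)
    have n1 := Real.sqrt_nonneg a
    by_contra! hcon
    nlinarith
  rcases le_total a b with h | h
  · have := key a b ha hb h
    have h3 := Real.sqrt_le_sqrt h
    have h4 := Real.sqrt_le_sqrt (show a + c ≤ b + c by linarith)
    rw [abs_of_nonpos (by linarith), abs_of_nonpos (by linarith)]; linarith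
  · have := key b a hb ha h
    have h3 := Real.sqrt_le_sqrt h
    have h4 := Real.sqrt_le_sqrt (show b + c ≤ a + c by linarith)
    rw [abs_of_nonneg (by linarith), abs_of_nonneg (by linarith)]; linarith

lemma abs_ringNum_div_le {t θ : ℝ} (ht : 0 ≤ t) (h : θ ∈ Set.Icc (-π) π) :
    |ringNum θ / √(t + chord θ ^ 2)| ≤ 1 := by
  have h1 := abs_ringNum_le h
  have h2 := chord_le_sqrt ht θ
  have h3 := chord_le_two θ
  have h4 := chord_nonneg θ
  rw [abs_div, abs_of_nonneg (Real.sqrt_nonneg _)]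
  apply div_le_one_of_le₀ _ (Real.sqrt_nonneg _)
  nlinarith

lemma integrable_ringH {t : ℝ} (ht : 0 ≤ t) :
    IntervalIntegrable (fun θ => ringNum θ / √(t + chord θ ^ 2)) volume (-π) π := by
  refine intervalIntegrable_of_bdd ?_ (fun θ hθ => abs_ringNum_div_le ht hθ)
  have := continuous_chord.measurable
  have := continuous_ringNum.measurable
  fun_prop

/-- Pointwise Lipschitz estimate behind the regularity of `ringH`. -/
lemma abs_ringNum_div_sub_le {a b θ : ℝ} (ha : 0 ≤ a) (hb : 0 ≤ b) (h : θ ∈ Set.Icc (-π) π) :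
    |ringNum θ / √(a + chord θ ^ 2) - ringNum θ / √(b + chord θ ^ 2)| ≤ |√a - √b| / 2 := by
  have h1 := abs_ringNum_le h
  have hA := chord_le_sqrt ha θ
  have hB := chord_le_sqrt hb θ
  have h4 := chord_nonneg θ
  have hd := abs_sqrt_add_sub_le ha hb (sq_nonneg (chord θ))
  set A := √(a + chord θ ^ 2)
  set B := √(b + chord θ ^ 2)
  rcases h4.eq_or_lt with h0 | h0
  · have : ringNum θ = 0 := by
      rw [← h0] at h1; simpa using h1
    rw [this]; simp; positivity
  have hA' : 0 < A := h0.trans_le hA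
  have hB' : 0 < B := h0.trans_le hB
  have e : ringNum θ / A - ringNum θ / B = ringNum θ * ((B - A) / (A * B)) := by
    field_simp
  rw [e, abs_mul, abs_div, abs_of_pos (mul_pos hA' hB'), abs_sub_comm]
  have h5 : chord θ ^ 2 ≤ A * B := by nlinarith
  rw [mul_div_assoc', div_le_iff₀ (by positivity)]
  have h6 : |ringNum θ| ≤ A * B / 2 := by linarith
  calc |ringNum θ| * |A - B| ≤ (A * B / 2) * |√a - √b| := by gcongr
    _ = _ := by ring

lemma abs_ringH_sub_le {a b : ℝ} (ha : 0 ≤ a) (hb : 0 ≤ b) :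
    |ringH a - ringH b| ≤ π * |√a - √b| := by
  unfold ringH
  rw [← intervalIntegral.integral_sub (integrable_ringH ha) (integrable_ringH hb)]
  refine (abs_integral_le_of_bdd (fun θ hθ => abs_ringNum_div_sub_le ha hb hθ)).trans (le_of_eq ?_)
  ring

lemma log_sub_log_le {x y : ℝ} (hx : 0 < x) (hy : 0 < y) : log x - log y ≤ (x - y) / y := by
  rw [← Real.log_div hx.ne' hy.ne']
  refine (Real.log_le_sub_one_of_pos (by positivity)).trans (le_of_eq ?_)
  field_simp

lemma abs_log_sub_log_le {x y c : ℝ} (hc : 0 < c) (hx : c ≤ x) (hy : c ≤ y) :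
    |log x - log y| ≤ |x - y| / c := by
  have key : ∀ x y : ℝ, c ≤ x → c ≤ y → log x - log y ≤ |x - y| / c := by
    intro x y hx hy
    refine (log_sub_log_le (by linarith) (by linarith)).trans ?_
    refine (div_le_div_of_nonneg_right (le_abs_self _) (by linarith)).trans ?_
    gcongr
  rw [abs_le]
  constructor
  · have := key y x hy hx; rw [abs_sub_comm] at this; linarith
  · exact key x y hx hy

lemma abs_ringJ_sub_le {a b : ℝ} (ha : 0 ≤ a) (hb : 0 ≤ b) :
    |ringJ a - ringJ b| ≤ 4 * |√a - √b| := by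
  have h1 := abs_ringH_sub_le ha hb
  have h2 : |log (2 + √(4 + a)) - log (2 + √(4 + b))| ≤ |√a - √b| / 4 := by
    have e : (2:ℝ) = √4 := by
      rw [show (4:ℝ) = 2 ^ 2 by norm_num, Real.sqrt_sq (by norm_num)]
    have ga : (2:ℝ) ≤ √(4 + a) := by nth_rewrite 1 [e]; exact Real.sqrt_le_sqrt (by linarith)
    have gb : (2:ℝ) ≤ √(4 + b) := by nth_rewrite 1 [e]; exact Real.sqrt_le_sqrt (by linarith)
    refine (abs_log_sub_log_le (c := 4) (by norm_num) (by linarith) (by linarith)).trans ?_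
    refine div_le_div_of_nonneg_right ?_ (by norm_num)
    have := abs_sqrt_add_sub_le ha hb (show (0:ℝ) ≤ 4 by norm_num)
    rw [add_comm 4 a, add_comm 4 b, add_sub_add_left_eq_sub]
    exact this
  have h3 : π < 3.15 := pi_lt_d2
  have h0 := abs_nonneg (√a - √b)
  unfold ringJ
  calc |ringH a + 2 * log (2 + √(4 + a)) - (ringH b + 2 * log (2 + √(4 + b)))|
      = |(ringH a - ringH b) + 2 * (log (2 + √(4 + a)) - log (2 + √(4 + b)))| := by
        congr 1; ring
    _ ≤ |ringH a - ringH b| + 2 * |log (2 + √(4 + a)) - log (2 + √(4 + b))| := by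
        refine (abs_add_le _ _).trans ?_
        rw [abs_mul, abs_of_pos (by norm_num : (0:ℝ) < 2)]
    _ ≤ π * |√a - √b| + 2 * (|√a - √b| / 4) := by gcongr
    _ ≤ _ := by nlinarith

lemma two_le_sqrt_four_add {a : ℝ} (ha : 0 ≤ a) : 2 ≤ √(4 + a) :=
  Real.le_sqrt_of_sq_le (by linarith)

lemma intervalIntegrable_cos_half {t : ℝ} (ht : 0 < t) :
    IntervalIntegrable (fun θ => cos (θ / 2) / √(t + chord θ ^ 2)) volume (-π) π := by
  apply Continuous.intervalIntegrable
  have := continuous_chord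
  refine Continuous.div (by fun_prop) (by fun_prop) (fun θ => ?_)
  positivity

/-- The explicit singular part of the profile. -/
lemma integral_cos_half {t : ℝ} (ht : 0 < t) :
    ∫ θ in (-π)..π, cos (θ / 2) / √(t + chord θ ^ 2) = 2 * log (2 + √(4 + t)) - log t := by
  have hst : 0 < √t := Real.sqrt_pos.2 ht
  have hd : ∀ θ ∈ Set.uIcc (-π) π, HasDerivAt (fun θ => arsinh (2 * sin (θ / 2) / √t))
      (cos (θ / 2) / √(t + chord θ ^ 2)) θ := by
    intro θ _
    have h1 : HasDerivAt (fun θ : ℝ => 2 * sin (θ / 2) / √t) (cos (θ / 2) / √t) θ := by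
      have h2 : HasDerivAt (fun θ : ℝ => sin (θ / 2)) (cos (θ / 2) * (1 / 2)) θ :=
        ((hasDerivAt_id θ).div_const 2).sin
      exact ((h2.const_mul 2).div_const (√t)).congr_deriv (by ring)
    have h4 := h1.arsinh
    convert h4 using 1
    have e : √(t + chord θ ^ 2) = √t * √(1 + (2 * sin (θ / 2) / √t) ^ 2) := by
      rw [← Real.sqrt_mul ht.le]
      congr 1
      rw [div_pow, Real.sq_sqrt ht.le, mul_add, mul_div_cancel₀ _ ht.ne']
      unfold chord; rw [mul_pow, sq_abs]; ring
    rw [e, smul_eq_mul]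
    have : 0 < √(1 + (2 * sin (θ / 2) / √t) ^ 2) := Real.sqrt_pos.2 (by positivity)
    field_simp
  rw [intervalIntegral.integral_eq_sub_of_hasDerivAt hd (intervalIntegrable_cos_half ht)]
  have e1 : sin (π / 2) = 1 := sin_pi_div_two
  have e2 : sin (-π / 2) = -1 := by rw [neg_div, sin_neg, e1]
  simp only [e1, e2]
  rw [show (2 * -1 / √t : ℝ) = -(2 * 1 / √t) by ring, arsinh_neg]
  have e3 : arsinh (2 * 1 / √t) = log (2 + √(4 + t)) - log t / 2 := by
    unfold arsinh
    have : 2 * 1 / √t + √(1 + (2 * 1 / √t) ^ 2) = (2 + √(4 + t)) / √t := by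
      rw [div_pow, Real.sq_sqrt ht.le]
      rw [show (1 + (2 * 1) ^ 2 / t : ℝ) = (4 + t) / t by field_simp; ring]
      rw [Real.sqrt_div (by linarith)]
      field_simp
    rw [this, Real.log_div (by positivity) hst.ne', Real.log_sqrt ht.le]
  rw [e3]; ring

lemma ringF_eq {t : ℝ} (ht : 0 < t) : ringF t = -log t + ringJ t := by
  unfold ringJ ringH ringF
  have h := intervalIntegral.integral_add (integrable_ringH ht.le) (intervalIntegrable_cos_half ht)
  have e : (fun θ => cos θ / √(t + 2 - 2 * cos θ)) =
      fun θ => ringNum θ / √(t + chord θ ^ 2) + cos (θ / 2) / √(t + chord θ ^ 2) := by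
    ext θ
    rw [chord_sq, ← add_div]; unfold ringNum; congr 2 <;> ring
  rw [e, h, integral_cos_half ht]; ring

lemma integral_inv_sqrt_le {t : ℝ} (ht : 0 < t) (ht1 : t ≤ 1) :
    IntervalIntegrable (fun θ => 1 / √(t + chord θ ^ 2)) volume (-π) π ∧
    ∫ θ in (-π)..π, 1 / √(t + chord θ ^ 2) ≤ |log t| + 7 := by
  have hi : IntervalIntegrable (fun θ => 1 / √(t + chord θ ^ 2)) volume (-π) π := by
    apply Continuous.intervalIntegrable
    have := continuous_chord
    refine Continuous.div (by fun_prop) (by fun_prop) (fun θ => ?_)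
    positivity
  refine ⟨hi, ?_⟩
  have h1 : ∫ θ in (-π)..π, 1 / √(t + chord θ ^ 2) ≤
      ∫ θ in (-π)..π, (cos (θ / 2) / √(t + chord θ ^ 2) + 1 / 2) := by
    refine intervalIntegral.integral_mono_on (by linarith [pi_pos]) hi
      ((intervalIntegrable_cos_half ht).add (by simp)) (fun θ hθ => ?_)
    have h2 := one_sub_cos_half_le hθ
    have h3 := chord_le_sqrt ht.le θ
    have h4 := chord_nonneg θ
    have h5 := chord_le_two θ
    have hA : 0 < √(t + chord θ ^ 2) := by positivity
    rw [div_add' _ _ _ hA.ne', div_le_div_iff_of_pos_right hA]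
    nlinarith
  rw [intervalIntegral.integral_add (intervalIntegrable_cos_half ht) (by simp),
    integral_cos_half ht] at h1
  refine h1.trans ?_
  have h6 : √(4 + t) ≤ 3 := by
    rw [Real.sqrt_le_left (by norm_num)]; linarith
  have h7 : log (2 + √(4 + t)) ≤ √(4 + t) + 1 - √(4+t) + 4/5 := by
    have h8 : log (2 + √(4 + t)) ≤ log 5 := Real.log_le_log (by positivity) (by linarith)
    have h9 : log 5 ≤ 9 / 5 := by
      rw [Real.log_le_iff_le_exp (by norm_num)]
      have := Real.sum_le_exp_of_nonneg (show (0:ℝ) ≤ 9/5 by norm_num) 5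
      refine le_trans ?_ this
      norm_num [Finset.sum_range_succ, Nat.factorial]
    linarith
  have h8 := neg_le_abs (log t)
  have h9 : π < 3.15 := pi_lt_d2
  simp
  nlinarith

/-- Modulus of continuity of `ringH` at the origin. -/
lemma abs_ringH_sub_zero_le {t : ℝ} (ht : 0 < t) (ht1 : t ≤ 1) :
    |ringH t - ringH 0| ≤ t / 4 * (|log t| + 7) := by
  obtain ⟨hi, hle⟩ := integral_inv_sqrt_le ht ht1
  unfold ringH
  rw [← intervalIntegral.integral_sub (integrable_ringH ht.le) (integrable_ringH le_rfl)]
  have hpi : -π ≤ π := by linarith [pi_pos]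
  have h1 : ∀ θ ∈ Set.Icc (-π) π,
      |ringNum θ / √(t + chord θ ^ 2) - ringNum θ / √(0 + chord θ ^ 2)| ≤
        t / 4 * (1 / √(t + chord θ ^ 2)) := by
    intro θ hθ
    have h1 := abs_ringNum_le hθ
    have hA := chord_le_sqrt ht.le θ
    have h4 := chord_nonneg θ
    have e : √(0 + chord θ ^ 2) = chord θ := by rw [zero_add, Real.sqrt_sq h4]
    have hA' : 0 < √(t + chord θ ^ 2) := by positivity
    have hsq := Real.sq_sqrt (show 0 ≤ t + chord θ ^ 2 by positivity)
    rw [e]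
    set A := √(t + chord θ ^ 2)
    rcases h4.eq_or_lt with h0 | h0
    · have : ringNum θ = 0 := by
        rw [← h0] at h1; simpa using h1
      rw [this]; simp; positivity
    have e : ringNum θ / A - ringNum θ / chord θ =
        -(ringNum θ * (t / (A * chord θ * (A + chord θ)))) := by
      rw [show t = (A - chord θ) * (A + chord θ) by nlinarith]
      field_simp
      ring
    rw [e, abs_neg, abs_mul, abs_of_pos (show 0 < t / (A * chord θ * (A + chord θ)) by positivity)]
    calc |ringNum θ| * (t / (A * chord θ * (A + chord θ)))
        ≤ (chord θ ^ 2 / 2) * (t / (A * chord θ * (A + chord θ))) := by gcongr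
      _ = t / (2 * A) * (chord θ / (A + chord θ)) := by field_simp
      _ ≤ t / (2 * A) * (1 / 2) := by
          refine mul_le_mul_of_nonneg_left ?_ (by positivity)
          rw [div_le_div_iff₀ (by positivity) (by norm_num)]; linarith
      _ = _ := by field_simp; norm_num
  have h2 := intervalIntegral.norm_integral_le_of_norm_le hpi
    (f := fun θ => ringNum θ / √(t + chord θ ^ 2) - ringNum θ / √(0 + chord θ ^ 2))
    (Eventually.of_forall fun θ hθ => h1 θ ⟨hθ.1.le, hθ.2⟩) (hi.const_mul _)
  refine h2.trans ?_
  rw [intervalIntegral.integral_const_mul]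
  gcongr

lemma abs_ringJ_sub_zero_le {t : ℝ} (ht : 0 < t) (ht1 : t ≤ 1) :
    |ringJ t - ringJ 0| ≤ t * (|log t| + 3) := by
  have h1 := abs_ringH_sub_zero_le ht ht1
  have h2 : |log (2 + √(4 + t)) - log (2 + √(4 + 0))| ≤ t / 16 := by
    have g1 := two_le_sqrt_four_add ht.le
    have g0 := two_le_sqrt_four_add le_rfl
    refine (abs_log_sub_log_le (c := 4) (by norm_num) (by linarith) (by linarith)).trans ?_
    have e : √(4 + 0 : ℝ) = 2 := by
      rw [show (4 + 0 : ℝ) = 2 ^ 2 by norm_num, Real.sqrt_sq (by norm_num)]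
    rw [e] at *
    rw [abs_of_nonneg (by linarith)]
    have := Real.sq_sqrt (show 0 ≤ 4 + t by linarith)
    nlinarith
  have h0 := abs_nonneg (log t)
  unfold ringJ
  calc |ringH t + 2 * log (2 + √(4 + t)) - (ringH 0 + 2 * log (2 + √(4 + 0)))|
      = |(ringH t - ringH 0) + 2 * (log (2 + √(4 + t)) - log (2 + √(4 + 0)))| := by
        congr 1; ring
    _ ≤ |ringH t - ringH 0| + 2 * |log (2 + √(4 + t)) - log (2 + √(4 + 0))| := by
        refine (abs_add_le _ _).trans ?_
        rw [abs_mul, abs_of_pos (by norm_num : (0:ℝ) < 2)]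
    _ ≤ t / 4 * (|log t| + 7) + 2 * (t / 16) := by gcongr
    _ ≤ _ := by nlinarith

/-- Derivative of `ringJ` away from the origin. -/
def ringJD (a : ℝ) : ℝ :=
  (∫ θ in (-π)..π, -(ringNum θ / (2 * √(a + chord θ ^ 2) ^ 3))) +
    1 / ((2 + √(4 + a)) * √(4 + a))

lemma abs_ringNum_div_cube_le {a θ : ℝ} (ha : 0 < a) (h : θ ∈ Set.Icc (-π) π) :
    |-(ringNum θ / (2 * √(a + chord θ ^ 2) ^ 3))| ≤ 1 / (4 * √a) := by
  have h1 := abs_ringNum_le h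
  have hA := chord_le_sqrt ha.le θ
  have hA2 := sqrt_le_sqrt_add_chord a θ
  have h4 := chord_nonneg θ
  have hsa : 0 < √a := Real.sqrt_pos.2 ha
  set A := √(a + chord θ ^ 2)
  have hA' : 0 < A := hsa.trans_le hA2
  rw [abs_neg, abs_div, abs_of_pos (show 0 < 2 * A ^ 3 by positivity)]
  rw [div_le_div_iff₀ (by positivity) (by positivity)]
  have : chord θ ^ 2 ≤ A ^ 2 := by gcongr
  calc |ringNum θ| * (4 * √a) ≤ (A ^ 2 / 2) * (4 * A) := by gcongr; linarith
    _ = _ := by ring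

lemma integrable_ringJD {a : ℝ} (ha : 0 < a) :
    IntervalIntegrable (fun θ => -(ringNum θ / (2 * √(a + chord θ ^ 2) ^ 3))) volume (-π) π := by
  refine intervalIntegrable_of_bdd ?_ (fun θ hθ => abs_ringNum_div_cube_le ha hθ)
  have := continuous_chord.measurable
  have := continuous_ringNum.measurable
  fun_prop

lemma abs_ringJD_le {a : ℝ} (ha : 0 < a) (ha1 : a ≤ 1) : |ringJD a| ≤ 4 / √a := by
  have hsa : 0 < √a := Real.sqrt_pos.2 ha
  have hsa1 : √a ≤ 1 := Real.sqrt_le_one.2 ha1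
  have h1 := abs_integral_le_of_bdd (fun θ hθ => abs_ringNum_div_cube_le ha hθ)
  have g := two_le_sqrt_four_add ha.le
  have h2 : |1 / ((2 + √(4 + a)) * √(4 + a))| ≤ 1 := by
    rw [abs_of_nonneg (by positivity), div_le_one (by positivity)]
    nlinarith
  have h9 : π < 3.15 := pi_lt_d2
  unfold ringJD
  refine (abs_add_le _ _).trans ((add_le_add h1 h2).trans ?_)
  rw [show 2 * π * (1 / (4 * √a)) + 1 = (π / 2 + √a) / √a by field_simp; ring]
  gcongr
  linarith

lemma abs_ringNum_taylor {a b θ : ℝ} (ha : 0 < a) (hb : 0 < b) (h : θ ∈ Set.Icc (-π) π) :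
    |ringNum θ / √(b + chord θ ^ 2) - ringNum θ / √(a + chord θ ^ 2)
      - (b - a) * -(ringNum θ / (2 * √(a + chord θ ^ 2) ^ 3))|
      ≤ (√a - √b) ^ 2 * (1 / √a + 1 / √b) / 2 := by
  have h1 := abs_ringNum_le h
  have hA := chord_le_sqrt ha.le θ
  have hB := chord_le_sqrt hb.le θ
  have hA2 := sqrt_le_sqrt_add_chord a θ
  have hB2 := sqrt_le_sqrt_add_chord b θ
  have h4 := chord_nonneg θ
  have hd := abs_sqrt_add_sub_le ha.le hb.le (sq_nonneg (chord θ))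
  have eA := Real.sq_sqrt (show 0 ≤ a + chord θ ^ 2 by positivity)
  have eB := Real.sq_sqrt (show 0 ≤ b + chord θ ^ 2 by positivity)
  have hsa : 0 < √a := Real.sqrt_pos.2 ha
  have hsb : 0 < √b := Real.sqrt_pos.2 hb
  set A := √(a + chord θ ^ 2)
  set B := √(b + chord θ ^ 2)
  have hA' : 0 < A := hsa.trans_le hA2
  have hB' : 0 < B := hsb.trans_le hB2
  have e : ringNum θ / B - ringNum θ / A - (b - a) * -(ringNum θ / (2 * A ^ 3))
      = ringNum θ * ((A - B) ^ 2 * (B + 2 * A) / (2 * A ^ 3 * B)) := by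
    rw [show b - a = B ^ 2 - A ^ 2 by linarith]
    field_simp
    ring
  rw [e, abs_mul, abs_of_nonneg
    (show 0 ≤ (A - B) ^ 2 * (B + 2 * A) / (2 * A ^ 3 * B) by positivity)]
  have hq : chord θ ^ 2 ≤ A ^ 2 := by gcongr
  have hd2 : (A - B) ^ 2 ≤ (√a - √b) ^ 2 := sq_le_sq.2 hd
  have i1 : 1 / A ≤ 1 / √a := one_div_le_one_div_of_le hsa hA2
  have i2 : 1 / B ≤ 1 / √b := one_div_le_one_div_of_le hsb hB2
  have i3 : 0 ≤ 1 / A := by positivity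
  calc |ringNum θ| * ((A - B) ^ 2 * (B + 2 * A) / (2 * A ^ 3 * B))
      ≤ (A ^ 2 / 2) * ((A - B) ^ 2 * (B + 2 * A) / (2 * A ^ 3 * B)) := by gcongr; linarith
    _ = (A - B) ^ 2 * ((1 / A) / 2 + 1 / B) / 2 := by field_simp
    _ ≤ (√a - √b) ^ 2 * (1 / √a + 1 / √b) / 2 := by
        have : 1 / A / 2 + 1 / B ≤ 1 / √a + 1 / √b := by linarith
        gcongr

lemma abs_log_taylor {a b : ℝ} (ha : 0 < a) (hb : 0 < b) :
    |log (2 + √(4 + b)) - log (2 + √(4 + a)) - (b - a) / (2 * ((2 + √(4 + a)) * √(4 + a)))|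
      ≤ (√a - √b) ^ 2 := by
  have gP := two_le_sqrt_four_add ha.le
  have gQ := two_le_sqrt_four_add hb.le
  have hd := abs_sqrt_add_sub_le ha.le hb.le (show (0:ℝ) ≤ 4 by norm_num)
  rw [add_comm a, add_comm b] at hd
  have hd2 := sq_le_sq.2 hd
  have eP := Real.sq_sqrt (show 0 ≤ 4 + a by positivity)
  have eQ := Real.sq_sqrt (show 0 ≤ 4 + b by positivity)
  set P := √(4 + a)
  set Q := √(4 + b)
  have up := log_sub_log_le (show 0 < 2 + Q by linarith) (show 0 < 2 + P by linarith)
  have lo := log_sub_log_le (show 0 < 2 + P by linarith) (show 0 < 2 + Q by linarith)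
  have e1 : (b - a) / (2 * ((2 + P) * P)) =
      (Q - P) / (2 + P) + (Q - P) ^ 2 / (2 * ((2 + P) * P)) := by
    rw [show b - a = Q ^ 2 - P ^ 2 by linarith]
    field_simp; ring
  have e2 : (2 + P - (2 + Q)) / (2 + Q) =
      - ((Q - P) / (2 + P)) + (Q - P) ^ 2 / ((2 + P) * (2 + Q)) := by
    field_simp; ring
  have e3 : (2 + Q - (2 + P)) / (2 + P) = (Q - P) / (2 + P) := by congr 1; ring
  have b1 : (Q - P) ^ 2 / (2 * ((2 + P) * P)) ≤ (Q - P) ^ 2 / 4 := by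
    gcongr; nlinarith
  have b2 : (Q - P) ^ 2 / ((2 + P) * (2 + Q)) ≤ (Q - P) ^ 2 / 4 := by
    gcongr; nlinarith
  have b3 : 0 ≤ (Q - P) ^ 2 / (2 * ((2 + P) * P)) := by positivity
  rw [e1]
  rw [e2] at lo
  rw [e3] at up
  rw [abs_le]
  constructor <;> nlinarith

/-- First-order Taylor expansion of `ringJ` away from the origin. -/
lemma abs_ringJ_taylor {a b : ℝ} (ha : 0 < a) (ha1 : a ≤ 1) (hb : 0 < b) :
    |ringJ b - ringJ a - ringJD a * (b - a)| ≤ 6 * ((√a - √b) ^ 2 * (1 / √a + 1 / √b)) := by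
  have hsa : 0 < √a := Real.sqrt_pos.2 ha
  have hsa1 : √a ≤ 1 := Real.sqrt_le_one.2 ha1
  have hsb : 0 < √b := Real.sqrt_pos.2 hb
  have i1 := (integrable_ringH hb.le).sub (integrable_ringH ha.le)
  have h1 := abs_integral_le_of_bdd (fun θ hθ => abs_ringNum_taylor ha hb hθ)
  rw [intervalIntegral.integral_sub i1 ((integrable_ringJD ha).const_mul _),
    intervalIntegral.integral_sub (integrable_ringH hb.le) (integrable_ringH ha.le),
    intervalIntegral.integral_const_mul] at h1
  have h2 := abs_log_taylor ha hb
  have h9 : π < 3.15 := pi_lt_d2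
  have h3 : 1 ≤ 1 / √a + 1 / √b := by
    have := one_le_one_div hsa hsa1
    have : 0 ≤ 1 / √b := by positivity
    linarith
  have h4 : (√a - √b) ^ 2 ≤ (√a - √b) ^ 2 * (1 / √a + 1 / √b) :=
    le_mul_of_one_le_right (sq_nonneg _) h3
  unfold ringJ ringJD
  have e : ringH b + 2 * log (2 + √(4 + b)) - (ringH a + 2 * log (2 + √(4 + a))) -
      ((∫ θ in (-π)..π, -(ringNum θ / (2 * √(a + chord θ ^ 2) ^ 3))) +
        1 / ((2 + √(4 + a)) * √(4 + a))) * (b - a) =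
      (ringH b - ringH a - (b - a) * ∫ θ in (-π)..π, -(ringNum θ / (2 * √(a + chord θ ^ 2) ^ 3)))
      + 2 * (log (2 + √(4 + b)) - log (2 + √(4 + a)) -
        (b - a) / (2 * ((2 + √(4 + a)) * √(4 + a)))) := by
    have gP := two_le_sqrt_four_add ha.le
    field_simp
    ring
  rw [e]
  refine (abs_add_le _ _).trans ?_
  rw [abs_mul, abs_of_pos (by norm_num : (0:ℝ) < 2)]
  unfold ringH
  set S := (√a - √b) ^ 2 * (1 / √a + 1 / √b)
  have hS : 0 ≤ S := by positivity
  nlinarith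

/-- Global upper bound for the profile. -/
lemma ringF_le {t : ℝ} (ht : 0 < t) : ringF t ≤ max (-log t) 0 + (|ringJ 0| + 7) := by
  rcases le_total t 1 with h | h
  · have h1 := abs_ringJ_sub_le ht.le le_rfl
    have hs : √t ≤ 1 := Real.sqrt_le_one.2 h
    rw [Real.sqrt_zero, sub_zero, abs_of_nonneg (Real.sqrt_nonneg _)] at h1
    rw [ringF_eq ht]
    have := abs_le.1 h1
    have := le_abs_self (ringJ 0)
    have := le_max_left (-log t) 0
    linarith
  · have h1 : |ringF t| ≤ 2 * π * 1 := by
      refine abs_integral_le_of_bdd (fun θ _ => ?_)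
      have hq : 2 - 2 * cos θ = chord θ ^ 2 := (chord_sq θ).symm
      rw [add_sub_assoc, hq, abs_div, abs_of_nonneg (Real.sqrt_nonneg _)]
      have : 1 ≤ √(t + chord θ ^ 2) := by
        refine Real.le_sqrt_of_sq_le ?_
        nlinarith [sq_nonneg (chord θ)]
      refine div_le_one_of_le₀ ((abs_cos_le_one θ).trans this) (by positivity)
    have h9 : π < 3.15 := pi_lt_d2
    have := le_abs_self (ringF t)
    have := abs_nonneg (ringJ 0)
    have := le_max_right (-log t) 0
    linarith

/-- Scaled distance to the axis. -/
def axDist (σ : ℝ) (y : ℂ) : ℝ := 1 + σ * y.re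

/-- Relative squared distance of two points in the scaled half plane. -/
def relDist (σ : ℝ) (y w : ℂ) : ℝ := σ ^ 2 * ‖y - w‖ ^ 2 / (axDist σ y * axDist σ w)

lemma abs_axDist_sub_one_le {σ : ℝ} (hσ : 0 < σ) (y : ℂ) : |axDist σ y - 1| ≤ σ * ‖y‖ := by
  unfold axDist
  rw [add_sub_cancel_left, abs_mul, abs_of_pos hσ]
  gcongr
  exact Complex.abs_re_le_norm y

lemma axDist_bounds {σ : ℝ} (hσ : 0 < σ) {y : ℂ} (hy : σ * ‖y‖ ≤ 1 / 8) :
    7 / 8 ≤ axDist σ y ∧ axDist σ y ≤ 9 / 8 := by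
  have := abs_le.1 (abs_axDist_sub_one_le hσ y)
  constructor <;> linarith

lemma sqrt_axDist_bounds {σ : ℝ} (hσ : 0 < σ) {y : ℂ} (hy : σ * ‖y‖ ≤ 1 / 8) :
    9 / 10 ≤ √(axDist σ y) ∧ √(axDist σ y) ≤ 11 / 10 := by
  obtain ⟨h1, h2⟩ := axDist_bounds hσ hy
  constructor
  · exact Real.le_sqrt_of_sq_le (by linarith)
  · rw [Real.sqrt_le_left (by norm_num)]; linarith

lemma abs_axDist_sub_le {σ : ℝ} (hσ : 0 < σ) (y z : ℂ) :
    |axDist σ y - axDist σ z| ≤ σ * ‖y - z‖ := by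
  unfold axDist
  rw [add_sub_add_left_eq_sub, ← mul_sub, ← Complex.sub_re, abs_mul, abs_of_pos hσ]
  gcongr
  exact Complex.abs_re_le_norm _

lemma abs_sqrt_axDist_sub_le {σ : ℝ} (hσ : 0 < σ) {y z : ℂ} (hy : σ * ‖y‖ ≤ 1 / 8)
    (hz : σ * ‖z‖ ≤ 1 / 8) : |√(axDist σ y) - √(axDist σ z)| ≤ σ * ‖y - z‖ := by
  obtain ⟨h1, _⟩ := sqrt_axDist_bounds hσ hy
  obtain ⟨h2, _⟩ := sqrt_axDist_bounds hσ hz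
  have e1 := Real.sq_sqrt (show 0 ≤ axDist σ y by linarith [(axDist_bounds hσ hy).1])
  have e2 := Real.sq_sqrt (show 0 ≤ axDist σ z by linarith [(axDist_bounds hσ hz).1])
  have h3 := abs_axDist_sub_le hσ y z
  rw [← e1, ← e2, sq_sub_sq, abs_mul, abs_of_pos (by linarith)] at h3
  have h4 := abs_nonneg (√(axDist σ y) - √(axDist σ z))
  nlinarith

lemma sqrt_relDist {σ : ℝ} (hσ : 0 < σ) {y w : ℂ} (hy : 0 < axDist σ y) :
    √(relDist σ y w) = σ * ‖y - w‖ / (√(axDist σ y) * √(axDist σ w)) := by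
  unfold relDist
  rw [Real.sqrt_div (by positivity), ← mul_pow, Real.sqrt_sq (by positivity), Real.sqrt_mul hy.le]

lemma relDist_nonneg {σ : ℝ} {y w : ℂ} (hy : 0 < axDist σ y) (hw : 0 < axDist σ w) :
    0 ≤ relDist σ y w := by unfold relDist; positivity

lemma relDist_pos {σ : ℝ} (hσ : 0 < σ) {y w : ℂ} (hy : 0 < axDist σ y) (hw : 0 < axDist σ w)
    (h : y ≠ w) : 0 < relDist σ y w := by
  have : 0 < ‖y - w‖ := norm_pos_iff.2 (sub_ne_zero.2 h)
  unfold relDist; positivity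

lemma abs_sqrt_relDist_sub_le {σ : ℝ} (hσ : 0 < σ) {y z w : ℂ} (hy : σ * ‖y‖ ≤ 1 / 8)
    (hz : σ * ‖z‖ ≤ 1 / 8) (hw : σ * ‖w‖ ≤ 1 / 8) :
    |√(relDist σ y w) - √(relDist σ z w)| ≤ 2 * (σ * ‖y - z‖) := by
  rw [sqrt_relDist hσ (by linarith [(axDist_bounds hσ hy).1]),
    sqrt_relDist hσ (by linarith [(axDist_bounds hσ hz).1])]
  obtain ⟨h1, _⟩ := sqrt_axDist_bounds hσ hy
  obtain ⟨h2, _⟩ := sqrt_axDist_bounds hσ hz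
  obtain ⟨h3, _⟩ := sqrt_axDist_bounds hσ hw
  have h4 := abs_sqrt_axDist_sub_le hσ hy hz
  set a := √(axDist σ y)
  set b := √(axDist σ z)
  set c := √(axDist σ w)
  have hzw : σ * ‖z - w‖ ≤ 1 / 4 := by
    have := norm_sub_le z w
    nlinarith
  have hn : |‖y - w‖ - ‖z - w‖| ≤ ‖y - z‖ := by
    have := abs_norm_sub_norm_le (y - w) (z - w)
    simpa using this
  have ha : 0 < a := by linarith
  have hb : 0 < b := by linarith
  have hc : 0 < c := by linarith
  have e : σ * ‖y - w‖ / (a * c) - σ * ‖z - w‖ / (b * c) =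
      σ * (‖y - w‖ - ‖z - w‖) / (a * c) + (σ * ‖z - w‖) * (b - a) / (a * b * c) := by
    field_simp; ring
  rw [e]
  refine (abs_add_le _ _).trans ?_
  rw [abs_div, abs_div, abs_of_pos (show 0 < a * c by positivity),
    abs_of_pos (show 0 < a * b * c by positivity), abs_mul, abs_mul (σ * ‖z - w‖), abs_of_pos hσ,
    abs_of_nonneg (show 0 ≤ σ * ‖z - w‖ by positivity), abs_sub_comm b a]
  have hac : 81 / 100 ≤ a * c := by nlinarith
  have habc : 729 / 1000 ≤ a * b * c := by nlinarith
  have t1 : σ * |‖y - w‖ - ‖z - w‖| / (a * c) ≤ σ * ‖y - z‖ / (81 / 100) := by gcongr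
  have t2 : σ * ‖z - w‖ * |a - b| / (a * b * c) ≤ 1 / 4 * (σ * ‖y - z‖) / (729 / 1000) := by
    gcongr
  have : 0 ≤ σ * ‖y - z‖ := by positivity
  linarith

lemma abs_ringJ_relDist_sub_le {σ : ℝ} (hσ : 0 < σ) {y z w : ℂ} (hy : σ * ‖y‖ ≤ 1 / 8)
    (hz : σ * ‖z‖ ≤ 1 / 8) (hw : σ * ‖w‖ ≤ 1 / 8) :
    |ringJ (relDist σ y w) - ringJ (relDist σ z w)| ≤ 8 * (σ * ‖y - z‖) := by
  have py : 0 < axDist σ y := by linarith [(axDist_bounds hσ hy).1]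
  have pz : 0 < axDist σ z := by linarith [(axDist_bounds hσ hz).1]
  have pw : 0 < axDist σ w := by linarith [(axDist_bounds hσ hw).1]
  have h1 := abs_ringJ_sub_le (relDist_nonneg py pw) (relDist_nonneg pz pw)
  have h2 := abs_sqrt_relDist_sub_le hσ hy hz hw
  linarith

lemma abs_quot_second_diff {σ X Y ξ ν d h : ℝ} (hσ : 0 < σ) (hd : 0 ≤ d) (hh : 0 ≤ h)
    (m1 : 7 / 8 ≤ X) (m2 : X ≤ 9 / 8) (w1 : 7 / 8 ≤ Y) (p1 : 7 / 8 ≤ X + ξ) (q1 : 7 / 8 ≤ X - ξ)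
    (hξ : |ξ| ≤ σ * h) (hν : |ν| ≤ d * h) (hmw : σ * d ≤ 1 / 4) :
    |σ ^ 2 * (d ^ 2 + 2 * ν + h ^ 2) / ((X + ξ) * Y) +
      σ ^ 2 * (d ^ 2 - 2 * ν + h ^ 2) / ((X - ξ) * Y) - 2 * (σ ^ 2 * d ^ 2 / (X * Y))| ≤
      8 * (σ ^ 2 * h ^ 2) := by
  have e : σ ^ 2 * (d ^ 2 + 2 * ν + h ^ 2) / ((X + ξ) * Y) +
      σ ^ 2 * (d ^ 2 - 2 * ν + h ^ 2) / ((X - ξ) * Y) - 2 * (σ ^ 2 * d ^ 2 / (X * Y)) =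
      σ ^ 2 * (2 * h ^ 2 * X ^ 2 - 4 * (ν * ξ) * X + 2 * (d * ξ) ^ 2) /
        (X * ((X + ξ) * (X - ξ)) * Y) := by
    have : X + ξ ≠ 0 := by linarith
    have : X - ξ ≠ 0 := by linarith
    field_simp
    ring
  rw [e, abs_div]
  have hνξ : |ν * ξ| ≤ h ^ 2 / 4 := by
    rw [abs_mul]
    calc |ν| * |ξ| ≤ (d * h) * (σ * h) := by gcongr
      _ = (σ * d) * h ^ 2 := by ring
      _ ≤ 1 / 4 * h ^ 2 := by gcongr
      _ = _ := by ring
  have hdξ : |d * ξ| ≤ h / 4 := by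
    rw [abs_mul, abs_of_nonneg hd]
    calc d * |ξ| ≤ d * (σ * h) := by gcongr
      _ = (σ * d) * h := by ring
      _ ≤ 1 / 4 * h := by gcongr
      _ = _ := by ring
  have hdξ2 : (d * ξ) ^ 2 ≤ h ^ 2 / 16 := by
    have := pow_le_pow_left₀ (abs_nonneg _) hdξ 2
    rw [sq_abs] at this
    linarith
  have den : (7 / 8 : ℝ) ^ 4 ≤ X * ((X + ξ) * (X - ξ)) * Y := by
    have : (7 / 8 : ℝ) * (7 / 8) ≤ (X + ξ) * (X - ξ) := by gcongr
    have : (7 / 8 : ℝ) * (7 / 8 * (7 / 8)) * (7 / 8) ≤ X * ((X + ξ) * (X - ξ)) * Y := by gcongr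
    linarith
  have num : |σ ^ 2 * (2 * h ^ 2 * X ^ 2 - 4 * (ν * ξ) * X + 2 * (d * ξ) ^ 2)| ≤
      σ ^ 2 * (4 * h ^ 2) := by
    rw [abs_mul, abs_of_nonneg (sq_nonneg σ)]
    gcongr
    have hX : X ^ 2 ≤ 81 / 64 := by nlinarith
    have t1 : |2 * h ^ 2 * X ^ 2| ≤ 2 * h ^ 2 * (81 / 64) := by
      rw [abs_of_nonneg (by positivity)]; gcongr
    have t2 : |4 * (ν * ξ) * X| ≤ 4 * (h ^ 2 / 4) * (9 / 8) := by
      rw [abs_mul, abs_mul, abs_of_pos (by norm_num : (0:ℝ) < 4),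
        abs_of_nonneg (by linarith : 0 ≤ X)]
      gcongr
    have t3 : |2 * (d * ξ) ^ 2| ≤ 2 * (h ^ 2 / 16) := by
      rw [abs_of_nonneg (by positivity)]; gcongr
    have := abs_add_le (2 * h ^ 2 * X ^ 2 - 4 * (ν * ξ) * X) (2 * (d * ξ) ^ 2)
    have := abs_sub (2 * h ^ 2 * X ^ 2) (4 * (ν * ξ) * X)
    linarith [sq_nonneg h]
  have denp : 0 < X * ((X + ξ) * (X - ξ)) * Y := lt_of_lt_of_le (by norm_num) den
  rw [abs_of_pos denp, div_le_iff₀ denp]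
  have : 0 ≤ σ ^ 2 * h ^ 2 := by positivity
  nlinarith

lemma abs_relDist_second_diff {σ : ℝ} (hσ : 0 < σ) {m v w : ℂ} (hm : σ * ‖m‖ ≤ 1 / 8)
    (hp : σ * ‖m + v‖ ≤ 1 / 8) (hq : σ * ‖m - v‖ ≤ 1 / 8) (hw : σ * ‖w‖ ≤ 1 / 8) :
    |relDist σ (m + v) w + relDist σ (m - v) w - 2 * relDist σ m w| ≤ 8 * (σ ^ 2 * ‖v‖ ^ 2) := by
  obtain ⟨m1, m2⟩ := axDist_bounds hσ hm
  obtain ⟨p1, p2⟩ := axDist_bounds hσ hp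
  obtain ⟨q1, q2⟩ := axDist_bounds hσ hq
  obtain ⟨w1, w2⟩ := axDist_bounds hσ hw
  have eP : axDist σ (m + v) = axDist σ m + σ * v.re := by simp [axDist]; ring
  have eQ : axDist σ (m - v) = axDist σ m - σ * v.re := by simp [axDist]; ring
  have hξ : |σ * v.re| ≤ σ * ‖v‖ := by
    rw [abs_mul, abs_of_pos hσ]; gcongr; exact Complex.abs_re_le_norm v
  have hN1 : ‖m + v - w‖ ^ 2 = ‖m - w‖ ^ 2 + 2 * inner ℝ (m - w) v + ‖v‖ ^ 2 := by
    rw [show m + v - w = (m - w) + v by ring]; exact norm_add_sq_real _ _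
  have hN2 : ‖m - v - w‖ ^ 2 = ‖m - w‖ ^ 2 - 2 * inner ℝ (m - w) v + ‖v‖ ^ 2 := by
    rw [show m - v - w = (m - w) - v by ring]; exact norm_sub_sq_real _ _
  have hν := abs_real_inner_le_norm (m - w) v
  have hmw : σ * ‖m - w‖ ≤ 1 / 4 := by
    have := norm_sub_le m w
    nlinarith
  unfold relDist
  rw [hN1, hN2]
  rw [eP] at p1 ⊢
  rw [eQ] at q1 ⊢
  exact abs_quot_second_diff hσ (norm_nonneg _) (norm_nonneg _) m1 m2 w1 p1 q1 hξ hν hmw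

/-- Second-difference estimate for the regular part of the ring kernel. -/
lemma abs_ringJ_second_diff {σ : ℝ} (hσ : 0 < σ) {m v w : ℂ} (hm : σ * ‖m‖ ≤ 1 / 8)
    (hp : σ * ‖m + v‖ ≤ 1 / 8) (hq : σ * ‖m - v‖ ≤ 1 / 8) (hw : σ * ‖w‖ ≤ 1 / 8) (hmw : m ≠ w) :
    |ringJ (relDist σ (m + v) w) + ringJ (relDist σ (m - v) w) - 2 * ringJ (relDist σ m w)| ≤
      600 * (σ * ‖v‖ ^ 2 / ‖m - w‖) := by
  have hd : 0 < ‖m - w‖ := norm_pos_iff.2 (sub_ne_zero.2 hmw)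
  rcases lt_or_ge ‖m - w‖ (2 * ‖v‖) with hc | hc
  · have h1 := abs_ringJ_relDist_sub_le hσ hp hm hw
    have h2 := abs_ringJ_relDist_sub_le hσ hq hm hw
    rw [add_sub_cancel_left] at h1
    rw [show m - v - m = -v by ring, norm_neg] at h2
    have h3 : ‖v‖ ≤ 2 * (‖v‖ ^ 2 / ‖m - w‖) := by
      rw [← mul_div_assoc, le_div_iff₀ hd]; nlinarith [norm_nonneg v]
    have h4 : σ * ‖v‖ ^ 2 / ‖m - w‖ = σ * (‖v‖ ^ 2 / ‖m - w‖) := by ring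
    have h5 : σ * ‖v‖ ≤ σ * (2 * (‖v‖ ^ 2 / ‖m - w‖)) := by gcongr
    have h6 : 0 ≤ σ * (‖v‖ ^ 2 / ‖m - w‖) := by positivity
    rw [h4]
    rw [abs_le] at *
    constructor <;> linarith [h1.1, h1.2, h2.1, h2.2]
  · have pm : 0 < axDist σ m := by linarith [(axDist_bounds hσ hm).1]
    have pp : 0 < axDist σ (m + v) := by linarith [(axDist_bounds hσ hp).1]
    have pq : 0 < axDist σ (m - v) := by linarith [(axDist_bounds hσ hq).1]
    have pw : 0 < axDist σ w := by linarith [(axDist_bounds hσ hw).1]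
    have np : ‖m - w‖ / 2 ≤ ‖m + v - w‖ := by
      have := norm_sub_le (m + v - w) v
      rw [show m + v - w - v = m - w by ring] at this
      linarith
    have nq : ‖m - w‖ / 2 ≤ ‖m - v - w‖ := by
      have := norm_add_le (m - v - w) v
      rw [show m - v - w + v = m - w by ring] at this
      linarith
    have low : ∀ y : ℂ, σ * ‖y‖ ≤ 1 / 8 → ‖m - w‖ / 2 ≤ ‖y - w‖ →
        σ * ‖m - w‖ / 4 ≤ √(relDist σ y w) := by
      intro y hy hyw
      obtain ⟨a1, a2⟩ := sqrt_axDist_bounds hσ hy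
      obtain ⟨b1, b2⟩ := sqrt_axDist_bounds hσ hw
      rw [sqrt_relDist hσ (by linarith [(axDist_bounds hσ hy).1])]
      rw [div_le_div_iff₀ (by norm_num) (by positivity)]
      have : √(axDist σ y) * √(axDist σ w) ≤ 11 / 10 * (11 / 10) := by gcongr
      have h2 : σ * (‖m - w‖ / 2) ≤ σ * ‖y - w‖ := by gcongr
      have h3 : 0 < σ * ‖m - w‖ := by positivity
      nlinarith
    have ha := low m hm (by linarith)
    have hb := low _ hp np
    have hc' := low _ hq nq
    have hs : 0 < σ * ‖m - w‖ / 4 := by positivity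
    have ra : 0 < relDist σ m w := Real.sqrt_pos.1 (hs.trans_le ha)
    have rb : 0 < relDist σ (m + v) w := Real.sqrt_pos.1 (hs.trans_le hb)
    have rc : 0 < relDist σ (m - v) w := Real.sqrt_pos.1 (hs.trans_le hc')
    have ra1 : relDist σ m w ≤ 1 := by
      unfold relDist
      rw [div_le_one (by positivity)]
      have h1 := (axDist_bounds hσ hm).1
      have h2 := (axDist_bounds hσ hw).1
      have h3 : σ * ‖m - w‖ ≤ 1 / 4 := by
        have := norm_sub_le m w
        nlinarith
      have h4 : (σ * ‖m - w‖) ^ 2 ≤ (1 / 4) ^ 2 := by gcongr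
      nlinarith
    have T1 := abs_ringJ_taylor ra ra1 rb
    have T2 := abs_ringJ_taylor ra ra1 rc
    have L1 := abs_sqrt_relDist_sub_le hσ hm hp hw
    have L2 := abs_sqrt_relDist_sub_le hσ hm hq hw
    rw [show m - (m + v) = -v by ring, norm_neg] at L1
    rw [show m - (m - v) = v by ring] at L2
    have D := abs_ringJD_le ra ra1
    have S := abs_relDist_second_diff hσ hm hp hq hw
    set a := relDist σ m w
    set b := relDist σ (m + v) w
    set c := relDist σ (m - v) w
    set d := ‖m - w‖
    set h := ‖v‖
    have hh : 0 ≤ h := norm_nonneg _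
    have ia : 1 / √a ≤ 4 / (σ * d) := by
      refine (one_div_le_one_div_of_le hs ha).trans (le_of_eq ?_); field_simp
    have ib : 1 / √b ≤ 4 / (σ * d) := by
      refine (one_div_le_one_div_of_le hs hb).trans (le_of_eq ?_); field_simp
    have ic : 1 / √c ≤ 4 / (σ * d) := by
      refine (one_div_le_one_div_of_le hs hc').trans (le_of_eq ?_); field_simp
    have Q1 : (√a - √b) ^ 2 ≤ (2 * (σ * h)) ^ 2 := by
      rw [← sq_abs]; gcongr
    have Q2 : (√a - √c) ^ 2 ≤ (2 * (σ * h)) ^ 2 := by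
      rw [← sq_abs]; gcongr
    have ia0 : 0 ≤ 1 / √a := by positivity
    have ib0 : 0 ≤ 1 / √b := by positivity
    have ic0 : 0 ≤ 1 / √c := by positivity
    have R1 : (√a - √b) ^ 2 * (1 / √a + 1 / √b) ≤
        (2 * (σ * h)) ^ 2 * (4 / (σ * d) + 4 / (σ * d)) := by
      gcongr
    have R2 : (√a - √c) ^ 2 * (1 / √a + 1 / √c) ≤
        (2 * (σ * h)) ^ 2 * (4 / (σ * d) + 4 / (σ * d)) := by
      gcongr
    have R3 : |ringJD a * (b + c - 2 * a)| ≤ (16 / (σ * d)) * (8 * (σ ^ 2 * h ^ 2)) := by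
      rw [abs_mul]
      have : |ringJD a| ≤ 16 / (σ * d) := by
        refine D.trans ?_
        have e1 : 4 / √a = 4 * (1 / √a) := by ring
        have e2 : 16 / (σ * d) = 4 * (4 / (σ * d)) := by ring
        rw [e1, e2]; gcongr
      gcongr
    have e1 : (2 * (σ * h)) ^ 2 * (4 / (σ * d) + 4 / (σ * d)) = 32 * (σ * h ^ 2 / d) := by
      field_simp; ring
    have e2 : (16 / (σ * d)) * (8 * (σ ^ 2 * h ^ 2)) = 128 * (σ * h ^ 2 / d) := by
      field_simp; ring
    rw [e1] at R1 R2
    rw [e2] at R3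
    have e3 : ringJ b + ringJ c - 2 * ringJ a = (ringJ b - ringJ a - ringJD a * (b - a)) +
      (ringJ c - ringJ a - ringJD a * (c - a)) + ringJD a * (b + c - 2 * a) := by ring
    rw [e3]
    refine (abs_add_three _ _ _).trans ?_
    have : 0 ≤ σ * h ^ 2 / d := by positivity
    linarith

/-- A locally integrable power singularity dominating the logarithmic kernel and its gradient. -/
def sing (y w : ℂ) : ℝ := ‖y - w‖ ^ (-(3 / 2) : ℝ)

lemma sing_nonneg (y w : ℂ) : 0 ≤ sing y w := by unfold sing; positivity

lemma measurable_sing (y : ℂ) : Measurable (sing y) := by unfold sing; fun_prop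

lemma volume_real_ball (y : ℂ) {r : ℝ} (hr : 0 ≤ r) :
    volume.real (Metric.ball y r) = π * r ^ 2 := by
  rw [Measure.real, Complex.volume_ball]
  simp [hr]; ring

lemma indicator_ball_sing_eq (r : ℝ) :
    (Metric.ball (0:ℂ) r).indicator (sing 0) =
      fun w => (Set.Iio r).indicator (fun s : ℝ => s ^ (-(3 / 2) : ℝ)) ‖w‖ := by
  ext w
  by_cases h : ‖w‖ < r
  · rw [Set.indicator_of_mem (by simpa using h), Set.indicator_of_mem (by simpa using h)]
    simp [sing]
  · rw [Set.indicator_of_notMem (by simpa using h), Set.indicator_of_notMem (by simpa using h)]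

lemma mul_indicator_rpow_eqOn (r : ℝ) :
    Set.EqOn (fun s : ℝ => s ^ (Module.finrank ℝ ℂ - 1) • (Set.Iio r).indicator
        (fun s : ℝ => s ^ (-(3 / 2) : ℝ)) s)
      ((Set.Ioo 0 r).indicator (fun s : ℝ => s ^ (-(1 / 2) : ℝ))) (Set.Ioi 0) := by
  intro s hs
  simp only [Set.mem_Ioi] at hs
  by_cases h : s < r
  · rw [Set.indicator_of_mem (show s ∈ Set.Ioo 0 r from ⟨hs, h⟩)]
    simp only [Complex.finrank_real_complex, Set.mem_Iio, h, Set.indicator_of_mem]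
    rw [show (2 - 1 : ℕ) = 1 by norm_num, pow_one, smul_eq_mul]
    nth_rewrite 1 [← Real.rpow_one s]
    rw [← Real.rpow_add hs]; norm_num
  · rw [Set.indicator_of_notMem (show s ∉ Set.Ioo 0 r from fun h' => h h'.2)]
    simp [h]

lemma integrable_rpow_Ioo {r : ℝ} (hr : 0 ≤ r) :
    IntegrableOn (fun s : ℝ => s ^ (-(1 / 2) : ℝ)) (Set.Ioo 0 r) := by
  have := intervalIntegral.intervalIntegrable_rpow' (a := 0) (b := r) (r := -(1 / 2)) (by norm_num)
  rw [intervalIntegrable_iff_integrableOn_Ioo_of_le hr] at this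
  exact this

lemma sing_ball_zero {r : ℝ} (hr : 0 ≤ r) :
    Integrable ((Metric.ball (0:ℂ) r).indicator (sing 0)) ∧
      ∫ w, (Metric.ball (0:ℂ) r).indicator (sing 0) w = 4 * π * √r := by
  rw [indicator_ball_sing_eq]
  have hi := integrable_rpow_Ioo hr
  constructor
  · rw [integrable_fun_norm_addHaar]
    rw [integrableOn_congr_fun (mul_indicator_rpow_eqOn r) measurableSet_Ioi]
    exact ((integrable_indicator_iff measurableSet_Ioo).2 hi).integrableOn
  · rw [integral_fun_norm_addHaar volume ((Set.Iio r).indicator (fun s : ℝ => s ^ (-(3 / 2) : ℝ)))]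
    rw [setIntegral_congr_fun measurableSet_Ioi (mul_indicator_rpow_eqOn r)]
    rw [setIntegral_indicator measurableSet_Ioo]
    rw [show Set.Ioi (0:ℝ) ∩ Set.Ioo 0 r = Set.Ioo 0 r by
      ext s; simp only [Set.mem_inter_iff, Set.mem_Ioi, Set.mem_Ioo]; tauto]
    rw [← integral_Ioc_eq_integral_Ioo, ← intervalIntegral.integral_of_le hr,
      integral_rpow (Or.inl (by norm_num)), volume_real_ball 0 zero_le_one, Real.sqrt_eq_rpow]
    rw [Real.zero_rpow (by norm_num)]
    norm_num
    ring

lemma sing_ball (y : ℂ) {r : ℝ} (hr : 0 ≤ r) :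
    IntegrableOn (sing y) (Metric.ball y r) ∧ ∫ w in Metric.ball y r, sing y w = 4 * π * √r := by
  obtain ⟨h1, h2⟩ := sing_ball_zero hr
  have e : (Metric.ball y r).indicator (sing y) =
      fun w => (Metric.ball (0:ℂ) r).indicator (sing 0) (w - y) := by
    ext w
    by_cases h : w ∈ Metric.ball y r
    · rw [Set.indicator_of_mem h, Set.indicator_of_mem (by simpa [dist_eq_norm] using h)]
      unfold sing; rw [zero_sub, neg_sub]
    · rw [Set.indicator_of_notMem h, Set.indicator_of_notMem (by simpa [dist_eq_norm] using h)]
  rw [← integrable_indicator_iff Metric.isOpen_ball.measurableSet,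
    ← integral_indicator Metric.isOpen_ball.measurableSet, e]
  exact ⟨h1.comp_sub_right y, by rw [integral_sub_right_eq_self
      (fun w => (Metric.ball (0:ℂ) r).indicator (sing 0) w) y, h2]⟩

lemma sing_le_of_notMem_ball {y w : ℂ} {r : ℝ} (hr : 0 < r) (h : w ∉ Metric.ball y r) :
    sing y w ≤ r ^ (-(3 / 2) : ℝ) := by
  have : r ≤ ‖y - w‖ := by
    rw [Metric.mem_ball, dist_comm, dist_eq_norm, not_lt] at h; exact h
  exact Real.rpow_le_rpow_of_nonpos hr this (by norm_num)

lemma integrableOn_sing (y : ℂ) {Z : Set ℂ} (hZ : MeasurableSet Z) (hf : volume Z ≠ ⊤) :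
    IntegrableOn (sing y) Z := by
  have h1 : IntegrableOn (sing y) (Z ∩ Metric.ball y 1) :=
    (sing_ball y zero_le_one).1.mono_set Set.inter_subset_right
  have h2 : IntegrableOn (sing y) (Z \ Metric.ball y 1) := by
    refine Measure.integrableOn_of_bounded (M := 1)
        (ne_top_of_le_ne_top hf (measure_mono Set.sdiff_subset))
      (measurable_sing y).aestronglyMeasurable ?_
    filter_upwards [ae_restrict_mem (hZ.diff Metric.isOpen_ball.measurableSet)] with w hw
    rw [Real.norm_of_nonneg (sing_nonneg y w)]
    simpa using sing_le_of_notMem_ball zero_lt_one hw.2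
  have := h1.union h2
  rwa [Set.inter_union_sdiff] at this

/-- Integral of the singular kernel over a set of finite area. -/
lemma integral_sing_le (y : ℂ) {Z : Set ℂ} (hZ : MeasurableSet Z) (hf : volume Z ≠ ⊤) :
    ∫ w in Z, sing y w ≤ 14 * volume.real Z ^ (1 / 4 : ℝ) := by
  have hi := integrableOn_sing y hZ hf
  rcases (measureReal_nonneg (μ := volume) (s := Z)).eq_or_lt with h0 | h0
  · have : volume Z = 0 := by
      rw [Measure.real, eq_comm, ENNReal.toReal_eq_zero_iff] at h0
      tauto
    rw [setIntegral_measure_zero _ this]; positivity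
  set V := volume.real Z
  set r := √V
  have hr : 0 < r := Real.sqrt_pos.2 h0
  rw [← Set.inter_union_sdiff Z (Metric.ball y r)]
  rw [setIntegral_union (Set.disjoint_sdiff_inter.symm) (hZ.diff Metric.isOpen_ball.measurableSet)
    (hi.mono_set Set.inter_subset_left) (hi.mono_set Set.sdiff_subset)]
  have h1 : ∫ w in Z ∩ Metric.ball y r, sing y w ≤ 4 * π * √r := by
    rw [← (sing_ball y hr.le).2]
    exact setIntegral_mono_set (sing_ball y hr.le).1 (Eventually.of_forall fun w => sing_nonneg y w)
      (Eventually.of_forall fun w hw => hw.2)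
  have h2 : ∫ w in Z \ Metric.ball y r, sing y w ≤ r ^ (-(3 / 2) : ℝ) * V := by
    have h3 : ∫ w in Z \ Metric.ball y r, sing y w ≤
        ∫ w in Z \ Metric.ball y r, r ^ (-(3 / 2) : ℝ) := by
      refine setIntegral_mono_on (hi.mono_set Set.sdiff_subset) ?_
        (hZ.diff Metric.isOpen_ball.measurableSet) (fun w hw => sing_le_of_notMem_ball hr hw.2)
      exact integrableOn_const (ne_top_of_le_ne_top hf (measure_mono Set.sdiff_subset))
    rw [setIntegral_const, smul_eq_mul, mul_comm] at h3
    refine h3.trans ?_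
    gcongr
    exact measureReal_mono Set.sdiff_subset hf
  have e1 : √r = V ^ (1 / 4 : ℝ) := by
    simp only [r, Real.sqrt_eq_rpow]
    rw [← Real.rpow_mul h0.le]; norm_num
  have e2 : r ^ (-(3 / 2) : ℝ) * V = V ^ (1 / 4 : ℝ) := by
    simp only [r, Real.sqrt_eq_rpow]
    rw [← Real.rpow_mul h0.le]
    nth_rewrite 2 [← Real.rpow_one V]
    rw [← Real.rpow_add h0]; norm_num
  rw [e1] at h1
  rw [e2] at h2
  have h9 : π < 3.15 := pi_lt_d2
  have h10 : 0 ≤ V ^ (1 / 4 : ℝ) := by positivity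
  nlinarith

lemma abs_log_le_sing {y w : ℂ} (h : y ≠ w) : |log ‖y - w‖| ≤ sing y w + ‖y - w‖ := by
  have hd : 0 < ‖y - w‖ := norm_pos_iff.2 (sub_ne_zero.2 h)
  have h1 := Real.log_le_self hd.le
  have h2 := Real.log_le_self (show 0 ≤ sing y w from sing_nonneg y w)
  have e : log (sing y w) = -(3 / 2) * log ‖y - w‖ := by unfold sing; rw [Real.log_rpow hd]
  have := sing_nonneg y w
  rw [abs_le]; constructor
  · rcases le_total 0 (log ‖y - w‖) with h | h <;> linarith
  · linarith

lemma inv_le_sing {y w : ℂ} (h : y ≠ w) : 1 / ‖y - w‖ ≤ sing y w + 1 := by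
  have hd : 0 < ‖y - w‖ := norm_pos_iff.2 (sub_ne_zero.2 h)
  have := sing_nonneg y w
  rcases le_total ‖y - w‖ 1 with h1 | h1
  · have : 1 / ‖y - w‖ ≤ sing y w := by
      unfold sing
      rw [one_div, ← Real.rpow_neg_one]
      exact Real.rpow_le_rpow_of_exponent_ge hd h1 (by norm_num)
    linarith
  · have : 1 / ‖y - w‖ ≤ 1 := by rw [div_le_one hd]; exact h1
    linarith

lemma abs_log_norm_sub_le {y z w : ℂ} (hy : y ≠ w) (hz : z ≠ w) :
    |log ‖y - w‖ - log ‖z - w‖| ≤ ‖y - z‖ * (sing y w + sing z w + 2) := by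
  have hd : 0 < ‖y - w‖ := norm_pos_iff.2 (sub_ne_zero.2 hy)
  have he : 0 < ‖z - w‖ := norm_pos_iff.2 (sub_ne_zero.2 hz)
  have h1 := inv_le_sing hy
  have h2 := inv_le_sing hz
  have h3 := log_sub_log_le hd he
  have h4 := log_sub_log_le he hd
  have hn : |‖y - w‖ - ‖z - w‖| ≤ ‖y - z‖ := by
    have := abs_norm_sub_norm_le (y - w) (z - w)
    simpa using this
  have h5 := abs_le.1 hn
  have i1 : 0 < 1 / ‖y - w‖ := by positivity
  have i2 : 0 < 1 / ‖z - w‖ := by positivity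
  rw [div_eq_mul_one_div] at h3 h4
  have h0 := norm_nonneg (y - z)
  rw [abs_le]; constructor <;> nlinarith

lemma log_one_add_le_rpow {x : ℝ} (hx : 0 ≤ x) : log (1 + x) ≤ 4 / 3 * x ^ (3 / 4 : ℝ) := by
  have h1 : log ((1 + x) ^ (3 / 4 : ℝ)) = 3 / 4 * log (1 + x) := Real.log_rpow (by linarith) _
  have h2 : log ((1 + x) ^ (3 / 4 : ℝ)) ≤ (1 + x) ^ (3 / 4 : ℝ) - 1 :=
    Real.log_le_sub_one_of_pos (by positivity)
  have h3 : (1 + x) ^ (3 / 4 : ℝ) ≤ 1 ^ (3 / 4 : ℝ) + x ^ (3 / 4 : ℝ) :=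
    Real.rpow_add_le_add_rpow zero_le_one hx (by norm_num) (by norm_num)
  rw [Real.one_rpow] at h3
  linarith

lemma norm_add_mul_norm_sub (a v : ℂ) : ‖a + v‖ * ‖a - v‖ = ‖a ^ 2 - v ^ 2‖ := by
  rw [← norm_mul]; congr 1; ring

/-- Bounds for the second difference of the logarithmic kernel. -/
lemma log_second_diff_bounds {a v : ℂ} (ha : a ≠ 0) (hp : a + v ≠ 0) (hq : a - v ≠ 0) :
    log ‖a + v‖ + log ‖a - v‖ - 2 * log ‖a‖ ≤ log (1 + ‖v‖ ^ 2 / ‖a‖ ^ 2) ∧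
    2 * log ‖a‖ - (log ‖a + v‖ + log ‖a - v‖) ≤ log (1 + ‖v‖ ^ 2 / (‖a + v‖ * ‖a - v‖)) := by
  have hA : 0 < ‖a‖ := norm_pos_iff.2 ha
  have hP : 0 < ‖a + v‖ := norm_pos_iff.2 hp
  have hQ : 0 < ‖a - v‖ := norm_pos_iff.2 hq
  have h1 : log ‖a + v‖ + log ‖a - v‖ = log (‖a + v‖ * ‖a - v‖) := (Real.log_mul hP.ne' hQ.ne').symm
  have h2 : 2 * log ‖a‖ = log (‖a‖ ^ 2) := by rw [Real.log_pow]; norm_num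
  have hpq : 0 < ‖a + v‖ * ‖a - v‖ := by positivity
  rw [h1, h2, ← Real.log_div hpq.ne' (by positivity), ← Real.log_div (by positivity) hpq.ne']
  have t1 : ‖a + v‖ * ‖a - v‖ ≤ ‖a‖ ^ 2 + ‖v‖ ^ 2 := by
    rw [norm_add_mul_norm_sub, ← norm_pow, ← norm_pow]; exact norm_sub_le _ _
  have t2 : ‖a‖ ^ 2 ≤ ‖a + v‖ * ‖a - v‖ + ‖v‖ ^ 2 := by
    rw [norm_add_mul_norm_sub, ← norm_pow, ← norm_pow]
    have := norm_add_le (a ^ 2 - v ^ 2) (v ^ 2)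
    rwa [sub_add_cancel] at this
  constructor
  · apply Real.log_le_log (by positivity)
    rw [div_le_iff₀ (by positivity), add_mul, div_mul_cancel₀ _ (by positivity)]
    linarith
  · apply Real.log_le_log (by positivity)
    rw [div_le_iff₀ (by positivity), add_mul, div_mul_cancel₀ _ (by positivity)]
    linarith

lemma div_sq_rpow {h A : ℝ} (hh : 0 ≤ h) (hA : 0 < A) :
    (h ^ 2 / A ^ 2) ^ (3 / 4 : ℝ) = h ^ (3 / 2 : ℝ) * A ^ (-(3 / 2) : ℝ) := by
  rw [← div_pow, ← Real.rpow_natCast, ← Real.rpow_mul (by positivity), Real.div_rpow hh hA.le,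
    Real.rpow_neg hA.le]
  norm_num [div_eq_mul_inv]

lemma abs_log_second_diff_le_sing {m v w : ℂ} (ha : m ≠ w) (hp : m + v ≠ w) (hq : m - v ≠ w) :
    |log ‖m + v - w‖ + log ‖m - v - w‖ - 2 * log ‖m - w‖| ≤
      4 / 3 * (‖v‖ ^ (3 / 2 : ℝ) * (sing m w + sing (m + v) w + sing (m - v) w)) := by
  have e1 : m + v - w = (m - w) + v := by ring
  have e2 : m - v - w = (m - w) - v := by ring
  obtain ⟨h1, h2⟩ := log_second_diff_bounds (a := m - w) (v := v) (sub_ne_zero.2 ha)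
    (by rw [← e1]; exact sub_ne_zero.2 hp) (by rw [← e2]; exact sub_ne_zero.2 hq)
  have hA : 0 < ‖m - w‖ := norm_pos_iff.2 (sub_ne_zero.2 ha)
  have hP : 0 < ‖m + v - w‖ := norm_pos_iff.2 (sub_ne_zero.2 hp)
  have hQ : 0 < ‖m - v - w‖ := norm_pos_iff.2 (sub_ne_zero.2 hq)
  rw [← e1, ← e2] at h1 h2
  unfold sing
  set A := ‖m - w‖
  set P := ‖m + v - w‖
  set Q := ‖m - v - w‖
  set h := ‖v‖
  have hh : 0 ≤ h := norm_nonneg v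
  have n0 : 0 ≤ h ^ (3 / 2 : ℝ) := by positivity
  have nA : 0 ≤ h ^ (3 / 2 : ℝ) * A ^ (-(3 / 2) : ℝ) := by positivity
  have nP : 0 ≤ h ^ (3 / 2 : ℝ) * P ^ (-(3 / 2) : ℝ) := by positivity
  have nQ : 0 ≤ h ^ (3 / 2 : ℝ) * Q ^ (-(3 / 2) : ℝ) := by positivity
  have b1 := log_one_add_le_rpow (show 0 ≤ h ^ 2 / A ^ 2 by positivity)
  rw [div_sq_rpow hh hA] at b1
  have b2 : log (1 + h ^ 2 / (P * Q)) ≤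
      4 / 3 * (h ^ (3 / 2 : ℝ) * P ^ (-(3 / 2) : ℝ) + h ^ (3 / 2 : ℝ) * Q ^ (-(3 / 2) : ℝ)) := by
    rcases le_total P Q with hPQ | hPQ
    · have b3 := log_one_add_le_rpow (show 0 ≤ h ^ 2 / P ^ 2 by positivity)
      rw [div_sq_rpow hh hP] at b3
      have : log (1 + h ^ 2 / (P * Q)) ≤ log (1 + h ^ 2 / P ^ 2) := by
        apply Real.log_le_log (by positivity)
        gcongr; nlinarith
      linarith
    · have b3 := log_one_add_le_rpow (show 0 ≤ h ^ 2 / Q ^ 2 by positivity)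
      rw [div_sq_rpow hh hQ] at b3
      have : log (1 + h ^ 2 / (P * Q)) ≤ log (1 + h ^ 2 / Q ^ 2) := by
        apply Real.log_le_log (by positivity)
        gcongr; nlinarith
      linarith
  rw [abs_le]
  constructor <;> nlinarith

lemma abs_log_second_diff_le_of_far {m v w : ℂ} (ha : m ≠ w) (hf : 2 * ‖v‖ ≤ ‖m - w‖) :
    |log ‖m + v - w‖ + log ‖m - v - w‖ - 2 * log ‖m - w‖| ≤ 4 / 3 * (‖v‖ ^ 2 / ‖m - w‖ ^ 2) := by
  have hA : 0 < ‖m - w‖ := norm_pos_iff.2 (sub_ne_zero.2 ha)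
  have e1 : m + v - w = (m - w) + v := by ring
  have e2 : m - v - w = (m - w) - v := by ring
  have np : ‖m - w‖ / 2 ≤ ‖(m - w) + v‖ := by
    have := norm_sub_le ((m - w) + v) v
    rw [add_sub_cancel_right] at this
    linarith
  have nq : ‖m - w‖ / 2 ≤ ‖(m - w) - v‖ := by
    have := norm_add_le ((m - w) - v) v
    rw [sub_add_cancel] at this
    linarith
  obtain ⟨h1, h2⟩ := log_second_diff_bounds (a := m - w) (v := v) (sub_ne_zero.2 ha)
    (norm_pos_iff.1 (by linarith)) (norm_pos_iff.1 (by linarith))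
  have t2 : ‖m - w‖ ^ 2 ≤ ‖(m - w) + v‖ * ‖(m - w) - v‖ + ‖v‖ ^ 2 := by
    rw [norm_add_mul_norm_sub, ← norm_pow, ← norm_pow]
    have := norm_add_le ((m - w) ^ 2 - v ^ 2) (v ^ 2)
    rwa [sub_add_cancel] at this
  rw [e1, e2]
  set A := ‖m - w‖
  set P := ‖(m - w) + v‖
  set Q := ‖(m - w) - v‖
  set h := ‖v‖
  have hh : 0 ≤ h := norm_nonneg v
  have c1 : log (1 + h ^ 2 / A ^ 2) ≤ h ^ 2 / A ^ 2 := by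
    have := Real.log_le_sub_one_of_pos (show 0 < 1 + h ^ 2 / A ^ 2 by positivity)
    linarith
  have hpq : 3 / 4 * A ^ 2 ≤ P * Q := by nlinarith
  have c2 : log (1 + h ^ 2 / (P * Q)) ≤ 4 / 3 * (h ^ 2 / A ^ 2) := by
    have hPQ : 0 < P * Q := lt_of_lt_of_le (by positivity) hpq
    have := Real.log_le_sub_one_of_pos (show 0 < 1 + h ^ 2 / (P * Q) by positivity)
    have h3 : h ^ 2 / (P * Q) ≤ h ^ 2 / (3 / 4 * A ^ 2) := by gcongr
    have h4 : h ^ 2 / (3 / 4 * A ^ 2) = 4 / 3 * (h ^ 2 / A ^ 2) := by field_simp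
    linarith
  have : 0 ≤ h ^ 2 / A ^ 2 := by positivity
  rw [abs_le]
  constructor <;> linarith

lemma integral_mul_log {a b : ℝ} (ha : 0 ≤ a) (hab : a ≤ b) :
    ∫ r in a..b, r * log r = (b ^ 2 / 2 * log b - b ^ 2 / 4) - (a ^ 2 / 2 * log a - a ^ 2 / 4) := by
  have hc : Continuous (fun r : ℝ => r ^ 2 / 2 * log r - r ^ 2 / 4) := by
    have : (fun r : ℝ => r ^ 2 / 2 * log r - r ^ 2 / 4) =
        fun r => r / 2 * (r * log r) - r ^ 2 / 4 := by ext r; ring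
    rw [this]
    have := Real.continuous_mul_log
    fun_prop
  refine intervalIntegral.integral_eq_sub_of_hasDerivAt_of_le hab
      (f := fun r : ℝ => r ^ 2 / 2 * log r - r ^ 2 / 4)
    hc.continuousOn (fun r hr => ?_) (Real.continuous_mul_log.intervalIntegrable _ _)
  have hr0 : r ≠ 0 := (ha.trans_lt hr.1).ne'
  have h1 := ((((hasDerivAt_id r).pow 2).div_const 2).mul (Real.hasDerivAt_log hr0)).sub
    (((hasDerivAt_id r).pow 2).div_const 4)
  refine h1.congr_deriv ?_
  simp only [id]; field_simp; norm_num; ring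

/-- Integration over a disc centred at the origin in polar coordinates. -/
lemma integral_ball_polar {f : ℂ → ℝ} (hf : Measurable f) {R : ℝ} (hR : 0 ≤ R)
    (hi : IntegrableOn f (ball 0 R)) :
    ∫ w in ball 0 R, f w = ∫ r in 0..R, r * ∫ θ in 0..2 * π, f (circleMap 0 r θ) := by
  set g := (ball (0:ℂ) R).indicator f
  have hg : Measurable g := hf.indicator isOpen_ball.measurableSet
  have hgi : Integrable g := (integrable_indicator_iff isOpen_ball.measurableSet).2 hi
  have hpm : Measurable (fun p : ℝ × ℝ => p.1 • g (Complex.polarCoord.symm p)) := by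
    have : Measurable (fun p : ℝ × ℝ => (Complex.polarCoord.symm p : ℂ)) := by
      simp only [Complex.polarCoord_symm_apply]; fun_prop
    exact measurable_fst.smul (hg.comp this)
  have hpi : IntegrableOn (fun p : ℝ × ℝ => p.1 • g (Complex.polarCoord.symm p))
      polarCoord.target := by
    refine ⟨hpm.aestronglyMeasurable, ?_⟩
    have h2 := Complex.lintegral_comp_polarCoord_symm (fun w => ‖g w‖ₑ)
    have h3 := hgi.2
    unfold HasFiniteIntegral at h3 ⊢
    rw [← h2] at h3
    refine lt_of_eq_of_lt (setLIntegral_congr_fun polarCoord.open_target.measurableSet ?_) h3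
    intro p hp
    have : 0 < p.1 := hp.1
    simp only [smul_eq_mul]
    rw [enorm_mul, Real.enorm_eq_ofReal this.le]
  rw [← integral_indicator isOpen_ball.measurableSet, ← Complex.integral_comp_polarCoord_symm]
  have ht : polarCoord.target = Set.Ioi (0:ℝ) ×ˢ Set.Ioo (-π) π := rfl
  rw [ht] at hpi ⊢
  rw [Measure.volume_eq_prod, setIntegral_prod _ (by rwa [Measure.volume_eq_prod] at hpi)]
  have hin : Set.EqOn (fun r : ℝ => ∫ θ in Set.Ioo (-π) π, r • g (Complex.polarCoord.symm (r, θ)))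
      ((Set.Ioo 0 R).indicator fun r : ℝ => r * ∫ θ in 0..2 * π, f (circleMap 0 r θ))
            (Set.Ioi 0) := by
    intro r hr
    simp only [Set.mem_Ioi] at hr
    have e : ∀ θ : ℝ, Complex.polarCoord.symm (r, θ) = circleMap 0 r θ := by
      intro θ
      rw [Complex.polarCoord_symm_apply]
      simp [circleMap, Complex.exp_mul_I]
    simp only [e]
    by_cases h : r < R
    · rw [Set.indicator_of_mem (show r ∈ Set.Ioo 0 R from ⟨hr, h⟩)]
      have e2 : ∀ θ : ℝ, g (circleMap 0 r θ) = f (circleMap 0 r θ) := by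
        intro θ
        refine Set.indicator_of_mem ?_ _
        simp [circleMap, abs_of_pos hr, h]
      simp only [e2, smul_eq_mul]
      rw [integral_const_mul, ← integral_Ioc_eq_integral_Ioo,
        ← intervalIntegral.integral_of_le (by linarith [pi_pos])]
      have hper : Function.Periodic (fun θ => f (circleMap 0 r θ)) (2 * π) := by
        intro θ; simp only [periodic_circleMap 0 r θ]
      have := hper.intervalIntegral_add_eq (-π) 0
      rw [show -π + 2 * π = π by ring, zero_add] at this
      rw [this]
    · rw [Set.indicator_of_notMem (show r ∉ Set.Ioo 0 R from fun h' => h h'.2)]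
      have e2 : ∀ θ : ℝ, g (circleMap 0 r θ) = 0 := by
        intro θ
        refine Set.indicator_of_notMem ?_ _
        simp [circleMap, abs_of_pos hr] ; linarith
      simp [e2]
  rw [setIntegral_congr_fun measurableSet_Ioi hin, setIntegral_indicator measurableSet_Ioo,
    show Set.Ioi (0:ℝ) ∩ Set.Ioo 0 R = Set.Ioo 0 R by
      ext s; simp only [Set.mem_inter_iff, Set.mem_Ioi, Set.mem_Ioo]; tauto,
    ← integral_Ioc_eq_integral_Ioo, ← intervalIntegral.integral_of_le hR]

/-- The logarithmic potential of a centred disc. -/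
def discPot (R : ℝ) (y : ℂ) : ℝ := ∫ w in ball (0:ℂ) R, -2 * log ‖y - w‖

lemma measurable_log_norm_sub (y : ℂ) : Measurable (fun w : ℂ => log ‖y - w‖) := by fun_prop

lemma volume_ball_ne_top (y : ℂ) (r : ℝ) : volume (ball y r) ≠ ⊤ :=
  (isBounded_ball.measure_lt_top).ne

lemma ae_ne (y : ℂ) (Z : Set ℂ) : ∀ᵐ w ∂(volume.restrict Z), y ≠ w := by
  refine ae_restrict_of_ae ?_
  have : volume ({y} : Set ℂ) = 0 := measure_singleton y
  filter_upwards [compl_mem_ae_iff.2 this] with w hw h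
  exact hw h.symm

/-- Functions dominated by the singular kernel are integrable. -/
lemma integrableOn_of_le_sing {f : ℂ → ℝ} (hf : Measurable f) {y : ℂ} {Z : Set ℂ}
    (hZ : MeasurableSet Z) (hv : volume Z ≠ ⊤) {a b : ℝ}
    (h : ∀ w ∈ Z, y ≠ w → |f w| ≤ a * sing y w + b) : IntegrableOn f Z := by
  have h1 : IntegrableOn (fun w => a * sing y w + b) Z :=
    ((integrableOn_sing y hZ hv).const_mul a).add (integrableOn_const hv)
  refine Integrable.mono' h1 hf.aestronglyMeasurable ?_
  filter_upwards [ae_ne y Z, ae_restrict_mem hZ] with w h1 h2 using h w h2 h1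

lemma integrableOn_log {y : ℂ} {Z : Set ℂ} (hZ : MeasurableSet Z) {R : ℝ} (hR : Z ⊆ ball 0 R) :
    IntegrableOn (fun w => log ‖y - w‖) Z := by
  refine integrableOn_of_le_sing (measurable_log_norm_sub y) (y := y) hZ
    (ne_top_of_le_ne_top (volume_ball_ne_top 0 R) (measure_mono hR)) (a := 1) (b := ‖y‖ + R) ?_
  intro w hw h
  have h1 := abs_log_le_sing h
  have h2 := norm_sub_le y w
  have h3 := hR hw
  rw [mem_ball_zero_iff] at h3
  linarith

lemma integral_circle_log (y : ℂ) {r : ℝ} (hr : 0 < r) :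
    ∫ θ in 0..2 * π, -2 * log ‖y - circleMap 0 r θ‖ = -(4 * π) * (log r + posLog (r⁻¹ * ‖y‖)) := by
  have h := circleAverage_log_norm_sub_const_eq_log_radius_add_posLog (a := y) (c := 0) hr.ne'
  rw [Real.circleAverage_def, zero_sub, norm_neg, smul_eq_mul] at h
  rw [intervalIntegral.integral_const_mul]
  have e : ∀ θ, ‖y - circleMap 0 r θ‖ = ‖circleMap 0 r θ - y‖ := fun θ => norm_sub_rev _ _
  simp only [e]
  rw [← h]
  have := pi_pos
  field_simp
  ring

lemma discPot_eq (y : ℂ) {R : ℝ} (hR : 0 ≤ R) :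
    discPot R y = ∫ r in 0..R, -(4 * π) * (r * (log r + posLog (r⁻¹ * ‖y‖))) := by
  unfold discPot
  rw [integral_ball_polar ((measurable_log_norm_sub y).const_mul _) hR
    ((integrableOn_log measurableSet_ball subset_rfl).const_mul _)]
  refine intervalIntegral.integral_congr_ae (Eventually.of_forall fun r hr => ?_)
  rw [Set.uIoc_of_le hR] at hr
  rw [integral_circle_log y hr.1]
  ring

lemma posLog_inner {r s : ℝ} (hr : 0 < r) (hs : r ≤ s) : log r + posLog (r⁻¹ * s) = log s := by
  rw [posLog_eq_log, Real.log_mul (by positivity) (by linarith), Real.log_inv]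
  · ring
  · rw [abs_of_pos (by have := hr.trans_le hs; positivity)]
    rw [inv_mul_eq_div, one_le_div hr]; exact hs

lemma posLog_outer {r s : ℝ} (hr : 0 < r) (h0 : 0 ≤ s) (hs : s ≤ r) :
    log r + posLog (r⁻¹ * s) = log r := by
  rw [add_eq_left, posLog_eq_zero_iff, abs_of_nonneg (by positivity), inv_mul_eq_div]
  exact div_le_one_of_le₀ hs hr.le

lemma discPot_outside {y : ℂ} {R : ℝ} (hR : 0 ≤ R) (h : R ≤ ‖y‖) :
    discPot R y = -(2 * π) * R ^ 2 * log ‖y‖ := by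
  rw [discPot_eq y hR]
  have : ∫ r in 0..R, -(4 * π) * (r * (log r + posLog (r⁻¹ * ‖y‖))) =
      ∫ r in 0..R, -(4 * π) * log ‖y‖ * r := by
    refine intervalIntegral.integral_congr_ae (Eventually.of_forall fun r hr => ?_)
    rw [Set.uIoc_of_le hR] at hr
    rw [posLog_inner hr.1 (hr.2.trans h)]; ring
  rw [this, intervalIntegral.integral_const_mul, integral_id]
  ring

lemma discPot_inside {y : ℂ} {R : ℝ} (h : ‖y‖ ≤ R) :
    discPot R y = π * (R ^ 2 - ‖y‖ ^ 2) - 2 * π * R ^ 2 * log R := by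
  have h0 := norm_nonneg y
  have hR : 0 ≤ R := h0.trans h
  rw [discPot_eq y hR]
  set s := ‖y‖
  have i1 : ∀ r ∈ Set.uIoc 0 s, -(4 * π) * (r * (log r + posLog (r⁻¹ * s))) =
      -(4 * π) * log s * r := by
    intro r hr
    rw [Set.uIoc_of_le h0] at hr
    rw [posLog_inner hr.1 hr.2]; ring
  have i2 : ∀ r ∈ Set.uIoc s R, -(4 * π) * (r * (log r + posLog (r⁻¹ * s))) =
      -(4 * π) * (r * log r) := by
    intro r hr
    rw [Set.uIoc_of_le h] at hr
    rw [posLog_outer (h0.trans_lt hr.1) h0 hr.1.le]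
  have c1 : IntervalIntegrable (fun r => -(4 * π) * log s * r) volume 0 s :=
    (continuous_const.mul continuous_id).intervalIntegrable _ _
  have c2 : IntervalIntegrable (fun r => -(4 * π) * (r * log r)) volume s R :=
    (continuous_const.mul Real.continuous_mul_log).intervalIntegrable _ _
  have j1 := c1.congr (f := fun r => -(4 * π) * log s * r) (fun r hr => (i1 r hr).symm)
  have j2 := c2.congr (f := fun r => -(4 * π) * (r * log r)) (fun r hr => (i2 r hr).symm)
  rw [← intervalIntegral.integral_add_adjacent_intervals j1 j2]
  rw [intervalIntegral.integral_congr_ae (Eventually.of_forall i1),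
    intervalIntegral.integral_congr_ae (Eventually.of_forall i2),
    intervalIntegral.integral_const_mul, intervalIntegral.integral_const_mul, integral_id,
    integral_mul_log h0 h]
  ring

lemma integral_unit_mul (f : ℂ → ℝ) {u : ℂ} (hu : ‖u‖ = 1) : ∫ w, f (u * w) = ∫ w, f w := by
  have := (rotation ⟨u, mem_sphere_zero_iff_norm.2 hu⟩).measurePreserving
  exact this.integral_comp
    (rotation ⟨u, mem_sphere_zero_iff_norm.2 hu⟩).toMeasurableEquiv.measurableEmbedding f

lemma integral_complex_mul (f : ℂ → ℝ) {y : ℂ} (hy : y ≠ 0) :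
    ‖y‖ ^ 2 * ∫ w, f (y * w) = ∫ w, f w := by
  have hn : 0 < ‖y‖ := norm_pos_iff.2 hy
  have hu : ‖y / ‖y‖‖ = 1 := by simp [hn.ne']
  rw [← integral_unit_mul f hu]
  have h := Measure.integral_comp_smul (volume : Measure ℂ) (fun w => f (y / ‖y‖ * w)) ‖y‖
  have e : ∀ w : ℂ, y / ‖y‖ * (‖y‖ • w) = y * w := by
    intro w
    have : (‖y‖ : ℂ) ≠ 0 := by exact_mod_cast hn.ne'
    rw [Complex.real_smul]; field_simp
  simp only [e, Complex.finrank_real_complex] at h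
  rw [h, abs_of_pos (by positivity), smul_eq_mul, ← mul_assoc, mul_inv_cancel₀ (by positivity),
      one_mul]

/-- First moment of the logarithmic kernel over the unit disc, seen from the boundary point `1`. -/
def discMoment : ℝ := ∫ w in ball (0:ℂ) 1, -2 * (w.re * log ‖1 - w‖)

lemma setIntegral_ball_conj (f : ℂ → ℝ) (R : ℝ) :
    ∫ w in ball (0:ℂ) R, f (starRingEnd ℂ w) = ∫ w in ball (0:ℂ) R, f w := by
  have := Complex.conjLIE.measurePreserving
  have h2 := this.setIntegral_preimage_emb Complex.conjLIE.toMeasurableEquiv.measurableEmbedding f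
      (ball 0 R)
  rw [← h2]
  congr 2
  ext w; simp

lemma integral_im_log : ∫ w in ball (0:ℂ) 1, w.im * log ‖1 - w‖ = 0 := by
  have h := setIntegral_ball_conj (fun w => w.im * log ‖1 - w‖) 1
  have e : ∀ w : ℂ, ‖1 - starRingEnd ℂ w‖ = ‖1 - w‖ := by
    intro w
    rw [← Complex.norm_conj (1 - w)]; simp
  simp only [e, Complex.conj_im, neg_mul, integral_neg] at h
  linarith

lemma setIntegral_ball_neg (f : ℂ → ℝ) (R : ℝ) :
    ∫ w in ball (0:ℂ) R, f (-w) = ∫ w in ball (0:ℂ) R, f w := by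
  rw [← integral_indicator measurableSet_ball, ← integral_indicator measurableSet_ball,
    ← integral_neg_eq_self]
  congr 1; ext w
  by_cases h : w ∈ ball (0:ℂ) R
  · rw [Set.indicator_of_mem h, Set.indicator_of_mem (by simpa using h), neg_neg]
  · rw [Set.indicator_of_notMem h, Set.indicator_of_notMem (by simpa using h)]

lemma integral_re_ball (R : ℝ) : ∫ w in ball (0:ℂ) R, w.re = 0 := by
  have h := setIntegral_ball_neg (fun w => w.re) R
  simp only [Complex.neg_re, integral_neg] at h
  linarith

lemma integral_im_ball (R : ℝ) : ∫ w in ball (0:ℂ) R, w.im = 0 := by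
  have h := setIntegral_ball_neg (fun w => w.im) R
  simp only [Complex.neg_im, integral_neg] at h
  linarith

/-- The first-moment potential of a disc on its boundary circle. -/
lemma moment_on_circle {y : ℂ} (hy : y ≠ 0) :
    ∫ w in ball (0:ℂ) ‖y‖, -2 * (w.re * log ‖y - w‖) = ‖y‖ ^ 2 * discMoment * y.re := by
  have hn : 0 < ‖y‖ := norm_pos_iff.2 hy
  rw [← integral_indicator measurableSet_ball, ← integral_complex_mul _ hy, mul_assoc]
  congr 1
  have e : (fun w => (ball (0:ℂ) ‖y‖).indicator (fun w => -2 * (w.re * log ‖y - w‖)) (y * w)) =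
      (ball (0:ℂ) 1).indicator (fun w => -2 * ((y * w).re * log ‖y - y * w‖)) := by
    ext w
    by_cases h : w ∈ ball (0:ℂ) 1
    · rw [Set.indicator_of_mem h, Set.indicator_of_mem]
      rw [mem_ball_zero_iff] at h ⊢
      rw [norm_mul]; nlinarith
    · rw [Set.indicator_of_notMem h, Set.indicator_of_notMem]
      rw [mem_ball_zero_iff] at h ⊢
      rw [norm_mul]; nlinarith
  rw [e, integral_indicator measurableSet_ball]
  have hb : ∀ w ∈ ball (0:ℂ) 1, ‖w‖ ≤ 1 := fun w hw => (mem_ball_zero_iff.1 hw).le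
  have ilog := integrableOn_log (y := 1) measurableSet_ball (subset_refl (ball (0:ℂ) 1))
  have i1 : IntegrableOn (fun w : ℂ => w.re * log ‖1 - w‖) (ball 0 1) := by
    refine ilog.bdd_mul (c := 1) (by fun_prop) ?_
    filter_upwards [ae_restrict_mem measurableSet_ball] with w hw
    exact (Complex.abs_re_le_norm w).trans (hb w hw)
  have i2 : IntegrableOn (fun w : ℂ => w.im * log ‖1 - w‖) (ball 0 1) := by
    refine ilog.bdd_mul (c := 1) (by fun_prop) ?_
    filter_upwards [ae_restrict_mem measurableSet_ball] with w hw
    exact (Complex.abs_im_le_norm w).trans (hb w hw)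
  have i3 : IntegrableOn (fun w : ℂ => w.re) (ball 0 1) := by
    refine Measure.integrableOn_of_bounded (M := 1) (volume_ball_ne_top 0 1) (by fun_prop) ?_
    filter_upwards [ae_restrict_mem measurableSet_ball] with w hw
    exact (Complex.abs_re_le_norm w).trans (hb w hw)
  have i4 : IntegrableOn (fun w : ℂ => w.im) (ball 0 1) := by
    refine Measure.integrableOn_of_bounded (M := 1) (volume_ball_ne_top 0 1) (by fun_prop) ?_
    filter_upwards [ae_restrict_mem measurableSet_ball] with w hw
    exact (Complex.abs_im_le_norm w).trans (hb w hw)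
  have e2 : ∫ w in ball (0:ℂ) 1, -2 * ((y * w).re * log ‖y - y * w‖) =
      ∫ w in ball (0:ℂ) 1, ((-2 * log ‖y‖) * (y.re * w.re) - (-2 * log ‖y‖) * (y.im * w.im)
        + y.re * (-2 * (w.re * log ‖1 - w‖)) - y.im * (-2 * (w.im * log ‖1 - w‖))) := by
    refine setIntegral_congr_ae measurableSet_ball ?_
    have : volume ({1} : Set ℂ) = 0 := measure_singleton _
    filter_upwards [compl_mem_ae_iff.2 this] with w hw _
    have hw1 : ‖1 - w‖ ≠ 0 := norm_ne_zero_iff.2 (sub_ne_zero.2 fun h => hw h.symm)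
    rw [show y - y * w = y * (1 - w) by ring, norm_mul, Real.log_mul hn.ne' hw1, Complex.mul_re]
    ring
  rw [e2, integral_sub, integral_add, integral_sub]
  · simp only [integral_const_mul, integral_re_ball, integral_im_ball, integral_im_log]
    unfold discMoment
    rw [integral_const_mul]
    ring
  · exact (i3.const_mul _).const_mul _
  · exact (i4.const_mul _).const_mul _
  · exact ((i3.const_mul _).const_mul _).sub ((i4.const_mul _).const_mul _)
  · exact (i1.const_mul _).const_mul _
  · exact (((i3.const_mul _).const_mul _).sub ((i4.const_mul _).const_mul _)).add
      ((i1.const_mul _).const_mul _)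
  · exact (i2.const_mul _).const_mul _

/-- The range of small scales considered throughout. -/
structure SmallScale (σ : ℝ) : Prop where
  pos : 0 < σ
  log_huge : 10 ^ 6 ≤ -log σ
  mul_log_small : σ * (-log σ) ≤ 1 / 10 ^ 200

lemma SmallScale.log_large {σ : ℝ} (h : SmallScale σ) : 100 ≤ -log σ := by
  linarith [h.log_huge]

/-- Width of the annulus in which the free boundary is located. -/
def bandWidth (σ : ℝ) : ℝ := 10 ^ 5 * (σ ^ 2 * (-log σ))

lemma SmallScale.le {σ : ℝ} (h : SmallScale σ) : σ ≤ 1 / 10 ^ 202 := by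
  have h1 := h.pos
  have h2 := h.log_large
  have h3 := h.mul_log_small
  have : σ * 100 ≤ σ * (-log σ) := by gcongr
  norm_num at *
  linarith

lemma SmallScale.le_coarse {σ : ℝ} (h : SmallScale σ) : σ ≤ 1 / 1000 :=
  h.le.trans (by norm_num)

lemma SmallScale.mul_norm_le {σ : ℝ} (h : SmallScale σ) {y : ℂ} (hy : ‖y‖ ≤ 16) :
    σ * ‖y‖ ≤ 1 / 8 := by
  have := h.le_coarse
  have h1 := h.pos
  calc σ * ‖y‖ ≤ 1 / 1000 * 16 := by gcongr
    _ ≤ 1 / 8 := by norm_num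

lemma SmallScale.bandWidth_pos {σ : ℝ} (h : SmallScale σ) : 0 < bandWidth σ := by
  have h1 := h.pos
  have h2 : 0 < -log σ := by linarith [h.log_large]
  unfold bandWidth; positivity

lemma SmallScale.bandWidth_le_mul {σ : ℝ} (h : SmallScale σ) :
    bandWidth σ ≤ σ * (1 / 10 ^ 195) := by
  have h1 := h.pos
  have h3 := h.mul_log_small
  have : bandWidth σ = σ * (10 ^ 5 * (σ * (-log σ))) := by unfold bandWidth; ring
  rw [this]
  refine mul_le_mul_of_nonneg_left ?_ h1.le
  norm_num at *
  linarith

lemma SmallScale.bandWidth_le {σ : ℝ} (h : SmallScale σ) : bandWidth σ ≤ 1 / 10 ^ 195 := by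
  refine h.bandWidth_le_mul.trans ?_
  have := h.le_coarse
  refine mul_le_of_le_one_left (by positivity) (by linarith)

lemma SmallScale.bandWidth_le_coarse {σ : ℝ} (h : SmallScale σ) : bandWidth σ ≤ 1 / 1000 :=
  h.bandWidth_le.trans (by norm_num)

lemma cube_expand {s : ℝ} (hs : |s| ≤ 1 / 8) :
    0 ≤ √(1 + s) ^ 3 - 1 - 3 / 2 * s ∧ √(1 + s) ^ 3 - 1 - 3 / 2 * s ≤ s ^ 2 := by
  have h := abs_le.1 hs
  have e := Real.sq_sqrt (show 0 ≤ 1 + s by linarith)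
  have h0 := Real.sqrt_nonneg (1 + s)
  set ξ := √(1 + s)
  have e1 : s = ξ ^ 2 - 1 := by linarith
  have e2 : ξ ^ 3 - 1 - 3 / 2 * s = (ξ - 1) ^ 2 * (ξ + 1 / 2) := by rw [e1]; ring
  have e3 : s ^ 2 = (ξ - 1) ^ 2 * (ξ + 1) ^ 2 := by rw [e1]; ring
  rw [e2, e3]
  refine ⟨by positivity, mul_le_mul_of_nonneg_left (by nlinarith) (sq_nonneg _)⟩

lemma inv_expand {s : ℝ} (hs : |s| ≤ 1 / 8) :
    0 ≤ 1 / √(1 + s) - 1 + s / 2 ∧ 1 / √(1 + s) - 1 + s / 2 ≤ s ^ 2 := by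
  have h := abs_le.1 hs
  have e := Real.sq_sqrt (show 0 ≤ 1 + s by linarith)
  have h0 : 9 / 10 ≤ √(1 + s) := Real.le_sqrt_of_sq_le (by linarith)
  set ξ := √(1 + s)
  have e1 : s = ξ ^ 2 - 1 := by linarith
  have e2 : 1 / ξ - 1 + s / 2 = (ξ - 1) ^ 2 * ((ξ + 2) / (2 * ξ)) := by
    rw [e1]; field_simp; ring
  have e3 : s ^ 2 = (ξ - 1) ^ 2 * (ξ + 1) ^ 2 := by rw [e1]; ring
  rw [e2, e3]
  refine ⟨by positivity, mul_le_mul_of_nonneg_left ?_ (sq_nonneg _)⟩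
  rw [div_le_iff₀ (by positivity)]
  nlinarith

/-- The weight `X^{3/2}`. -/
def rho (σ : ℝ) (w : ℂ) : ℝ := √(axDist σ w) ^ 3

/-- The combination of `X^{3/2}` and `X^{-1/2}` with vanishing linear part. -/
def profA (σ : ℝ) (y : ℂ) : ℝ := √(axDist σ y) ^ 3 / 4 + 3 / 4 * (1 / √(axDist σ y))

/-- The combination of `X^{3/2}` and `X^{-1/2}` vanishing at the centre. -/
def profB (σ : ℝ) (y : ℂ) : ℝ := √(axDist σ y) ^ 3 / 2 - 1 / √(axDist σ y) / 2

lemma abs_re_scale {σ : ℝ} (hσ : 0 < σ) {y : ℂ} (hy : σ * ‖y‖ ≤ 1 / 8) :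
    |σ * y.re| ≤ 1 / 8 ∧ (σ * y.re) ^ 2 ≤ (σ * ‖y‖) ^ 2 ∧ |σ * y.re| ≤ σ * ‖y‖ := by
  have h : |σ * y.re| ≤ σ * ‖y‖ := by
    rw [abs_mul, abs_of_pos hσ]; gcongr; exact Complex.abs_re_le_norm y
  refine ⟨h.trans hy, ?_, h⟩
  rw [← sq_abs]; gcongr

lemma profA_bounds {σ : ℝ} (hσ : 0 < σ) {y : ℂ} (hy : σ * ‖y‖ ≤ 1 / 8) :
    1 ≤ profA σ y ∧ profA σ y ≤ 1 + (σ * ‖y‖) ^ 2 := by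
  obtain ⟨h1, h2, _⟩ := abs_re_scale hσ hy
  have h3 := cube_expand h1
  have h4 := inv_expand h1
  unfold profA axDist
  constructor <;> linarith

lemma abs_profB_sub_le {σ : ℝ} (hσ : 0 < σ) {y : ℂ} (hy : σ * ‖y‖ ≤ 1 / 8) :
    |profB σ y - σ * y.re| ≤ (σ * ‖y‖) ^ 2 := by
  obtain ⟨h1, h2, _⟩ := abs_re_scale hσ hy
  have h3 := cube_expand h1
  have h4 := inv_expand h1
  unfold profB axDist
  rw [abs_le]
  constructor <;> linarith

lemma abs_log_axDist_sub_le {σ : ℝ} (hσ : 0 < σ) {y : ℂ} (hy : σ * ‖y‖ ≤ 1 / 8) :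
    |log (axDist σ y) - σ * y.re| ≤ 2 * (σ * ‖y‖) ^ 2 := by
  obtain ⟨h1, h2, _⟩ := abs_re_scale hσ hy
  have h := abs_le.1 h1
  unfold axDist
  set s := σ * y.re
  have a1 := Real.log_le_sub_one_of_pos (show 0 < 1 + s by linarith)
  have a2 := Real.one_sub_inv_le_log_of_pos (show 0 < 1 + s by linarith)
  have a3 : 1 - (1 + s)⁻¹ = s - s ^ 2 / (1 + s) := by
    have : 1 + s ≠ 0 := by linarith
    field_simp; ring
  have a4 : s ^ 2 / (1 + s) ≤ 2 * s ^ 2 := by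
    rw [div_le_iff₀ (by linarith)]; nlinarith [sq_nonneg s]
  rw [abs_le]
  constructor <;> nlinarith [sq_nonneg (σ * ‖y‖)]

lemma abs_log_axDist_le {σ : ℝ} (hσ : 0 < σ) {y : ℂ} (hy : σ * ‖y‖ ≤ 1 / 8) :
    |log (axDist σ y)| ≤ 2 * (σ * ‖y‖) := by
  obtain ⟨h1, h2, h3⟩ := abs_re_scale hσ hy
  have h4 := abs_log_axDist_sub_le hσ hy
  have h5 : 0 ≤ σ * ‖y‖ := by positivity
  rw [abs_le] at *
  constructor <;> nlinarith

lemma abs_rho_expand {σ : ℝ} (hσ : 0 < σ) {y : ℂ} (hy : σ * ‖y‖ ≤ 1 / 8) :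
    |rho σ y - 1 - 3 / 2 * (σ * y.re)| ≤ (σ * ‖y‖) ^ 2 := by
  obtain ⟨h1, h2, _⟩ := abs_re_scale hσ hy
  have h3 := cube_expand h1
  unfold rho axDist
  rw [abs_le]
  constructor <;> linarith [sq_nonneg (σ * ‖y‖)]

lemma abs_rho_sub_one_le {σ : ℝ} (hσ : 0 < σ) {y : ℂ} (hy : σ * ‖y‖ ≤ 1 / 8) :
    |rho σ y - 1| ≤ 2 * (σ * ‖y‖) := by
  obtain ⟨h1, h2, h3⟩ := abs_re_scale hσ hy
  have h4 := abs_rho_expand hσ hy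
  have h5 : 0 ≤ σ * ‖y‖ := by positivity
  rw [abs_le] at *
  constructor <;> nlinarith

lemma rho_bounds {σ : ℝ} (hσ : 0 < σ) {y : ℂ} (hy : σ * ‖y‖ ≤ 1 / 8) :
    3 / 4 ≤ rho σ y ∧ rho σ y ≤ 5 / 4 := by
  have := abs_le.1 (abs_rho_sub_one_le hσ hy)
  constructor <;> linarith

lemma abs_cube_sub_le {σ : ℝ} (hσ : 0 < σ) {y z : ℂ} (hy : σ * ‖y‖ ≤ 1 / 8)
    (hz : σ * ‖z‖ ≤ 1 / 8) : |√(axDist σ y) ^ 3 - √(axDist σ z) ^ 3| ≤ 4 * (σ * ‖y - z‖) := by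
  have h := abs_sqrt_axDist_sub_le hσ hy hz
  obtain ⟨a1, a2⟩ := sqrt_axDist_bounds hσ hy
  obtain ⟨b1, b2⟩ := sqrt_axDist_bounds hσ hz
  set a := √(axDist σ y)
  set b := √(axDist σ z)
  rw [show a ^ 3 - b ^ 3 = (a ^ 2 + a * b + b ^ 2) * (a - b) by ring, abs_mul]
  gcongr
  rw [abs_of_nonneg (by positivity)]
  nlinarith

lemma abs_inv_sqrt_sub_le {σ : ℝ} (hσ : 0 < σ) {y z : ℂ} (hy : σ * ‖y‖ ≤ 1 / 8)
    (hz : σ * ‖z‖ ≤ 1 / 8) : |1 / √(axDist σ y) - 1 / √(axDist σ z)| ≤ 2 * (σ * ‖y - z‖) := by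
  have h := abs_sqrt_axDist_sub_le hσ hy hz
  obtain ⟨a1, a2⟩ := sqrt_axDist_bounds hσ hy
  obtain ⟨b1, b2⟩ := sqrt_axDist_bounds hσ hz
  set a := √(axDist σ y)
  set b := √(axDist σ z)
  have ha : 0 < a := by linarith
  have hb : 0 < b := by linarith
  rw [show 1 / a - 1 / b = -(1 / (a * b)) * (a - b) by field_simp; ring, abs_mul]
  gcongr
  rw [abs_neg, abs_of_nonneg (by positivity), div_le_iff₀ (by positivity)]
  nlinarith

lemma abs_profA_sub_le {σ : ℝ} (hσ : 0 < σ) {y z : ℂ} (hy : σ * ‖y‖ ≤ 1 / 8)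
    (hz : σ * ‖z‖ ≤ 1 / 8) : |profA σ y - profA σ z| ≤ 3 * (σ * ‖y - z‖) := by
  have h1 := abs_le.1 (abs_cube_sub_le hσ hy hz)
  have h2 := abs_le.1 (abs_inv_sqrt_sub_le hσ hy hz)
  unfold profA
  rw [abs_le]; constructor <;> linarith

lemma abs_profB_sub_profB_le {σ : ℝ} (hσ : 0 < σ) {y z : ℂ} (hy : σ * ‖y‖ ≤ 1 / 8)
    (hz : σ * ‖z‖ ≤ 1 / 8) : |profB σ y - profB σ z| ≤ 3 * (σ * ‖y - z‖) := by
  have h1 := abs_le.1 (abs_cube_sub_le hσ hy hz)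
  have h2 := abs_le.1 (abs_inv_sqrt_sub_le hσ hy hz)
  unfold profB
  rw [abs_le]; constructor <;> linarith

lemma abs_log_axDist_sub_log_le {σ : ℝ} (hσ : 0 < σ) {y z : ℂ} (hy : σ * ‖y‖ ≤ 1 / 8)
    (hz : σ * ‖z‖ ≤ 1 / 8) : |log (axDist σ y) - log (axDist σ z)| ≤ 2 * (σ * ‖y - z‖) := by
  have h1 := (axDist_bounds hσ hy).1
  have h2 := (axDist_bounds hσ hz).1
  have h3 := abs_log_sub_log_le (c := 1 / 2) (by norm_num) (by linarith : (1/2:ℝ) ≤ axDist σ y)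
    (by linarith : (1/2:ℝ) ≤ axDist σ z)
  have h4 := abs_axDist_sub_le hσ y z
  linarith

lemma abs_mul_log_le {t C : ℝ} (h0 : 0 < t) (hC : t ≤ C) : |t * log t| ≤ C ^ 2 + 1 := by
  have h1 := Real.log_le_sub_one_of_pos h0
  have h2 := Real.one_sub_inv_le_log_of_pos h0
  have h3 : t * (1 - t⁻¹) ≤ t * log t := by gcongr
  have h4 : t * log t ≤ t * (t - 1) := by gcongr
  rw [mul_sub, mul_inv_cancel₀ h0.ne'] at h3
  rw [abs_le]
  constructor <;> nlinarith

/-- Near the diagonal the regular part of the ring kernel is almost constant. -/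
lemma abs_ringJ_relDist_sub_zero_le {σ : ℝ} (h : SmallScale σ) {y w : ℂ} (hy : ‖y‖ ≤ 4)
    (hw : ‖w‖ ≤ 2) (hyw : y ≠ w) :
    |ringJ (relDist σ y w) - ringJ 0| ≤ 200 * (σ ^ 2 * (-log σ)) := by
  have hσ := h.pos
  have hL := h.log_large
  obtain ⟨a1, a2⟩ := axDist_bounds hσ (h.mul_norm_le (hy.trans (by norm_num)))
  obtain ⟨b1, b2⟩ := axDist_bounds hσ (h.mul_norm_le (hw.trans (by norm_num)))
  set t := ‖y - w‖ ^ 2 / (axDist σ y * axDist σ w) with ht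
  have hd : 0 < ‖y - w‖ := norm_pos_iff.2 (sub_ne_zero.2 hyw)
  have hd6 : ‖y - w‖ ≤ 6 := (norm_sub_le _ _).trans (by linarith)
  have hp : 0 < axDist σ y * axDist σ w := mul_pos (by linarith) (by linarith)
  have t0 : 0 < t := by positivity
  have t1 : t ≤ 48 := by
    rw [ht, div_le_iff₀ hp]
    have : 49 / 64 ≤ axDist σ y * axDist σ w := by nlinarith
    nlinarith
  have e : relDist σ y w = σ ^ 2 * t := by rw [ht]; unfold relDist; ring
  have s1 := h.le_coarse
  have hs2 : σ ^ 2 ≤ 1 / 1000000 := by nlinarith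
  have k := abs_ringJ_sub_zero_le (t := relDist σ y w) (by rw [e]; positivity)
    (by rw [e]; nlinarith)
  refine k.trans ?_
  rw [e, Real.log_mul (by positivity) t0.ne', Real.log_pow]
  have k2 := abs_mul_log_le t0 t1
  have k3 : |(2:ℕ) * log σ + log t| ≤ 2 * (-log σ) + |log t| := by
    refine (abs_add_le _ _).trans ?_
    rw [abs_of_nonpos (by push_cast; linarith)]
    push_cast; linarith
  have k4 : t * |log t| ≤ 2305 := by
    rw [abs_mul, abs_of_pos t0] at k2
    linarith
  calc σ ^ 2 * t * (|(2:ℕ) * log σ + log t| + 3)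
      ≤ σ ^ 2 * t * (2 * (-log σ) + |log t| + 3) := by gcongr
    _ = σ ^ 2 * (t * (2 * (-log σ)) + t * |log t| + 3 * t) := by ring
    _ ≤ σ ^ 2 * (48 * (2 * (-log σ)) + 2305 + 3 * 48) := by gcongr
    _ ≤ σ ^ 2 * (200 * (-log σ)) := by gcongr; linarith
    _ = _ := by ring

lemma abs_ringJ_zero_le : |ringJ 0| ≤ 11 := by
  have h1 := abs_ringJ_sub_le (a := 1) (b := 0) (by norm_num) le_rfl
  have h2 := ringF_eq (t := 1) one_pos
  have h3 : |ringF 1| ≤ 2 * π := by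
    unfold ringF
    have := intervalIntegral.norm_integral_le_of_norm_le_const (a := -π) (b := π) (C := 1)
      (f := fun θ => cos θ / √((1:ℝ) + 2 - 2 * cos θ)) ?_
    · rw [Real.norm_eq_abs, one_mul, abs_of_pos (by linarith [pi_pos] : 0 < π - -π)] at this
      linarith
    · intro θ _
      rw [Real.norm_eq_abs, abs_div, abs_of_nonneg (Real.sqrt_nonneg _)]
      have c1 := Real.cos_le_one θ
      have c2 : (1:ℝ) ≤ √((1:ℝ) + 2 - 2 * cos θ) := Real.one_le_sqrt.2 (by linarith)
      rw [div_le_one (by linarith)]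
      exact (Real.abs_cos_le_one θ).trans c2
  rw [log_one, neg_zero, zero_add] at h2
  rw [← h2, sqrt_one, sqrt_zero, sub_zero, abs_one] at h1
  have h4 := pi_lt_d2
  rw [abs_le] at *
  constructor <;> linarith

lemma ringF_relDist {σ : ℝ} (hσ : 0 < σ) {y w : ℂ} (hy : 0 < axDist σ y) (hw : 0 < axDist σ w)
    (h : y ≠ w) : ringF (relDist σ y w) =
      2 * (-log σ) - 2 * log ‖y - w‖ + log (axDist σ y) + log (axDist σ w) +
        ringJ (relDist σ y w) := by
  have hd : 0 < ‖y - w‖ := norm_pos_iff.2 (sub_ne_zero.2 h)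
  rw [ringF_eq (relDist_pos hσ hy hw h)]
  unfold relDist
  rw [Real.log_div (by positivity) (by positivity), Real.log_mul (by positivity) (by positivity),
    Real.log_mul hy.ne' hw.ne', Real.log_pow, Real.log_pow]
  push_cast; ring

/-- The potential of the ring kernel with density `X^{3/2}`. -/
def ringPot (σ : ℝ) (D : Set ℂ) (y : ℂ) : ℝ := ∫ w in D, rho σ w * ringF (relDist σ y w)

/-- The logarithmic potential with density `X^{3/2}`. -/
def logPot (σ : ℝ) (D : Set ℂ) (y : ℂ) : ℝ := ∫ w in D, rho σ w * (-2 * log ‖y - w‖)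

/-- The potential of the regular part of the ring kernel. -/
def corrPot (σ : ℝ) (D : Set ℂ) (y : ℂ) : ℝ := ∫ w in D, rho σ w * ringJ (relDist σ y w)

/-- The mass of the density `X^{3/2}`. -/
def massRho (σ : ℝ) (D : Set ℂ) : ℝ := ∫ w in D, rho σ w

/-- The constant part of the ring potential. -/
def selfConst (σ : ℝ) (D : Set ℂ) : ℝ := ∫ w in D, rho σ w * (2 * (-log σ) + log (axDist σ w))

lemma continuous_axDist (σ : ℝ) : Continuous (axDist σ) := by
  unfold axDist; fun_prop

lemma continuous_rho (σ : ℝ) : Continuous (rho σ) := by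
  have := continuous_axDist σ
  unfold rho; fun_prop

lemma continuous_ringJ_max : Continuous fun t : ℝ => ringJ (max t 0) := by
  rw [continuous_iff_continuousAt]
  intro b
  have h : Tendsto (fun a : ℝ => 4 * |√a - √b|) (nhds b) (nhds 0) := by
    have : Continuous fun a : ℝ => 4 * |√a - √b| := by fun_prop
    simpa using this.tendsto b
  rw [ContinuousAt, tendsto_iff_dist_tendsto_zero]
  refine squeeze_zero (fun _ => dist_nonneg) (fun a => ?_) h
  have e : ∀ a : ℝ, √(max a 0) = √a := by
    intro a
    rcases le_total a 0 with h | h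
    · rw [max_eq_right h, sqrt_zero, sqrt_eq_zero_of_nonpos h]
    · rw [max_eq_left h]
  rw [Real.dist_eq]
  have := abs_ringJ_sub_le (a := max a 0) (b := max b 0) (le_max_right _ _) (le_max_right _ _)
  rwa [e, e] at this

lemma measurable_ringJ_relDist (σ : ℝ) (y : ℂ) :
    Measurable fun w => ringJ (max (relDist σ y w) 0) := by
  refine continuous_ringJ_max.measurable.comp ?_
  have := (continuous_axDist σ).measurable
  unfold relDist
  fun_prop

section
variable {σ : ℝ} {D : Set ℂ}

lemma norm_lt_of_subset (hD : D ⊆ ball 0 2) {w : ℂ} (hw : w ∈ D) : ‖w‖ < 2 :=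
  mem_ball_zero_iff.1 (hD hw)

lemma volume_ne_top_of_subset (hD : D ⊆ ball 0 2) : volume D ≠ ⊤ :=
  ne_top_of_le_ne_top (volume_ball_ne_top 0 2) (measure_mono hD)

lemma SmallScale.mul_norm_mem (h : SmallScale σ) (hD : D ⊆ ball 0 2) {w : ℂ} (hw : w ∈ D) :
    σ * ‖w‖ ≤ 1 / 8 := h.mul_norm_le (by linarith [norm_lt_of_subset hD hw])

lemma axDist_pos (h : SmallScale σ) {w : ℂ} (hw : ‖w‖ ≤ 16) : 0 < axDist σ w := by
  linarith [(axDist_bounds h.pos (h.mul_norm_le hw)).1]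

lemma abs_rho_le_mem (h : SmallScale σ) (hD : D ⊆ ball 0 2) {w : ℂ} (hw : w ∈ D) :
    |rho σ w| ≤ 5 / 4 := by
  obtain ⟨a, b⟩ := rho_bounds h.pos (h.mul_norm_mem hD hw)
  rw [abs_le]; constructor <;> linarith

/-- Integrals of functions bounded on a set. -/
lemma integrableOn_of_abs_le {f : ℂ → ℝ} (hf : Measurable f) (hDm : MeasurableSet D)
    (hD : D ⊆ ball 0 2) {c : ℝ} (hc : ∀ w ∈ D, |f w| ≤ c) : IntegrableOn f D := by
  refine Measure.integrableOn_of_bounded (M := c) (volume_ne_top_of_subset hD)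
    hf.aestronglyMeasurable ?_
  filter_upwards [ae_restrict_mem hDm] with w hw using hc w hw

lemma abs_setIntegral_le {f : ℂ → ℝ} (hv : volume D ≠ ⊤) {c : ℝ}
    (hc : ∀ w ∈ D, |f w| ≤ c) : |∫ w in D, f w| ≤ c * volume.real D := by
  rw [← Real.norm_eq_abs]
  exact norm_setIntegral_le_of_norm_le_const (f := f) (lt_top_iff_ne_top.2 hv) hc

lemma volume_real_le_of_subset (hD : D ⊆ ball 0 2) : volume.real D ≤ 4 * π := by
  have := measureReal_mono hD (volume_ball_ne_top 0 2)
  rw [volume_real_ball _ (by norm_num)] at this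
  linarith

lemma integrableOn_rho (h : SmallScale σ) (hDm : MeasurableSet D) (hD : D ⊆ ball 0 2) :
    IntegrableOn (rho σ) D :=
  integrableOn_of_abs_le (continuous_rho σ).measurable hDm hD
    fun _ hw => abs_rho_le_mem h hD hw

lemma integrableOn_rho_mul {f : ℂ → ℝ} (h : SmallScale σ) (hDm : MeasurableSet D)
    (hD : D ⊆ ball 0 2) (hf : IntegrableOn f D) : IntegrableOn (fun w => rho σ w * f w) D := by
  refine hf.bdd_mul (c := 5 / 4) (continuous_rho σ).aestronglyMeasurable ?_
  filter_upwards [ae_restrict_mem hDm] with w hw using abs_rho_le_mem h hD hw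

lemma integrableOn_log_axDist (h : SmallScale σ) (hDm : MeasurableSet D) (hD : D ⊆ ball 0 2) :
    IntegrableOn (fun w => log (axDist σ w)) D := by
  refine integrableOn_of_abs_le ((continuous_axDist σ).measurable.log) hDm hD (c := 1) ?_
  intro w hw
  have := abs_log_axDist_le h.pos (h.mul_norm_mem hD hw)
  linarith [h.mul_norm_mem hD hw]

lemma integrableOn_ringJ (h : SmallScale σ) (hDm : MeasurableSet D) (hD : D ⊆ ball 0 2) {y : ℂ}
    (hy : 0 < axDist σ y) : IntegrableOn (fun w => ringJ (relDist σ y w)) D := by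
  have e : Set.EqOn (fun w => ringJ (relDist σ y w))
      (fun w => ringJ (max (relDist σ y w) 0)) D := by
    intro w hw
    have : 0 ≤ relDist σ y w :=
      relDist_nonneg hy (axDist_pos h (by linarith [norm_lt_of_subset hD hw]))
    simp only [max_eq_left this]
  rw [integrableOn_congr_fun e hDm]
  refine integrableOn_of_abs_le (measurable_ringJ_relDist σ y) hDm hD
    (c := 11 + 4 * (σ * (‖y‖ + 2) / (√(axDist σ y) * (9 / 10)))) ?_
  intro w hw
  have hX := axDist_pos h (by linarith [norm_lt_of_subset hD hw] : ‖w‖ ≤ 16)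
  have h0 : 0 ≤ relDist σ y w := relDist_nonneg hy hX
  rw [max_eq_left h0]
  have h1 := abs_ringJ_sub_le h0 (le_refl 0)
  rw [sqrt_zero, sub_zero, abs_of_nonneg (Real.sqrt_nonneg _), sqrt_relDist h.pos hy] at h1
  have h2 := (sqrt_axDist_bounds h.pos (h.mul_norm_mem hD hw)).1
  have h3 := norm_sub_le y w
  have h4 := norm_lt_of_subset hD hw
  have hσ := h.pos
  have h5 : σ * ‖y - w‖ / (√(axDist σ y) * √(axDist σ w)) ≤
      σ * (‖y‖ + 2) / (√(axDist σ y) * (9 / 10)) := by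
    have := Real.sqrt_pos.2 hy
    apply div_le_div₀ (by positivity)
    · gcongr; linarith
    · positivity
    · gcongr
  have h6 := abs_ringJ_zero_le
  rw [abs_le] at *
  constructor <;> linarith

lemma integrableOn_neg_two_log (hDm : MeasurableSet D) (hD : D ⊆ ball 0 2) (y : ℂ) :
    IntegrableOn (fun w => -2 * log ‖y - w‖) D := (integrableOn_log hDm hD).const_mul _

lemma integrableOn_selfConst (h : SmallScale σ) (hDm : MeasurableSet D) (hD : D ⊆ ball 0 2) :
    IntegrableOn (fun w => rho σ w * (2 * (-log σ) + log (axDist σ w))) D := by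
  refine integrableOn_rho_mul h hDm hD ?_
  exact (integrableOn_const (volume_ne_top_of_subset hD)).add (integrableOn_log_axDist h hDm hD)

lemma ringPot_integrand_ae (h : SmallScale σ) (hDm : MeasurableSet D) (hD : D ⊆ ball 0 2) {y : ℂ}
    (hy : 0 < axDist σ y) :
    (fun w => rho σ w * (-2 * log ‖y - w‖) + rho σ w * ringJ (relDist σ y w) +
        rho σ w * log (axDist σ y) + rho σ w * (2 * (-log σ) + log (axDist σ w)))
      =ᵐ[volume.restrict D] fun w => rho σ w * ringF (relDist σ y w) := by
  filter_upwards [ae_ne y D, ae_restrict_mem hDm] with w h1 h2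
  rw [ringF_relDist h.pos hy (axDist_pos h (by linarith [norm_lt_of_subset hD h2])) h1]
  ring

lemma integrableOn_ringPot (h : SmallScale σ) (hDm : MeasurableSet D) (hD : D ⊆ ball 0 2) {y : ℂ}
    (hy : 0 < axDist σ y) : IntegrableOn (fun w => rho σ w * ringF (relDist σ y w)) D := by
  refine Integrable.congr ?_ (ringPot_integrand_ae h hDm hD hy)
  exact (((integrableOn_rho_mul h hDm hD (integrableOn_neg_two_log hDm hD y)).add
    (integrableOn_rho_mul h hDm hD (integrableOn_ringJ h hDm hD hy))).add
    ((integrableOn_rho h hDm hD).mul_const _)).add (integrableOn_selfConst h hDm hD)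

lemma integral_add_add {f g k : ℂ → ℝ} {μ : Measure ℂ} (hf : Integrable f μ) (hg : Integrable g μ)
    (hk : Integrable k μ) : ∫ w, (f w + g w + k w) ∂μ =
          ∫ w, f w ∂μ + ∫ w, g w ∂μ + ∫ w, k w ∂μ := by
  rw [integral_add (f := fun w => f w + g w) (hf.add hg) hk, integral_add hf hg]

lemma ringPot_eq (h : SmallScale σ) (hDm : MeasurableSet D) (hD : D ⊆ ball 0 2) {y : ℂ}
    (hy : 0 < axDist σ y) : ringPot σ D y =
      logPot σ D y + corrPot σ D y + massRho σ D * log (axDist σ y) + selfConst σ D := by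
  unfold ringPot logPot corrPot massRho selfConst
  have i1 := integrableOn_rho_mul h hDm hD (integrableOn_neg_two_log hDm hD y)
  have i2 := integrableOn_rho_mul h hDm hD (integrableOn_ringJ h hDm hD hy)
  have i3 := (integrableOn_rho h hDm hD).mul_const (log (axDist σ y))
  have i4 := integrableOn_selfConst h hDm hD
  rw [← integral_congr_ae (ringPot_integrand_ae h hDm hD hy),
    integral_add (f := fun w => rho σ w * (-2 * log ‖y - w‖) + rho σ w * ringJ (relDist σ y w) +
        rho σ w * log (axDist σ y)) ((i1.add i2).add i3) i4,
    integral_add_add i1 i2 i3, integral_mul_const]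

/-- Lipschitz bound for differences of logarithmic potentials with a common weight bound. -/
lemma abs_integral_log_diff_le {f : ℂ → ℝ} {Z : Set ℂ} (hZ : MeasurableSet Z)
    (hv : volume Z ≠ ⊤) {c : ℝ} (hc0 : 0 ≤ c) (hf : ∀ w ∈ Z, |f w| ≤ c) (y z : ℂ) :
    |∫ w in Z, f w * (-2 * log ‖y - w‖ - -2 * log ‖z - w‖)| ≤
      c * ‖y - z‖ * (56 * volume.real Z ^ (1 / 4 : ℝ) + 4 * volume.real Z) := by
  have i1 := integrableOn_sing y hZ hv
  have i2 := integrableOn_sing z hZ hv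
  have i3 : IntegrableOn (fun w => c * ‖y - z‖ * (2 * (sing y w + sing z w + 2))) Z :=
    (((i1.add i2).add (integrableOn_const hv)).const_mul _).const_mul _
  have b : |∫ w in Z, f w * (-2 * log ‖y - w‖ - -2 * log ‖z - w‖)| ≤
      ∫ w in Z, c * ‖y - z‖ * (2 * (sing y w + sing z w + 2)) := by
    rw [← Real.norm_eq_abs]
    refine norm_integral_le_of_norm_le i3 ?_
    filter_upwards [ae_ne y Z, ae_ne z Z, ae_restrict_mem hZ] with w h1 h2 h3
    rw [Real.norm_eq_abs, abs_mul, ← mul_sub, abs_mul]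
    have := abs_log_norm_sub_le h1 h2
    rw [abs_neg, abs_two]
    calc |f w| * (2 * |log ‖y - w‖ - log ‖z - w‖|)
        ≤ c * (2 * (‖y - z‖ * (sing y w + sing z w + 2))) := by
          gcongr
          exact hf w h3
      _ = _ := by ring
  refine b.trans ?_
  rw [integral_const_mul, integral_const_mul]
  have e : ∫ w in Z, (sing y w + sing z w + 2) =
      (∫ w in Z, sing y w) + (∫ w in Z, sing z w) + 2 * volume.real Z := by
    rw [integral_add_add i1 i2 (integrableOn_const hv)]
    simp [mul_comm]
  rw [e]
  have k1 := integral_sing_le y hZ hv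
  have k2 := integral_sing_le z hZ hv
  refine mul_le_mul_of_nonneg_left ?_ (by positivity)
  linarith

end

/-- Measurable sets pinched between the two circles bounding the thin band. -/
structure InBand (σ : ℝ) (D : Set ℂ) : Prop where
  meas : MeasurableSet D
  inner : ball 0 (1 - bandWidth σ) ⊆ D
  outer : D ⊆ ball 0 (1 + bandWidth σ)

/-- The band between the two circles. -/
def band (σ : ℝ) : Set ℂ := ball 0 (1 + bandWidth σ) \ ball 0 (1 - bandWidth σ)

lemma measurableSet_band (σ : ℝ) : MeasurableSet (band σ) :=
  measurableSet_ball.diff measurableSet_ball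

lemma SmallScale.volume_band {σ : ℝ} (h : SmallScale σ) :
    volume.real (band σ) = 4 * π * bandWidth σ := by
  have h1 := h.bandWidth_pos
  have h2 := h.bandWidth_le_coarse
  unfold band
  rw [measureReal_sdiff (ball_subset_ball (by linarith)) measurableSet_ball
      (volume_ball_ne_top 0 _),
    volume_real_ball _ (by linarith), volume_real_ball _ (by linarith)]
  ring

lemma SmallScale.volume_band_le {σ : ℝ} (h : SmallScale σ) :
    volume.real (band σ) ≤ (1 / 10 ^ 45) ^ 4 := by
  rw [h.volume_band]
  have h2 := h.bandWidth_le
  have h3 := pi_lt_d2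
  have h4 := h.bandWidth_pos
  calc 4 * π * bandWidth σ ≤ 4 * 4 * (1 / 10 ^ 195) := by gcongr; linarith
    _ ≤ _ := by norm_num

lemma rpow_quarter_le {a b : ℝ} (ha : 0 ≤ a) (hb : 0 ≤ b) (h : a ≤ b ^ 4) :
    a ^ (1 / 4 : ℝ) ≤ b := by
  calc a ^ (1 / 4 : ℝ) ≤ (b ^ 4) ^ (1 / 4 : ℝ) := Real.rpow_le_rpow ha h (by norm_num)
    _ = b := by
      have := Real.pow_rpow_inv_natCast hb (show (4:ℕ) ≠ 0 by norm_num)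
      norm_num at this ⊢
      exact this

lemma band_ne_top (σ : ℝ) : volume (band σ) ≠ ⊤ :=
  ne_top_of_le_ne_top (volume_ball_ne_top 0 _) (measure_mono Set.sdiff_subset)

section
variable {σ : ℝ} {D : Set ℂ}

lemma InBand.subset_two (h : SmallScale σ) (hD : InBand σ D) : D ⊆ ball 0 2 :=
  hD.outer.trans (ball_subset_ball (by linarith [h.bandWidth_le_coarse]))

lemma InBand.ball {R : ℝ} (h1 : 1 - bandWidth σ ≤ R) (h2 : R ≤ 1 + bandWidth σ) :
    InBand σ (ball 0 R) :=
  ⟨measurableSet_ball, ball_subset_ball h1, ball_subset_ball h2⟩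

lemma InBand.sdiff_subset {D' : Set ℂ} (hD : InBand σ D) (hD' : InBand σ D') :
    D \ D' ⊆ band σ := fun _ hw => ⟨hD.outer hw.1, fun h => hw.2 (hD'.inner h)⟩

lemma setIntegral_sub_eq {f : ℂ → ℝ} {s t : Set ℂ} (hs : MeasurableSet s) (ht : MeasurableSet t)
    (fs : IntegrableOn f s) (ft : IntegrableOn f t) :
    (∫ w in s, f w) - ∫ w in t, f w = (∫ w in s \ t, f w) - ∫ w in t \ s, f w := by
  have h1 := integral_inter_add_sdiff ht fs
  have h2 := integral_inter_add_sdiff hs ft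
  rw [Set.inter_comm] at h2
  linarith

/-- The logarithmic potential of a set in the band is a small Lipschitz perturbation of the
potential of a disc. -/
lemma abs_logPot_sub_discPot_lip (h : SmallScale σ) (hD : InBand σ D) {R : ℝ}
    (h1 : 1 - bandWidth σ ≤ R) (h2 : R ≤ 1 + bandWidth σ) (y z : ℂ) :
    |(logPot σ D y - discPot R y) - (logPot σ D z - discPot R z)| ≤
      ‖y - z‖ * (1 / 10 ^ 40) := by
  have hB := InBand.ball h1 h2
  have hD2 := hD.subset_two h
  have hB2 := hB.subset_two h
  have hv := volume_ne_top_of_subset hD2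
  set g : ℂ → ℝ := fun w => -2 * log ‖y - w‖ - -2 * log ‖z - w‖ with hg
  have iD : IntegrableOn g D :=
    (integrableOn_neg_two_log hD.meas hD2 y).sub (integrableOn_neg_two_log hD.meas hD2 z)
  have iB : IntegrableOn g (Metric.ball 0 R) :=
    (integrableOn_neg_two_log hB.meas hB2 y).sub (integrableOn_neg_two_log hB.meas hB2 z)
  have e1 : logPot σ D y - logPot σ D z = ∫ w in D, rho σ w * g w := by
    unfold logPot
    rw [← integral_sub (integrableOn_rho_mul h hD.meas hD2 (integrableOn_neg_two_log hD.meas hD2 y))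
      (integrableOn_rho_mul h hD.meas hD2 (integrableOn_neg_two_log hD.meas hD2 z))]
    congr 1; ext w; simp only [hg]; ring
  have e2 : discPot R y - discPot R z = ∫ w in Metric.ball 0 R, g w := by
    unfold discPot
    rw [← integral_sub (integrableOn_neg_two_log hB.meas hB2 y)
      (integrableOn_neg_two_log hB.meas hB2 z)]
  have e3 : ∫ w in D, rho σ w * g w = (∫ w in D, (rho σ w - 1) * g w) + ∫ w in D, g w := by
    rw [← integral_add _ iD]
    · congr 1; ext w; ring
    · refine iD.bdd_mul (c := 1) ((continuous_rho σ).sub continuous_const).aestronglyMeasurable ?_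
      filter_upwards [ae_restrict_mem hD.meas] with w hw
      obtain ⟨a, b⟩ := rho_bounds h.pos (h.mul_norm_mem hD2 hw)
      rw [Real.norm_eq_abs, abs_le]; constructor <;> linarith
  have e4 := setIntegral_sub_eq hD.meas hB.meas iD iB
  have hσ := h.pos
  have b1 := abs_integral_log_diff_le hD.meas hv (c := 4 * σ) (by positivity)
    (f := fun w => rho σ w - 1) (fun w hw => by
      have k := abs_rho_sub_one_le hσ (h.mul_norm_mem hD2 hw)
      have k2 := norm_lt_of_subset hD2 hw
      nlinarith) y z
  have n1 : (D \ Metric.ball 0 R) ⊆ band σ := hD.sdiff_subset hB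
  have n2 : (Metric.ball 0 R \ D) ⊆ band σ := hB.sdiff_subset hD
  have aux : ∀ Z : Set ℂ, MeasurableSet Z → Z ⊆ band σ →
      |∫ w in Z, g w| ≤ ‖y - z‖ * (60 * (1 / 10 ^ 45)) := by
    intro Z hZ hZs
    have b := abs_integral_log_diff_le hZ (ne_top_of_le_ne_top (band_ne_top σ) (measure_mono hZs))
      zero_le_one (f := fun _ => 1) (fun _ _ => by simp) y z
    simp only [one_mul] at b
    refine b.trans ?_
    have m1 : volume.real Z ≤ (1 / 10 ^ 45) ^ 4 :=
      (measureReal_mono hZs (band_ne_top σ)).trans h.volume_band_le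
    have m2 := rpow_quarter_le measureReal_nonneg (by positivity) m1
    have m3 : ((1:ℝ) / 10 ^ 45) ^ 4 ≤ 1 / 10 ^ 45 := by norm_num
    refine mul_le_mul_of_nonneg_left ?_ (norm_nonneg _)
    linarith
  have b2 := aux _ (hD.meas.diff measurableSet_ball) n1
  have b3 := aux _ (measurableSet_ball.diff hD.meas) n2
  have m4 : volume.real D ≤ 16 := by
    have := volume_real_le_of_subset hD2
    linarith [pi_lt_d2]
  have m5 := rpow_quarter_le (b := 2) measureReal_nonneg (by norm_num)
    (m4.trans (by norm_num : (16:ℝ) ≤ 2 ^ 4))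
  have b4 : 4 * σ * ‖y - z‖ * (56 * volume.real D ^ (1 / 4 : ℝ) + 4 * volume.real D) ≤
      ‖y - z‖ * (1 / 10 ^ 45) := by
    have k : 4 * σ * (56 * volume.real D ^ (1 / 4 : ℝ) + 4 * volume.real D) ≤ 1 / 10 ^ 45 := by
      calc 4 * σ * (56 * volume.real D ^ (1 / 4 : ℝ) + 4 * volume.real D)
          ≤ 4 * (1 / 10 ^ 202) * (56 * 2 + 4 * 16) := by
            gcongr
            exact h.le
        _ ≤ 1 / 10 ^ 45 := by norm_num
    calc _ = ‖y - z‖ * (4 * σ * (56 * volume.real D ^ (1 / 4 : ℝ) + 4 * volume.real D)) := by ring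
      _ ≤ _ := mul_le_mul_of_nonneg_left k (norm_nonneg _)
  have e5 : (logPot σ D y - discPot R y) - (logPot σ D z - discPot R z) =
      (∫ w in D, (rho σ w - 1) * g w) + (∫ w in D \ Metric.ball 0 R, g w) -
        ∫ w in Metric.ball 0 R \ D, g w := by linarith
  rw [e5]
  have b5 := b1.trans b4
  have hn := norm_nonneg (y - z)
  have fin : ‖y - z‖ * (1 / 10 ^ 45) + ‖y - z‖ * (60 * (1 / 10 ^ 45)) +
      ‖y - z‖ * (60 * (1 / 10 ^ 45)) ≤ ‖y - z‖ * (1 / 10 ^ 40) := by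
    rw [← mul_add, ← mul_add]
    exact mul_le_mul_of_nonneg_left (by norm_num) hn
  rw [abs_le] at *
  constructor <;> linarith [b5.1, b5.2, b2.1, b2.2, b3.1, b3.2]

lemma abs_corrPot_sub_le (h : SmallScale σ) (hDm : MeasurableSet D) (hD : D ⊆ ball 0 2) {y z : ℂ}
    (hy : ‖y‖ ≤ 16) (hz : ‖z‖ ≤ 16) :
    |corrPot σ D y - corrPot σ D z| ≤ 160 * (σ * ‖y - z‖) := by
  unfold corrPot
  rw [← integral_sub (integrableOn_rho_mul h hDm hD (integrableOn_ringJ h hDm hD (axDist_pos h hy)))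
    (integrableOn_rho_mul h hDm hD (integrableOn_ringJ h hDm hD (axDist_pos h hz)))]
  have hσ := h.pos
  refine (abs_setIntegral_le (volume_ne_top_of_subset hD) (c := 5 / 4 * (8 * (σ * ‖y - z‖)))
    fun w hw => ?_).trans ?_
  · rw [← mul_sub, abs_mul]
    gcongr
    · exact abs_rho_le_mem h hD hw
    · exact abs_ringJ_relDist_sub_le hσ (h.mul_norm_le hy) (h.mul_norm_le hz) (h.mul_norm_mem hD hw)
  · have := volume_real_le_of_subset hD
    have h3 := pi_lt_d2
    calc 5 / 4 * (8 * (σ * ‖y - z‖)) * volume.real D ≤ 5 / 4 * (8 * (σ * ‖y - z‖)) * 16 := by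
          gcongr; linarith
      _ = _ := by ring

lemma massRho_bounds (h : SmallScale σ) (hDm : MeasurableSet D) (hD : D ⊆ ball 0 2) :
    3 / 4 * volume.real D ≤ massRho σ D ∧ massRho σ D ≤ 5 / 4 * volume.real D := by
  have hv := volume_ne_top_of_subset hD
  have i := integrableOn_rho h hDm hD
  unfold massRho
  constructor
  · have := setIntegral_mono_on (integrableOn_const hv (C := (3 / 4 : ℝ))) i hDm
      fun w hw => (rho_bounds h.pos (h.mul_norm_mem hD hw)).1
    simpa [mul_comm] using this
  · have := setIntegral_mono_on i (integrableOn_const hv (C := (5 / 4 : ℝ))) hDm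
      fun w hw => (rho_bounds h.pos (h.mul_norm_mem hD hw)).2
    simpa [mul_comm] using this

/-- The excess of the ring potential over a combination of the two profiles. -/
def excess (σ : ℝ) (D : Set ℂ) (b x : ℝ) (y : ℂ) : ℝ :=
  ringPot σ D y - b * profA σ y - x * profB σ y

lemma excess_eq (h : SmallScale σ) (hDm : MeasurableSet D) (hD : D ⊆ ball 0 2) (b x : ℝ) {y : ℂ}
    (hy : 0 < axDist σ y) : excess σ D b x y =
      logPot σ D y + corrPot σ D y + massRho σ D * log (axDist σ y) + selfConst σ D -
        b * profA σ y - x * profB σ y := by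
  unfold excess; rw [ringPot_eq h hDm hD hy]

/-- The excess is a small Lipschitz perturbation of the potential of a disc. -/
lemma abs_excess_sub_discPot_lip (h : SmallScale σ) (hD : InBand σ D) {b x : ℝ}
    (hb : |b| ≤ 1000 * (-log σ)) (hx : |x| ≤ 1000 * (-log σ)) {R : ℝ}
    (h1 : 1 - bandWidth σ ≤ R) (h2 : R ≤ 1 + bandWidth σ) {y z : ℂ} (hy : ‖y‖ ≤ 16)
    (hz : ‖z‖ ≤ 16) :
    |(excess σ D b x y - discPot R y) - (excess σ D b x z - discPot R z)| ≤
      ‖y - z‖ * (1 / 10 ^ 35) := by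
  have hD2 := hD.subset_two h
  have hσ := h.pos
  have hL := h.log_large
  have sy := h.mul_norm_le hy
  have sz := h.mul_norm_le hz
  rw [excess_eq h hD.meas hD2 b x (axDist_pos h hy), excess_eq h hD.meas hD2 b x (axDist_pos h hz)]
  have k1 := abs_logPot_sub_discPot_lip h hD h1 h2 y z
  have k2 := abs_corrPot_sub_le h hD.meas hD2 hy hz
  have k3 := abs_log_axDist_sub_log_le hσ sy sz
  have k4 := abs_profA_sub_le hσ sy sz
  have k5 := abs_profB_sub_profB_le hσ sy sz
  obtain ⟨m1, m2⟩ := massRho_bounds h hD.meas hD2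
  have m3 := volume_real_le_of_subset hD2
  have m4 : 0 ≤ volume.real D := measureReal_nonneg
  have m5 : |massRho σ D| ≤ 20 := by
    rw [abs_le]; constructor <;> linarith [pi_lt_d2]
  set d := ‖y - z‖
  have hd : 0 ≤ d := norm_nonneg _
  have l3 : |massRho σ D * log (axDist σ y) - massRho σ D * log (axDist σ z)| ≤
      20 * (2 * (σ * d)) := by
    rw [← mul_sub, abs_mul]; gcongr
  have hL0 : 0 ≤ -log σ := by linarith
  have l4 : |b * profA σ y - b * profA σ z| ≤ 1000 * (-log σ) * (3 * (σ * d)) := by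
    rw [← mul_sub, abs_mul]; gcongr
  have l5 : |x * profB σ y - x * profB σ z| ≤ 1000 * (-log σ) * (3 * (σ * d)) := by
    rw [← mul_sub, abs_mul]; gcongr
  have s1 : σ * d ≤ d * (1 / 10 ^ 202) := by
    rw [mul_comm]; exact mul_le_mul_of_nonneg_left h.le hd
  have s2 : 1000 * (-log σ) * (3 * (σ * d)) ≤ d * (3000 / 10 ^ 200) := by
    have : 1000 * (-log σ) * (3 * (σ * d)) = d * (3000 * (σ * (-log σ))) := by ring
    rw [this]
    refine mul_le_mul_of_nonneg_left ?_ hd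
    have := h.mul_log_small
    rw [div_eq_mul_one_div]
    exact mul_le_mul_of_nonneg_left this (by norm_num)
  have fin : d * (1 / 10 ^ 40) + 200 * (d * (1 / 10 ^ 202)) + 2 * (d * (3000 / 10 ^ 200)) ≤
      d * (1 / 10 ^ 35) := by
    have : d * (1 / 10 ^ 40) + 200 * (d * (1 / 10 ^ 202)) + 2 * (d * (3000 / 10 ^ 200)) =
      d * (1 / 10 ^ 40 + 200 * (1 / 10 ^ 202) + 2 * (3000 / 10 ^ 200)) := by ring
    rw [this]
    exact mul_le_mul_of_nonneg_left (by norm_num) hd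
  rw [abs_le] at *
  constructor <;> linarith [k1.1, k1.2, k2.1, k2.2, l3.1, l3.2, l4.1, l4.2, l5.1, l5.2]

end

/-- Quantitative radial decrease of the potential of a disc. -/
lemma discPot_sub_ge {R : ℝ} (hR1 : 9 / 10 ≤ R) {y z : ℂ} (hyz : ‖y‖ ≤ ‖z‖)
    (hz1 : 1 / 2 ≤ ‖z‖) (hz2 : ‖z‖ ≤ 8) : 1 / 2 * (‖z‖ - ‖y‖) ≤ discPot R y - discPot R z := by
  have hp := pi_gt_d2
  have h0 := norm_nonneg y
  have inside : ∀ a b : ℝ, 0 ≤ a → a ≤ b → 1 / 2 ≤ b → 1 / 2 * (b - a) ≤ π * (b ^ 2 - a ^ 2) := by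
    intro a b ha hab hb
    have : π * (b ^ 2 - a ^ 2) = (π * (b + a)) * (b - a) := by ring
    rw [this]
    refine mul_le_mul_of_nonneg_right ?_ (by linarith)
    nlinarith
  have outside : ∀ a b : ℝ, 0 < a → a ≤ b → b ≤ 8 →
      1 / 2 * (b - a) ≤ 2 * π * R ^ 2 * (log b - log a) := by
    intro a b ha hab hb
    have hb0 : 0 < b := ha.trans_le hab
    have h1 := log_sub_log_le ha hb0
    have h2 : (b - a) / 8 ≤ log b - log a := by
      have : (b - a) / 8 ≤ (b - a) / b := div_le_div_of_nonneg_left (by linarith) hb0 hb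
      have k := Real.one_sub_inv_le_log_of_pos (show 0 < b / a by positivity)
      rw [Real.log_div hb0.ne' ha.ne'] at k
      have : 1 - (b / a)⁻¹ = (b - a) / b := by field_simp
      linarith
    have h3 : 4 ≤ 2 * π * R ^ 2 := by nlinarith
    have h4 : 0 ≤ (b - a) / 8 := by linarith
    calc 1 / 2 * (b - a) = 4 * ((b - a) / 8) := by ring
      _ ≤ 2 * π * R ^ 2 * (log b - log a) := by gcongr
  rcases le_total ‖z‖ R with h | h
  · rw [discPot_inside h, discPot_inside (hyz.trans h)]
    linarith [inside _ _ h0 hyz hz1]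
  · rcases le_total ‖y‖ R with h' | h'
    · rw [discPot_outside (by linarith) h, discPot_inside h']
      have a1 := inside _ _ h0 h' (by linarith)
      have a2 := outside _ _ (by linarith) h hz2
      linarith
    · rw [discPot_outside (by linarith) h, discPot_outside (by linarith) h']
      linarith [outside _ _ (by linarith) hyz hz2]

/-- The coefficient that cancels the dipole term on circles. -/
def dipoleConst : ℝ := 1 + 3 / 2 * discMoment / π

lemma abs_dipoleConst_le : |dipoleConst| ≤ 40 := by
  have hv := volume_ball_ne_top 0 1
  have hm : MeasurableSet (ball (0:ℂ) 1) := measurableSet_ball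
  have v1 : volume.real (ball (0:ℂ) 1) = π := by rw [volume_real_ball _ zero_le_one]; ring
  have i1 := integrableOn_sing (1:ℂ) hm hv
  have i2 : IntegrableOn (fun w => 2 * (sing 1 w + 2)) (ball (0:ℂ) 1) :=
    (i1.add (integrableOn_const hv)).const_mul _
  have b : |discMoment| ≤ ∫ w in ball (0:ℂ) 1, 2 * (sing 1 w + 2) := by
    unfold discMoment
    rw [← Real.norm_eq_abs]
    refine norm_integral_le_of_norm_le i2 ?_
    filter_upwards [ae_ne 1 (ball (0:ℂ) 1), ae_restrict_mem hm] with w h1 h2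
    rw [mem_ball_zero_iff] at h2
    have h3 := abs_log_le_sing h1
    have h4 := norm_sub_le (1:ℂ) w
    rw [norm_one] at h4
    have h5 := (Complex.abs_re_le_norm w).trans h2.le
    rw [Real.norm_eq_abs, abs_mul, abs_mul, abs_neg, abs_two]
    have : |w.re| * |log ‖1 - w‖| ≤ 1 * (sing 1 w + 2) := by
      gcongr; linarith
    linarith
  rw [integral_const_mul, integral_add i1 (integrableOn_const hv)] at b
  have k := integral_sing_le (1:ℂ) hm hv
  rw [v1] at k
  have q := rpow_quarter_le (a := π) (b := 14 / 10) pi_pos.le (by norm_num)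
    (by have := pi_lt_d2; norm_num; linarith)
  have c : ∫ _w in ball (0:ℂ) 1, (2:ℝ) = π * 2 := by simp [v1]
  rw [c] at b
  have hp := pi_gt_d2
  have hp' := pi_lt_d2
  have b2 : |discMoment| ≤ 60 := by linarith
  unfold dipoleConst
  have : |3 / 2 * discMoment / π| ≤ 39 := by
    rw [abs_div, abs_of_pos pi_pos, div_le_iff₀ pi_pos, abs_mul, abs_of_pos (by norm_num)]
    linarith
  rw [abs_le] at *
  constructor <;> linarith

/-- The self-interaction logarithm. -/
def ringLog (σ : ℝ) : ℝ := 2 * (-log σ) + ringJ 0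

/-- The coefficient of `profA` in the normalized kernel. -/
def kerCoeff (σ : ℝ) (w : ℂ) : ℝ := rho σ w * (ringLog σ + log (axDist σ w)) - 4 / 5

/-- The normalized kernel, positive near the unit circle. -/
def ringK (σ : ℝ) (y w : ℂ) : ℝ :=
  rho σ w * ringF (relDist σ y w) - kerCoeff σ w * profA σ y -
    (w.re / σ + dipoleConst) * profB σ y - y.im * w.im

/-- The multiplier of `profA`. -/
def multA (σ : ℝ) (D : Set ℂ) : ℝ := (∫ w in D, kerCoeff σ w) + 4 / 5 * π

/-- The multiplier of `profB`. -/
def multB (σ : ℝ) (D : Set ℂ) : ℝ := ∫ w in D, (w.re / σ + dipoleConst)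

section
variable {σ : ℝ} {D : Set ℂ}

lemma ringLog_bounds (h : SmallScale σ) : 3 / 2 * (-log σ) ≤ ringLog σ ∧
    ringLog σ ≤ 5 / 2 * (-log σ) := by
  have h1 := abs_le.1 abs_ringJ_zero_le
  have h2 := h.log_large
  unfold ringLog
  constructor <;> linarith

lemma abs_kerCoeff_le (h : SmallScale σ) {w : ℂ} (hw : ‖w‖ ≤ 2) :
    |kerCoeff σ w| ≤ 4 * (-log σ) := by
  have s := h.mul_norm_le (by linarith : ‖w‖ ≤ 16)
  have h1 := rho_bounds h.pos s
  have h2 := abs_le.1 (abs_log_axDist_le h.pos s)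
  have h3 := ringLog_bounds h
  have h4 := h.log_large
  unfold kerCoeff
  have h5 : 0 ≤ ringLog σ + log (axDist σ w) := by linarith
  have h6 : rho σ w * (ringLog σ + log (axDist σ w)) ≤ 5 / 4 * (5 / 2 * (-log σ) + 1) := by
    gcongr
    · exact h1.2
    · exact h3.2
    · linarith
  have h7 : 0 ≤ rho σ w * (ringLog σ + log (axDist σ w)) := mul_nonneg (by linarith) h5
  rw [abs_le]; constructor <;> linarith

lemma integrableOn_kerCoeff (h : SmallScale σ) (hDm : MeasurableSet D) (hD : D ⊆ ball 0 2) :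
    IntegrableOn (kerCoeff σ) D := by
  refine integrableOn_of_abs_le ?_ hDm hD (c := 4 * (-log σ))
    fun w hw => abs_kerCoeff_le h (norm_lt_of_subset hD hw).le
  have := (continuous_rho σ).measurable
  have := (continuous_axDist σ).measurable
  unfold kerCoeff; fun_prop

lemma integrableOn_re (hDm : MeasurableSet D) (hD : D ⊆ ball 0 2) :
    IntegrableOn (fun w : ℂ => w.re) D :=
  integrableOn_of_abs_le (by fun_prop) hDm hD (c := 2)
    fun w hw => (Complex.abs_re_le_norm w).trans (norm_lt_of_subset hD hw).le

lemma integrableOn_im (hDm : MeasurableSet D) (hD : D ⊆ ball 0 2) :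
    IntegrableOn (fun w : ℂ => w.im) D :=
  integrableOn_of_abs_le (by fun_prop) hDm hD (c := 2)
    fun w hw => (Complex.abs_im_le_norm w).trans (norm_lt_of_subset hD hw).le

lemma integrableOn_dipole (hDm : MeasurableSet D) (hD : D ⊆ ball 0 2) :
    IntegrableOn (fun w : ℂ => w.re / σ + dipoleConst) D :=
  ((integrableOn_re hDm hD).div_const σ).add (integrableOn_const (volume_ne_top_of_subset hD))

lemma integrableOn_ringK (h : SmallScale σ) (hDm : MeasurableSet D) (hD : D ⊆ ball 0 2) {y : ℂ}
    (hy : 0 < axDist σ y) : IntegrableOn (ringK σ y) D :=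
  (((integrableOn_ringPot h hDm hD hy).sub ((integrableOn_kerCoeff h hDm hD).mul_const _)).sub
    ((integrableOn_dipole hDm hD).mul_const _)).sub ((integrableOn_im hDm hD).const_mul _)

lemma integral_ringK (h : SmallScale σ) (hDm : MeasurableSet D) (hD : D ⊆ ball 0 2) {y : ℂ}
    (hy : 0 < axDist σ y) : (∫ w in D, ringK σ y w) - 4 / 5 * π * profA σ y =
      excess σ D (multA σ D) (multB σ D) y - y.im * ∫ w in D, w.im := by
  have i1 := integrableOn_ringPot h hDm hD hy
  have i2 := (integrableOn_kerCoeff h hDm hD).mul_const (profA σ y)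
  have i3 := (integrableOn_dipole (σ := σ) hDm hD).mul_const (profB σ y)
  have i4 := (integrableOn_im hDm hD).const_mul y.im
  have e : ∫ w in D, ringK σ y w = ringPot σ D y - (∫ w in D, kerCoeff σ w) * profA σ y -
      multB σ D * profB σ y - y.im * ∫ w in D, w.im := by
    unfold ringK
    rw [integral_sub (f := fun w => rho σ w * ringF (relDist σ y w) - kerCoeff σ w * profA σ y -
      (w.re / σ + dipoleConst) * profB σ y) ((i1.sub i2).sub i3) i4,
      integral_sub (f := fun w => rho σ w * ringF (relDist σ y w) - kerCoeff σ w * profA σ y)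
      (i1.sub i2) i3, integral_sub i1 i2, integral_mul_const, integral_mul_const,
      integral_const_mul]
    rfl
  rw [e]
  unfold excess multA
  ring

lemma abs_multA_le (h : SmallScale σ) (hD : D ⊆ ball 0 2) : |multA σ D| ≤ 100 * (-log σ) := by
  have h1 := abs_setIntegral_le (volume_ne_top_of_subset hD)
    fun w hw => abs_kerCoeff_le h (norm_lt_of_subset hD hw).le
  have h2 := volume_real_le_of_subset hD
  have h3 := h.log_large
  have hp := pi_gt_d2
  have hp' := pi_lt_d2
  have h4 : 4 * (-log σ) * volume.real D ≤ 4 * (-log σ) * 13 := by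
    gcongr; linarith
  unfold multA
  rw [abs_le] at *
  constructor <;> linarith

lemma abs_integral_re_le (h : SmallScale σ) (hD : InBand σ D) :
    |∫ w in D, w.re| ≤ 30 * bandWidth σ := by
  have hB := InBand.ball (σ := σ) (R := 1 - bandWidth σ) le_rfl (by linarith [h.bandWidth_pos])
  have hs := setIntegral_sub_eq hD.meas hB.meas (integrableOn_re hD.meas (hD.subset_two h))
    (integrableOn_re hB.meas (hB.subset_two h))
  rw [integral_re_ball, Set.sdiff_eq_empty.2 hD.inner, setIntegral_empty, sub_zero, sub_zero] at hs
  rw [hs]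
  have hsub := hD.sdiff_subset hB
  have b := abs_setIntegral_le (ne_top_of_le_ne_top (band_ne_top σ) (measure_mono hsub))
    (f := fun w : ℂ => w.re) (c := 2)
    (fun w hw => (Complex.abs_re_le_norm w).trans (norm_lt_of_subset (hD.subset_two h) hw.1).le)
  have m := measureReal_mono hsub (band_ne_top σ)
  rw [h.volume_band] at m
  have := h.bandWidth_pos
  have hp' := pi_lt_d2
  refine b.trans ?_
  nlinarith

lemma multB_eq (hDm : MeasurableSet D) (hD : D ⊆ ball 0 2) :
    multB σ D = (∫ w in D, w.re) / σ + dipoleConst * volume.real D := by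
  unfold multB
  rw [integral_add ((integrableOn_re hDm hD).div_const σ)
    (integrableOn_const (volume_ne_top_of_subset hD)), integral_div]
  simp [mul_comm]

lemma abs_multB_le (h : SmallScale σ) (hD : InBand σ D) : |multB σ D| ≤ 600 := by
  have hD2 := hD.subset_two h
  rw [multB_eq hD.meas hD2]
  have h1 := abs_integral_re_le h hD
  have hσ := h.pos
  have h2 : |(∫ w in D, w.re) / σ| ≤ 30 := by
    rw [abs_div, abs_of_pos hσ, div_le_iff₀ hσ]
    have := h.bandWidth_le_mul
    refine h1.trans ?_
    nlinarith
  have h3 : |dipoleConst * volume.real D| ≤ 40 * 13 := by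
    rw [abs_mul, abs_of_nonneg (measureReal_nonneg : 0 ≤ volume.real D)]
    have := volume_real_le_of_subset hD2
    have hp' := pi_lt_d2
    gcongr
    · exact abs_dipoleConst_le
    · linarith
  rw [abs_le] at *
  constructor <;> linarith

lemma ringK_eq (h : SmallScale σ) {y w : ℂ} (hy : 0 < axDist σ y) (hw : 0 < axDist σ w)
    (hyw : y ≠ w) : ringK σ y w =
      rho σ w * (-2 * log ‖y - w‖ - (y.re * w.re + y.im * w.im) + 4 / 5) +
      ((rho σ w - 1) * (y.re * w.re + y.im * w.im) + 4 / 5 * (profA σ y - rho σ w) +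
        rho σ w * log (axDist σ y) + rho σ w * (ringJ (relDist σ y w) - ringJ 0) +
        rho σ w * (ringLog σ + log (axDist σ w)) * (1 - profA σ y) -
        w.re / σ * (profB σ y - σ * y.re) - dipoleConst * profB σ y) := by
  have hσ := h.pos.ne'
  have e : w.re / σ * (profB σ y - σ * y.re) = w.re / σ * profB σ y - y.re * w.re := by
    field_simp
  rw [e]
  unfold ringK kerCoeff ringLog
  rw [ringF_relDist h.pos hy hw hyw]
  ring

lemma log_part_pos {δ : ℝ} (h0 : 0 ≤ δ) (h1 : δ ≤ 1 / 1000) {y w : ℂ} (hy : ‖y‖ ≤ 1 + δ)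
    (hw : ‖w‖ ≤ 1 + δ) (hyw : y ≠ w) :
    1 / 20 ≤ -2 * log ‖y - w‖ - (y.re * w.re + y.im * w.im) + 4 / 5 := by
  have hd : 0 < ‖y - w‖ := norm_pos_iff.2 (sub_ne_zero.2 hyw)
  have e1 : ‖y - w‖ ^ 2 = ‖y‖ ^ 2 + ‖w‖ ^ 2 - 2 * (y.re * w.re + y.im * w.im) := by
    rw [Complex.sq_norm, Complex.sq_norm, Complex.sq_norm, Complex.normSq_apply,
      Complex.normSq_apply, Complex.normSq_apply, Complex.sub_re, Complex.sub_im]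
    ring
  have k := Real.log_le_sub_one_of_pos (show 0 < ‖y - w‖ ^ 2 / 2 by positivity)
  rw [Real.log_div (by positivity) (by norm_num), Real.log_pow] at k
  push_cast at k
  have l2 := Real.log_two_lt_d9
  have n1 : ‖y‖ ^ 2 ≤ (1 + δ) ^ 2 := by gcongr
  have n2 : ‖w‖ ^ 2 ≤ (1 + δ) ^ 2 := by gcongr
  nlinarith

lemma ringK_pos (h : SmallScale σ) {y w : ℂ} (hy : ‖y‖ ≤ 1 + bandWidth σ)
    (hw : ‖w‖ ≤ 1 + bandWidth σ) (hyw : y ≠ w) : 0 < ringK σ y w := by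
  have hδ := h.bandWidth_le_coarse
  have hσ := h.pos
  have hL := h.log_large
  have sy := h.mul_norm_le (by linarith : ‖y‖ ≤ 16)
  have sw := h.mul_norm_le (by linarith : ‖w‖ ≤ 16)
  have y2 : ‖y‖ ≤ 2 := by linarith
  have w2 : ‖w‖ ≤ 2 := by linarith
  have ty : σ * ‖y‖ ≤ 2 * σ := by nlinarith
  have tw : σ * ‖w‖ ≤ 2 * σ := by nlinarith
  have tys : (σ * ‖y‖) ^ 2 ≤ 4 * σ ^ 2 := by
    calc (σ * ‖y‖) ^ 2 ≤ (2 * σ) ^ 2 := by gcongr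
      _ = _ := by ring
  rw [ringK_eq h (axDist_pos h (by linarith)) (axDist_pos h (by linarith)) hyw]
  have p := log_part_pos h.bandWidth_pos.le hδ hy hw hyw
  have r := rho_bounds hσ sw
  have c1 : |(rho σ w - 1) * (y.re * w.re + y.im * w.im)| ≤ 4 * σ * 8 := by
    rw [abs_mul]
    gcongr
    · linarith [abs_rho_sub_one_le hσ sw]
    · have a1 := (Complex.abs_re_le_norm y).trans y2
      have a2 := (Complex.abs_im_le_norm y).trans y2
      have a3 := (Complex.abs_re_le_norm w).trans w2
      have a4 := (Complex.abs_im_le_norm w).trans w2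
      calc |y.re * w.re + y.im * w.im| ≤ |y.re| * |w.re| + |y.im| * |w.im| := by
            rw [← abs_mul, ← abs_mul]; exact abs_add_le _ _
        _ ≤ 2 * 2 + 2 * 2 := by gcongr
        _ = 8 := by norm_num
  have A := profA_bounds hσ sy
  have c2 := abs_le.1 (abs_rho_sub_one_le hσ sw)
  have rr : |rho σ w| ≤ 5 / 4 := by rw [abs_le]; constructor <;> linarith
  have c3 : |rho σ w * log (axDist σ y)| ≤ 5 / 4 * (4 * σ) := by
    rw [abs_mul]; gcongr; linarith [abs_log_axDist_le hσ sy]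
  have c4 : |rho σ w * (ringJ (relDist σ y w) - ringJ 0)| ≤ 5 / 4 * (200 * (σ ^ 2 * (-log σ))) := by
    rw [abs_mul]; gcongr
    exact abs_ringJ_relDist_sub_zero_le h (by linarith) w2 hyw
  have kc := abs_le.1 (abs_kerCoeff_le h w2)
  have c5 : |rho σ w * (ringLog σ + log (axDist σ w)) * (1 - profA σ y)| ≤
      5 * (-log σ) * (4 * σ ^ 2) := by
    rw [abs_mul]
    unfold kerCoeff at kc
    gcongr
    · rw [abs_le]; constructor <;> linarith
    · rw [abs_le]; constructor <;> linarith
  have c6 : |w.re / σ * (profB σ y - σ * y.re)| ≤ 8 * σ := by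
    have a3 := (Complex.abs_re_le_norm w).trans w2
    rw [abs_mul, abs_div, abs_of_pos hσ]
    calc |w.re| / σ * |profB σ y - σ * y.re| ≤ 2 / σ * (4 * σ ^ 2) := by
          gcongr; exact (abs_profB_sub_le hσ sy).trans tys
      _ = 8 * σ := by field_simp; norm_num
  have c7 : |dipoleConst * profB σ y| ≤ 40 * (4 * σ) := by
    rw [abs_mul]
    gcongr
    · exact abs_dipoleConst_le
    · have b1 := abs_le.1 (abs_profB_sub_le hσ sy)
      have b2 := abs_le.1 (abs_re_scale hσ sy).2.2
      have := h.le_coarse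
      rw [abs_le]
      constructor <;> nlinarith
  have s1 := h.le_coarse
  have s2 : σ ≤ 1 / 10 ^ 6 := h.le.trans (by norm_num)
  have s3 : σ * (-log σ) ≤ 1 / 10 ^ 6 := h.mul_log_small.trans (by norm_num)
  have s4 : σ ^ 2 * (-log σ) ≤ 1 / 10 ^ 6 := by
    have : σ ^ 2 * (-log σ) = σ * (σ * (-log σ)) := by ring
    rw [this]; nlinarith
  have q : 3 / 4 * (1 / 20) ≤ rho σ w * (-2 * log ‖y - w‖ - (y.re * w.re + y.im * w.im) +
      4 / 5) := by
    exact mul_le_mul r.1 p (by norm_num) (by linarith)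
  rw [abs_le] at c1 c3 c4 c5 c6 c7
  have s5 : 5 * (-log σ) * (4 * σ ^ 2) = 20 * (σ ^ 2 * (-log σ)) := by ring
  linarith [c1.1, c3.1, c4.1, c5.1, c6.2, c7.2, A.1, c2.2]

end

section
variable {σ : ℝ}

/-- The leading part of the normalized kernel, modulo a multiple of the first coordinate. -/
def ringKMain (σ : ℝ) (y w : ℂ) : ℝ :=
  -2 * log ‖y - w‖ + 3 / 2 * σ * (-2 * (w.re * log ‖y - w‖)) -
    (y.re + (profB σ y - σ * y.re) / σ) * w.re - y.im * w.im +
    (4 / 5 * profA σ y + (1 - dipoleConst) * σ * y.re)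

lemma abs_ringK_sub_main_le (h : SmallScale σ) {y w : ℂ} (hy : ‖y‖ ≤ 11 / 10)
    (hw : ‖w‖ ≤ 11 / 10) (hyw : y ≠ w) :
    |ringK σ y w - ringKMain σ y w| ≤ 4 * σ ^ 2 * sing y w + 320 * (σ ^ 2 * (-log σ)) := by
  have hσ := h.pos
  have sy := h.mul_norm_le (by linarith : ‖y‖ ≤ 16)
  have sw := h.mul_norm_le (by linarith : ‖w‖ ≤ 16)
  have hL := h.log_large
  rw [ringK_eq h (axDist_pos h (by linarith)) (axDist_pos h (by linarith)) hyw]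
  have e : ∀ r A B l J : ℝ, ∀ J0 : ℝ, r * (-2 * log ‖y - w‖ - (y.re * w.re + y.im * w.im) + 4 / 5) +
      ((r - 1) * (y.re * w.re + y.im * w.im) + 4 / 5 * (A - r) +
        r * l + r * (J - J0) +
        r * (ringLog σ + log (axDist σ w)) * (1 - A) -
        w.re / σ * (B - σ * y.re) - dipoleConst * B) -
      (-2 * log ‖y - w‖ + 3 / 2 * σ * (-2 * (w.re * log ‖y - w‖)) -
        (y.re + (B - σ * y.re) / σ) * w.re - y.im * w.im +
        (4 / 5 * A + (1 - dipoleConst) * σ * y.re)) =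
      (r - 1 - 3 / 2 * (σ * w.re)) * (-2 * log ‖y - w‖) + (r - 1) * l + (l - σ * y.re) +
        r * (J - J0) + r * (ringLog σ + log (axDist σ w)) * (1 - A) -
        dipoleConst * (B - σ * y.re) := by
    intro r A B l J J0; field_simp; ring
  unfold ringKMain
  rw [e]
  have ny : (σ * ‖y‖) ^ 2 ≤ 2 * σ ^ 2 := by
    rw [mul_pow]
    nlinarith [norm_nonneg y, pow_le_pow_left₀ (norm_nonneg y) hy 2, sq_nonneg σ]
  have nw : (σ * ‖w‖) ^ 2 ≤ 2 * σ ^ 2 := by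
    rw [mul_pow]
    nlinarith [norm_nonneg w, pow_le_pow_left₀ (norm_nonneg w) hw 2, sq_nonneg σ]
  have ly := abs_log_le_sing hyw
  have dyw := norm_sub_le y w
  have sn : 0 ≤ sing y w := sing_nonneg y w
  have c1 : |(rho σ w - 1 - 3 / 2 * (σ * w.re)) * (-2 * log ‖y - w‖)| ≤
      2 * σ ^ 2 * (2 * (sing y w + 3)) := by
    rw [abs_mul, abs_mul, abs_neg, abs_two]
    gcongr
    · exact (abs_rho_expand hσ sw).trans nw
    · linarith
  have c2 : |(rho σ w - 1) * log (axDist σ y)| ≤ (2 * (σ * 2)) * (2 * (σ * 2)) := by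
    rw [abs_mul]
    gcongr
    · refine (abs_rho_sub_one_le hσ sw).trans ?_; gcongr; linarith
    · refine (abs_log_axDist_le hσ sy).trans ?_; gcongr; linarith
  have c3 : |log (axDist σ y) - σ * y.re| ≤ 4 * σ ^ 2 := by
    refine (abs_log_axDist_sub_le hσ sy).trans ?_; linarith
  have c4 : |rho σ w * (ringJ (relDist σ y w) - ringJ 0)| ≤ 5 / 4 * (200 * (σ ^ 2 * (-log σ))) := by
    rw [abs_mul]
    have r := rho_bounds hσ sw
    gcongr
    · rw [abs_of_pos (by linarith)]; exact r.2
    · exact abs_ringJ_relDist_sub_zero_le h (by linarith) (by linarith) hyw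
  have kc := abs_le.1 (abs_kerCoeff_le h (by linarith : ‖w‖ ≤ 2))
  have pA := profA_bounds hσ sy
  have c5 : |rho σ w * (ringLog σ + log (axDist σ w)) * (1 - profA σ y)| ≤
      5 * (-log σ) * (2 * σ ^ 2) := by
    rw [abs_mul]
    unfold kerCoeff at kc
    gcongr
    · rw [abs_le]; constructor <;> linarith
    · rw [abs_le]; constructor <;> linarith [sq_nonneg σ]
  have c6 : |dipoleConst * (profB σ y - σ * y.re)| ≤ 40 * (2 * σ ^ 2) := by
    rw [abs_mul]
    gcongr
    · exact abs_dipoleConst_le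
    · exact (abs_profB_sub_le hσ sy).trans ny
  have hs : 100 * σ ^ 2 ≤ σ ^ 2 * (-log σ) := by nlinarith [sq_nonneg σ]
  rw [abs_le] at *
  have s5 : 5 * (-log σ) * (2 * σ ^ 2) = 10 * (σ ^ 2 * (-log σ)) := by ring
  rw [s5] at c5
  constructor <;> linarith [c1.1, c2.1, c3.1, c4.1, c5.1, c6.1, c1.2, c2.2, c3.2, c4.2, c5.2, c6.2]

lemma integral_ringKMain {y : ℂ} (hy : y ≠ 0) (hR : ‖y‖ ≤ 2) :
    IntegrableOn (ringKMain σ y) (ball 0 ‖y‖) ∧ ∫ w in ball (0:ℂ) ‖y‖, ringKMain σ y w =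
      -(2 * π) * ‖y‖ ^ 2 * log ‖y‖ + 4 / 5 * π * ‖y‖ ^ 2 * profA σ y := by
  have hs : ball (0:ℂ) ‖y‖ ⊆ ball 0 2 := ball_subset_ball hR
  have i1 := integrableOn_neg_two_log (D := ball (0:ℂ) ‖y‖) measurableSet_ball hs y
  have i2 : IntegrableOn (fun w => -2 * (w.re * log ‖y - w‖)) (ball (0:ℂ) ‖y‖) := by
    refine Integrable.const_mul ?_ _
    refine (integrableOn_log measurableSet_ball hs).bdd_mul (c := 2) (by fun_prop) ?_
    filter_upwards [ae_restrict_mem measurableSet_ball] with w hw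
    exact (Complex.abs_re_le_norm w).trans (norm_lt_of_subset hs hw).le
  have i3 := integrableOn_re (D := ball (0:ℂ) ‖y‖) measurableSet_ball hs
  have i4 := integrableOn_im (D := ball (0:ℂ) ‖y‖) measurableSet_ball hs
  have i5 : IntegrableOn (fun _ => 4 / 5 * profA σ y + (1 - dipoleConst) * σ * y.re)
      (ball (0:ℂ) ‖y‖) := integrableOn_const (volume_ne_top_of_subset hs)
  set p := y.re + (profB σ y - σ * y.re) / σ
  have j1 : IntegrableOn (fun w => -2 * log ‖y - w‖ + 3 / 2 * σ * (-2 * (w.re * log ‖y - w‖)))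
    (ball (0:ℂ) ‖y‖) := i1.add (i2.const_mul _)
  have j2 : IntegrableOn (fun w => -2 * log ‖y - w‖ + 3 / 2 * σ * (-2 * (w.re * log ‖y - w‖)) -
    p * w.re) (ball (0:ℂ) ‖y‖) := j1.sub (i3.const_mul _)
  have j3 : IntegrableOn (fun w => -2 * log ‖y - w‖ + 3 / 2 * σ * (-2 * (w.re * log ‖y - w‖)) -
    p * w.re - y.im * w.im) (ball (0:ℂ) ‖y‖) := j2.sub (i4.const_mul _)
  refine ⟨j3.add i5, ?_⟩
  unfold ringKMain
  rw [integral_add j3 i5, integral_sub j2 (i4.const_mul _), integral_sub j1 (i3.const_mul _),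
    integral_add i1 (i2.const_mul _), integral_const_mul (3 / 2 * σ), moment_on_circle hy,
    integral_const_mul p, integral_const_mul y.im, integral_re_ball, integral_im_ball]
  have d := discPot_outside (norm_nonneg y) (le_refl ‖y‖)
  unfold discPot at d
  rw [d]
  simp only [integral_const, measureReal_restrict_apply_univ, smul_eq_mul]
  rw [volume_real_ball _ (norm_nonneg y)]
  have : (1 - dipoleConst) * π = - (3 / 2 * discMoment) := by
    unfold dipoleConst; field_simp; ring
  linear_combination (‖y‖ ^ 2 * σ * y.re) * this

lemma abs_integral_ringK_ball_le (h : SmallScale σ) {y : ℂ} (hy1 : y ≠ 0) (hy : ‖y‖ ≤ 11 / 10) :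
    |(∫ w in ball (0:ℂ) ‖y‖, ringK σ y w) -
      (-(2 * π) * ‖y‖ ^ 2 * log ‖y‖ + 4 / 5 * π * ‖y‖ ^ 2 * profA σ y)| ≤
      2000 * (σ ^ 2 * (-log σ)) := by
  have hs : ball (0:ℂ) ‖y‖ ⊆ ball 0 2 := ball_subset_ball (by linarith)
  have hv := volume_ne_top_of_subset hs
  obtain ⟨i1, e⟩ := integral_ringKMain (σ := σ) hy1 (by linarith)
  have i0 := integrableOn_ringK h (D := ball (0:ℂ) ‖y‖) measurableSet_ball hs
    (axDist_pos h (by linarith : ‖y‖ ≤ 16))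
  have hm : MeasurableSet (ball (0:ℂ) ‖y‖) := measurableSet_ball
  have is := integrableOn_sing y hm hv
  have hL := h.log_large
  rw [← e, ← integral_sub i0 i1, ← Real.norm_eq_abs]
  refine (norm_integral_le_of_norm_le ((is.const_mul (4 * σ ^ 2)).add
    (integrableOn_const hv (C := 320 * (σ ^ 2 * (-log σ))))) ?_).trans ?_
  · filter_upwards [ae_ne y (ball 0 ‖y‖), ae_restrict_mem hm] with w h1 h2
    rw [mem_ball_zero_iff] at h2
    exact abs_ringK_sub_main_le h hy (by linarith) h1
  · rw [integral_add' (is.const_mul (4 * σ ^ 2)) (integrableOn_const hv), integral_const_mul,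
      integral_const, measureReal_restrict_apply_univ, smul_eq_mul]
    have k := integral_sing_le y hm hv
    have v := volume_real_le_of_subset hs
    have v0 : 0 ≤ volume.real (ball (0:ℂ) ‖y‖) := measureReal_nonneg
    have hp' := pi_lt_d2
    have vq : volume.real (ball (0:ℂ) ‖y‖) ≤ 4 := by
      rw [volume_real_ball _ (norm_nonneg y)]
      nlinarith [norm_nonneg y, pow_le_pow_left₀ (norm_nonneg y) hy 2, pi_pos]
    have q := rpow_quarter_le (b := 2) v0 (by norm_num) (by linarith)
    have hs : 100 * σ ^ 2 ≤ σ ^ 2 * (-log σ) := by nlinarith [sq_nonneg σ]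
    have z1 : 4 * σ ^ 2 * (∫ w in ball (0:ℂ) ‖y‖, sing y w) ≤ 4 * σ ^ 2 * 28 := by
      gcongr; linarith
    have z2 : volume.real (ball (0:ℂ) ‖y‖) * (320 * (σ ^ 2 * (-log σ))) ≤
        4 * (320 * (σ ^ 2 * (-log σ))) := by
      have : 0 ≤ σ ^ 2 * (-log σ) := by nlinarith [sq_nonneg σ]
      gcongr
    have : 0 ≤ σ ^ 2 * (-log σ) := by nlinarith [sq_nonneg σ]
    nlinarith [sq_nonneg σ]

lemma SmallScale.gain_eq (h : SmallScale σ) :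
    2000 * (σ ^ 2 * (-log σ)) ≤ 1 / 50 * bandWidth σ ∧ σ ^ 2 ≤ 1 / 10 ^ 6 := by
  have hL := h.log_large
  have hσ := h.pos
  have hl : σ ≤ 1 / 10 ^ 6 := h.le.trans (by norm_num)
  unfold bandWidth
  constructor
  · have : 0 ≤ σ ^ 2 * (-log σ) := by nlinarith [sq_nonneg σ]
    linarith
  · nlinarith

/-- The inner disc is a strict subsolution. -/
lemma subsolution (h : SmallScale σ) {y : ℂ} (hy : ‖y‖ = 1 - bandWidth σ) :
    4 / 5 * π * profA σ y < ∫ w in ball (0:ℂ) (1 - bandWidth σ), ringK σ y w := by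
  obtain ⟨g1, g2⟩ := h.gain_eq
  have d0 := h.bandWidth_pos
  have d1 := h.bandWidth_le_coarse
  set δ := bandWidth σ
  have hn : 0 < ‖y‖ := by rw [hy]; linarith
  have k := (abs_le.1 (abs_integral_ringK_ball_le h (norm_pos_iff.1 hn) (by rw [hy]; linarith))).1
  have pA := profA_bounds h.pos (h.mul_norm_le (by rw [hy]; linarith : ‖y‖ ≤ 16))
  have pA2 : profA σ y ≤ 1 + 1 / 10 ^ 6 := by
    have : (σ * ‖y‖) ^ 2 ≤ σ ^ 2 := by
      rw [mul_pow]
      have : ‖y‖ ^ 2 ≤ 1 := by rw [hy]; nlinarith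
      nlinarith [sq_nonneg σ]
    linarith
  have hl := Real.log_le_sub_one_of_pos hn
  rw [hy] at k hl
  have hp := pi_gt_d2
  have e1 : δ ≤ -log (1 - δ) := by linarith
  have e2 : 2 * π * (1 - δ) ^ 2 * δ ≤ -(2 * π) * (1 - δ) ^ 2 * log (1 - δ) := by
    have : -(2 * π) * (1 - δ) ^ 2 * log (1 - δ) = 2 * π * (1 - δ) ^ 2 * (-log (1 - δ)) := by ring
    rw [this]; gcongr
  have e3 : 2 * π * (998 / 1000) * δ ≤ 2 * π * (1 - δ) ^ 2 * δ := by
    gcongr; nlinarith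
  have e4 : 4 / 5 * π * profA σ y - 4 / 5 * π * (1 - δ) ^ 2 * profA σ y ≤
      4 / 5 * π * (2 * δ) * (1 + 1 / 10 ^ 6) := by
    have : 4 / 5 * π * profA σ y - 4 / 5 * π * (1 - δ) ^ 2 * profA σ y =
      4 / 5 * π * (1 - (1 - δ) ^ 2) * profA σ y := by ring
    rw [this]
    gcongr
    · nlinarith
    · nlinarith
  have : 3 * δ ≤ π * δ := by gcongr; linarith
  linarith

/-- The outer disc is a strict supersolution. -/
lemma supersolution (h : SmallScale σ) {y : ℂ} (hy : ‖y‖ = 1 + bandWidth σ) :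
    ∫ w in ball (0:ℂ) (1 + bandWidth σ), ringK σ y w < 4 / 5 * π * profA σ y := by
  obtain ⟨g1, g2⟩ := h.gain_eq
  have d0 := h.bandWidth_pos
  have d1 := h.bandWidth_le_coarse
  set δ := bandWidth σ
  have hn : 0 < ‖y‖ := by rw [hy]; linarith
  have k := (abs_le.1 (abs_integral_ringK_ball_le h (norm_pos_iff.1 hn) (by rw [hy]; linarith))).2
  have pA := profA_bounds h.pos (h.mul_norm_le (by rw [hy]; linarith : ‖y‖ ≤ 16))
  have pA2 : profA σ y ≤ 1 + 1 / 10 ^ 5 := by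
    have : (σ * ‖y‖) ^ 2 ≤ 2 * σ ^ 2 := by
      rw [mul_pow]
      have : ‖y‖ ^ 2 ≤ 2 := by rw [hy]; nlinarith
      nlinarith [sq_nonneg σ]
    linarith
  have hl := Real.one_sub_inv_le_log_of_pos hn
  rw [hy] at k hl
  have hp := pi_gt_d2
  have e1 : 998 / 1000 * δ ≤ log (1 + δ) := by
    refine le_trans ?_ hl
    have : 1 - (1 + δ)⁻¹ = δ / (1 + δ) := by field_simp; ring
    rw [this, le_div_iff₀ (by linarith)]
    nlinarith
  have e2 : -(2 * π) * (1 + δ) ^ 2 * log (1 + δ) ≤ -(2 * π * 1 * (998 / 1000 * δ)) := by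
    have : -(2 * π) * (1 + δ) ^ 2 * log (1 + δ) = -(2 * π * (1 + δ) ^ 2 * (log (1 + δ))) := by ring
    rw [this]
    gcongr
    nlinarith
  have e4 : 4 / 5 * π * (1 + δ) ^ 2 * profA σ y - 4 / 5 * π * profA σ y ≤
      4 / 5 * π * (2001 / 1000 * δ) * (1 + 1 / 10 ^ 5) := by
    have : 4 / 5 * π * (1 + δ) ^ 2 * profA σ y - 4 / 5 * π * profA σ y =
      4 / 5 * π * ((1 + δ) ^ 2 - 1) * profA σ y := by ring
    rw [this]
    gcongr
    · nlinarith
    · nlinarith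
  have : 3 * δ ≤ π * δ := by gcongr; linarith
  linarith

end

/-- Symmetry with respect to complex conjugation. -/
def ConjSymm (D : Set ℂ) : Prop := ∀ w ∈ D, starRingEnd ℂ w ∈ D

section
variable {σ : ℝ} {D : Set ℂ}

lemma setIntegral_conj (hD : ConjSymm D) (f : ℂ → ℝ) :
    ∫ w in D, f (starRingEnd ℂ w) = ∫ w in D, f w := by
  have := Complex.conjLIE.measurePreserving
  have h2 := this.setIntegral_preimage_emb Complex.conjLIE.toMeasurableEquiv.measurableEmbedding f D
  rw [← h2]
  congr 2
  ext w
  refine ⟨fun h => hD w h, fun h => ?_⟩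
  have := hD _ h
  simpa using this

lemma axDist_conj (σ : ℝ) (y : ℂ) : axDist σ (starRingEnd ℂ y) = axDist σ y := by
  simp [axDist]

lemma norm_conj_sub_conj (y w : ℂ) : ‖starRingEnd ℂ y - starRingEnd ℂ w‖ = ‖y - w‖ := by
  rw [← map_sub, Complex.norm_conj]

lemma relDist_conj (σ : ℝ) (y w : ℂ) :
    relDist σ (starRingEnd ℂ y) (starRingEnd ℂ w) = relDist σ y w := by
  unfold relDist
  rw [axDist_conj, axDist_conj, norm_conj_sub_conj]

lemma ringK_conj (σ : ℝ) (y w : ℂ) :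
    ringK σ (starRingEnd ℂ y) (starRingEnd ℂ w) = ringK σ y w := by
  unfold ringK kerCoeff rho profA profB
  simp only [relDist_conj, axDist_conj, Complex.conj_re, Complex.conj_im]
  ring

lemma integral_ringK_conj (hD : ConjSymm D) (y : ℂ) :
    ∫ w in D, ringK σ (starRingEnd ℂ y) w = ∫ w in D, ringK σ y w := by
  rw [← setIntegral_conj hD]
  simp only [ringK_conj]

lemma profA_conj (σ : ℝ) (y : ℂ) : profA σ (starRingEnd ℂ y) = profA σ y := by
  unfold profA; rw [axDist_conj]

lemma integral_im_eq_zero (hD : ConjSymm D) : ∫ w in D, w.im = 0 := by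
  have h := setIntegral_conj hD (fun w => w.im)
  simp only [Complex.conj_im, integral_neg] at h
  linarith

lemma excess_eq_integral_ringK (h : SmallScale σ) (hDm : MeasurableSet D) (hD : D ⊆ ball 0 2)
    (hs : ConjSymm D) {y : ℂ} (hy : 0 < axDist σ y) :
    excess σ D (multA σ D) (multB σ D) y = (∫ w in D, ringK σ y w) - 4 / 5 * π * profA σ y := by
  rw [integral_ringK h hDm hD hy, integral_im_eq_zero hs, mul_zero, sub_zero]

lemma abs_discPot_sub_le {R : ℝ} (hR2 : R ≤ 2) (y z : ℂ) :
    |discPot R y - discPot R z| ≤ 1000 * ‖y - z‖ := by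
  have hs : ball (0:ℂ) R ⊆ ball 0 2 := ball_subset_ball hR2
  have hm : MeasurableSet (ball (0:ℂ) R) := measurableSet_ball
  have k := abs_integral_log_diff_le hm (volume_ne_top_of_subset hs) (c := 1) (f := fun _ => 1)
    zero_le_one (fun w _ => by simp) y z
  simp only [one_mul] at k
  rw [integral_sub (integrableOn_neg_two_log hm hs y) (integrableOn_neg_two_log hm hs z)] at k
  refine k.trans ?_
  have v := volume_real_le_of_subset hs
  have hp := pi_lt_d2
  have q := rpow_quarter_le (b := 2) (measureReal_nonneg (μ := volume) (s := ball (0:ℂ) R))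
    (by norm_num) (by linarith)
  have : 56 * volume.real (ball (0:ℂ) R) ^ (1 / 4 : ℝ) + 4 * volume.real (ball (0:ℂ) R) ≤ 1000 := by
    linarith
  rw [mul_comm]
  gcongr

lemma abs_multA_le' (h : SmallScale σ) (hD : D ⊆ ball 0 2) : |multA σ D| ≤ 1000 * (-log σ) :=
  (abs_multA_le h hD).trans (by nlinarith [h.log_large])

lemma abs_multB_le' (h : SmallScale σ) (hD : InBand σ D) : |multB σ D| ≤ 1000 * (-log σ) :=
  (abs_multB_le h hD).trans (by nlinarith [h.log_large])

lemma abs_excess_sub_le (h : SmallScale σ) (hD : InBand σ D) {b x : ℝ}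
    (hb : |b| ≤ 1000 * (-log σ)) (hx : |x| ≤ 1000 * (-log σ)) {y z : ℂ} (hy : ‖y‖ ≤ 16)
    (hz : ‖z‖ ≤ 16) : |excess σ D b x y - excess σ D b x z| ≤ 1001 * ‖y - z‖ := by
  have d := h.bandWidth_pos
  have k1 := abs_excess_sub_discPot_lip h hD hb hx (R := 1) (by linarith) (by linarith) hy hz
  have k2 := abs_discPot_sub_le one_le_two y z
  have := norm_nonneg (y - z)
  rw [abs_le] at *
  constructor <;> linarith

lemma continuousOn_excess (h : SmallScale σ) (hD : InBand σ D) {b x : ℝ}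
    (hb : |b| ≤ 1000 * (-log σ)) (hx : |x| ≤ 1000 * (-log σ)) :
    ContinuousOn (excess σ D b x) (closedBall 0 16) := by
  refine LipschitzOnWith.continuousOn (K := 1001) (LipschitzOnWith.of_dist_le_mul ?_)
  intro y hy z hz
  rw [Real.dist_eq, dist_eq_norm]
  rw [mem_closedBall_zero_iff] at hy hz
  exact abs_excess_sub_le h hD hb hx hy hz

lemma measurableSet_band_integral (h : SmallScale σ) (hD : InBand σ D) (hs : ConjSymm D) :
    MeasurableSet {y ∈ band σ | 4 / 5 * π * profA σ y < ∫ w in D, ringK σ y w} := by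
  have hc := (continuousOn_excess h hD (abs_multA_le' h (hD.subset_two h))
    (abs_multB_le' h hD)).mono ball_subset_closedBall
  have ho := hc.isOpen_inter_preimage isOpen_ball isOpen_Ioi (t := Set.Ioi 0)
  have : {y ∈ band σ | 4 / 5 * π * profA σ y < ∫ w in D, ringK σ y w} =
      band σ ∩ (ball 0 16 ∩ excess σ D (multA σ D) (multB σ D) ⁻¹' Set.Ioi 0) := by
    ext y
    refine and_congr_right fun hy => ?_
    have h1 := h.bandWidth_le_coarse
    have hy' : ‖y‖ < 16 := by
      have := mem_ball_zero_iff.1 hy.1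
      linarith
    rw [Set.mem_inter_iff, mem_ball_zero_iff, Set.mem_preimage, Set.mem_Ioi,
      excess_eq_integral_ringK h hD.meas (hD.subset_two h) hs (axDist_pos h hy'.le)]
    simp [hy']
  rw [this]
  exact (measurableSet_band σ).inter ho.measurableSet

/-- One step of the monotone iteration. -/
def iterStep (σ : ℝ) (D : Set ℂ) : Set ℂ :=
  ball 0 (1 - bandWidth σ) ∪ {y ∈ band σ | 4 / 5 * π * profA σ y < ∫ w in D, ringK σ y w}

lemma inBand_iterStep (h : SmallScale σ) (hD : InBand σ D) (hs : ConjSymm D) :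
    InBand σ (iterStep σ D) :=
  ⟨measurableSet_ball.union (measurableSet_band_integral h hD hs), Set.subset_union_left,
    Set.union_subset (ball_subset_ball (by linarith [h.bandWidth_pos])) fun _ hy => hy.1.1⟩

lemma conjSymm_ball (R : ℝ) : ConjSymm (ball 0 R) := by
  intro w hw
  rw [mem_ball_zero_iff] at *
  rwa [Complex.norm_conj]

lemma conjSymm_iterStep (hs : ConjSymm D) : ConjSymm (iterStep σ D) := by
  rintro w (hw | ⟨hw, hw'⟩)
  · exact Or.inl (conjSymm_ball _ w hw)
  · refine Or.inr ⟨⟨conjSymm_ball _ w hw.1, fun hc => hw.2 ?_⟩, ?_⟩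
    · have := conjSymm_ball _ _ hc
      simpa using this
    · rwa [integral_ringK_conj hs, profA_conj]

lemma integral_ringK_mono (h : SmallScale σ) {D' : Set ℂ} (hD' : InBand σ D')
    (hsub : D ⊆ D') {y : ℂ} (hy : ‖y‖ ≤ 1 + bandWidth σ) :
    ∫ w in D, ringK σ y w ≤ ∫ w in D', ringK σ y w := by
  have h1 := h.bandWidth_le_coarse
  refine setIntegral_mono_set
    (integrableOn_ringK h hD'.meas (hD'.subset_two h) (axDist_pos h (by linarith))) ?_
    (LE.le.eventuallyLE hsub)
  filter_upwards [ae_ne y D', ae_restrict_mem hD'.meas] with w h2 h3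
  exact (ringK_pos h hy (mem_ball_zero_iff.1 (hD'.outer h3)).le h2).le

lemma norm_le_of_mem_band {y : ℂ} (hy : y ∈ band σ) : ‖y‖ ≤ 1 + bandWidth σ :=
  (mem_ball_zero_iff.1 hy.1).le

lemma iterStep_mono (h : SmallScale σ) {D' : Set ℂ} (hD' : InBand σ D')
    (hsub : D ⊆ D') : iterStep σ D ⊆ iterStep σ D' := by
  rintro y (hy | ⟨hy, hy'⟩)
  · exact Or.inl hy
  · exact Or.inr ⟨hy, hy'.trans_le (integral_ringK_mono h hD' hsub (norm_le_of_mem_band hy))⟩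

/-- The monotone iteration started from the inner disc. -/
def iterSet (σ : ℝ) (n : ℕ) : Set ℂ := (iterStep σ)^[n] (ball 0 (1 - bandWidth σ))

lemma iterSet_succ (σ : ℝ) (n : ℕ) : iterSet σ (n + 1) = iterStep σ (iterSet σ n) :=
  Function.iterate_succ_apply' _ _ _

lemma iterSet_spec (h : SmallScale σ) (n : ℕ) :
    InBand σ (iterSet σ n) ∧ ConjSymm (iterSet σ n) ∧ iterSet σ n ⊆ iterSet σ (n + 1) := by
  induction n with
  | zero =>
    exact ⟨InBand.ball le_rfl (by linarith [h.bandWidth_pos]), conjSymm_ball _,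
      Set.subset_union_left⟩
  | succ n ih =>
    obtain ⟨h1, h2, h3⟩ := ih
    have k : InBand σ (iterSet σ (n + 1)) := by rw [iterSet_succ]; exact inBand_iterStep h h1 h2
    refine ⟨k, by rw [iterSet_succ]; exact conjSymm_iterStep h2, ?_⟩
    conv_lhs => rw [iterSet_succ]
    rw [iterSet_succ]
    exact iterStep_mono h k h3

/-- Existence of a set in the band solving the free boundary problem there. -/
lemma exists_fixed_set (h : SmallScale σ) : ∃ D, InBand σ D ∧ ConjSymm D ∧
    ∀ y ∈ band σ, y ∈ D ↔ 4 / 5 * π * profA σ y < ∫ w in D, ringK σ y w := by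
  have hmono : Monotone (iterSet σ) := monotone_nat_of_le_succ fun n => (iterSet_spec h n).2.2
  have hI : InBand σ (⋃ n, iterSet σ n) :=
    ⟨MeasurableSet.iUnion fun n => (iterSet_spec h n).1.meas,
      (iterSet_spec h 0).1.inner.trans (Set.subset_iUnion _ 0),
      Set.iUnion_subset fun n => (iterSet_spec h n).1.outer⟩
  refine ⟨⋃ n, iterSet σ n, hI, ?_, ?_⟩
  · intro w hw
    obtain ⟨n, hn⟩ := Set.mem_iUnion.1 hw
    exact Set.mem_iUnion.2 ⟨n, (iterSet_spec h n).2.1 w hn⟩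
  · intro y hy
    have hyn := norm_le_of_mem_band hy
    have hX := axDist_pos h (w := y) (by linarith [h.bandWidth_le_coarse])
    constructor
    · intro hyD
      obtain ⟨n, hn⟩ := Set.mem_iUnion.1 hyD
      have hn' := hmono (Nat.le_succ n) hn
      rw [Nat.succ_eq_add_one, iterSet_succ] at hn'
      rcases hn' with hc | ⟨_, hc⟩
      · exact absurd hc hy.2
      · exact hc.trans_le (integral_ringK_mono h hI (Set.subset_iUnion _ n) hyn)
    · intro hlt
      have ht := tendsto_setIntegral_of_monotone (μ := volume) (f := ringK σ y)
        (fun n => (iterSet_spec h n).1.meas) hmono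
        (integrableOn_ringK h hI.meas (hI.subset_two h) hX)
      obtain ⟨n, hn⟩ := (ht.eventually (lt_mem_nhds hlt)).exists
      refine Set.mem_iUnion.2 ⟨n + 1, ?_⟩
      rw [iterSet_succ]
      exact Or.inr ⟨hy, hn⟩

/-- The properties of the scaled cross-section obtained from the iteration. -/
structure IsCore (σ : ℝ) (D : Set ℂ) : Prop where
  inBand : InBand σ D
  symm : ConjSymm D
  fixed : ∀ y ∈ band σ, y ∈ D ↔ 0 < excess σ D (multA σ D) (multB σ D) y

lemma exists_isCore (h : SmallScale σ) : ∃ D, IsCore σ D := by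
  obtain ⟨D, hD, hs, hf⟩ := exists_fixed_set h
  refine ⟨D, hD, hs, fun y hy => ?_⟩
  have hX := axDist_pos h (w := y) (by linarith [h.bandWidth_le_coarse, norm_le_of_mem_band hy])
  rw [hf y hy, excess_eq_integral_ringK h hD.meas (hD.subset_two h) hs hX, sub_pos]

/-- The excess with the multipliers attached to the set. -/
def coreExcess (σ : ℝ) (D : Set ℂ) (y : ℂ) : ℝ := excess σ D (multA σ D) (multB σ D) y

lemma coreExcess_decay (h : SmallScale σ) (hD : InBand σ D) {y z : ℂ} (hyz : ‖y‖ ≤ ‖z‖)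
    (hz1 : 1 / 2 ≤ ‖z‖) (hz2 : ‖z‖ ≤ 8) :
    1 / 2 * (‖z‖ - ‖y‖) - ‖y - z‖ * (1 / 10 ^ 35) ≤ coreExcess σ D y - coreExcess σ D z := by
  have d := h.bandWidth_pos
  have k1 := abs_excess_sub_discPot_lip h hD (abs_multA_le' h (hD.subset_two h))
    (abs_multB_le' h hD) (R := 1) (by linarith) (by linarith) (y := y) (z := z)
    (by linarith) (by linarith)
  have k2 := discPot_sub_ge (R := 1) (by norm_num) hyz hz1 hz2
  unfold coreExcess
  rw [abs_le] at k1
  linarith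

lemma coreExcess_ray (h : SmallScale σ) (hD : InBand σ D) {z : ℂ} {t : ℝ} (ht0 : 0 ≤ t)
    (ht1 : t ≤ 1) (hz1 : 1 / 2 ≤ ‖z‖) (hz2 : ‖z‖ ≤ 8) :
    1 / 4 * ((1 - t) * ‖z‖) ≤ coreExcess σ D (t * z) - coreExcess σ D z := by
  have e1 : ‖(t:ℂ) * z‖ = t * ‖z‖ := by simp [abs_of_nonneg ht0]
  have e2 : ‖(t:ℂ) * z - z‖ = (1 - t) * ‖z‖ := by
    have : (t:ℂ) * z - z = -(((1 - t : ℝ) : ℂ) * z) := by push_cast; ring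
    rw [this, norm_neg, norm_mul, Complex.norm_real, Real.norm_eq_abs, abs_of_nonneg (by linarith)]
  have k := coreExcess_decay h hD (y := t * z) (z := z)
    (by rw [e1]; exact mul_le_of_le_one_left (norm_nonneg z) ht1) hz1 hz2
  rw [e1, e2] at k
  have : 0 ≤ (1 - t) * ‖z‖ := mul_nonneg (by linarith) (norm_nonneg z)
  linarith

lemma IsCore.excess_inner (h : SmallScale σ) (hD : IsCore σ D) {y : ℂ}
    (hy : ‖y‖ ≤ 1 - bandWidth σ) : 0 < coreExcess σ D y := by
  have d0 := h.bandWidth_pos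
  have d1 := h.bandWidth_le_coarse
  have on : ∀ z : ℂ, ‖z‖ = 1 - bandWidth σ → 0 < coreExcess σ D z := by
    intro z hz
    unfold coreExcess
    rw [excess_eq_integral_ringK h hD.inBand.meas (hD.inBand.subset_two h) hD.symm
      (axDist_pos h (by linarith)), sub_pos]
    exact (subsolution h hz).trans_le (integral_ringK_mono h
      hD.inBand hD.inBand.inner (by linarith))
  rcases eq_or_ne y 0 with rfl | hy0
  · have hz : ‖((1 - bandWidth σ : ℝ) : ℂ)‖ = 1 - bandWidth σ := by
      rw [Complex.norm_real, Real.norm_eq_abs, abs_of_pos (by linarith)]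
    have k := coreExcess_ray h hD.inBand (z := ((1 - bandWidth σ : ℝ) : ℂ)) (t := 0) le_rfl
      zero_le_one (by linarith) (by linarith)
    have := on _ hz
    rw [hz, Complex.ofReal_zero, zero_mul] at k
    linarith
  · have hn : 0 < ‖y‖ := norm_pos_iff.2 hy0
    set s := ‖y‖ / (1 - bandWidth σ) with hs
    have hs0 : 0 < s := by apply div_pos hn; linarith
    have hs1 : s ≤ 1 := (div_le_one (by linarith)).2 hy
    have hz : ‖((s⁻¹ : ℝ) : ℂ) * y‖ = 1 - bandWidth σ := by
      rw [norm_mul, Complex.norm_real, Real.norm_eq_abs, abs_of_pos (by positivity), hs]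
      field_simp
    have k := coreExcess_ray h hD.inBand (z := ((s⁻¹ : ℝ) : ℂ) * y) (t := s) hs0.le hs1
      (by linarith) (by linarith)
    have e : (s : ℂ) * (((s⁻¹ : ℝ) : ℂ) * y) = y := by
      have : (s : ℂ) ≠ 0 := by exact_mod_cast hs0.ne'
      push_cast; field_simp
    rw [e, hz] at k
    have := on _ hz
    have : 0 ≤ (1 - s) * (1 - bandWidth σ) := mul_nonneg (by linarith) (by linarith)
    linarith

lemma IsCore.excess_outer (h : SmallScale σ) (hD : IsCore σ D) {y : ℂ}
    (hy : 1 + bandWidth σ ≤ ‖y‖) (hy8 : ‖y‖ ≤ 8) : coreExcess σ D y < 0 := by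
  have d0 := h.bandWidth_pos
  have d1 := h.bandWidth_le_coarse
  set s := (1 + bandWidth σ) / ‖y‖ with hs
  have hn : 0 < ‖y‖ := by linarith
  have hs0 : 0 < s := by positivity
  have hs1 : s ≤ 1 := (div_le_one hn).2 hy
  have hz : ‖(s : ℂ) * y‖ = 1 + bandWidth σ := by
    rw [norm_mul, Complex.norm_real, Real.norm_eq_abs, abs_of_pos hs0, hs]
    field_simp
  have k := coreExcess_ray h hD.inBand (z := y) hs0.le hs1 (by linarith) hy8
  have on : coreExcess σ D ((s:ℂ) * y) < 0 := by
    unfold coreExcess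
    rw [excess_eq_integral_ringK h hD.inBand.meas (hD.inBand.subset_two h) hD.symm
      (axDist_pos h (by linarith)), sub_neg]
    exact (integral_ringK_mono h (InBand.ball (by linarith) le_rfl) hD.inBand.outer
      hz.le).trans_lt (supersolution h hz)
  have : 0 ≤ (1 - s) * ‖y‖ := mul_nonneg (by linarith) hn.le
  linarith

lemma IsCore.mem_iff_of_norm_le (h : SmallScale σ) (hD : IsCore σ D) {y : ℂ} (hy : ‖y‖ ≤ 8) :
    y ∈ D ↔ 0 < coreExcess σ D y := by
  by_cases h1 : ‖y‖ < 1 - bandWidth σ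
  · exact iff_of_true (hD.inBand.inner (by simpa using h1)) (hD.excess_inner h h1.le)
  · by_cases h2 : ‖y‖ < 1 + bandWidth σ
    · exact hD.fixed y ⟨by simpa using h2, by simpa using h1⟩
    · refine iff_of_false (fun hc => h2 ?_) (hD.excess_outer h (not_lt.1 h2) hy).not_gt
      simpa using hD.inBand.outer hc

end

section
variable {σ : ℝ} {D : Set ℂ}

lemma abs_volume_sub_pi_le (h : SmallScale σ) (hD : InBand σ D) :
    |volume.real D - π| ≤ 10 * bandWidth σ := by
  have d0 := h.bandWidth_pos
  have d1 := h.bandWidth_le_coarse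
  have h1 := measureReal_mono hD.inner (volume_ne_top_of_subset (hD.subset_two h))
  have h2 := measureReal_mono hD.outer (volume_ball_ne_top 0 _)
  rw [volume_real_ball _ (by linarith)] at h1 h2
  have hp := pi_lt_d2
  have hp0 := pi_pos
  have e1 : π * bandWidth σ ≤ 3.15 * bandWidth σ := by gcongr
  have e2 : π * bandWidth σ ^ 2 ≤ 3.15 * bandWidth σ := by
    gcongr; nlinarith
  have e3 : 0 ≤ π * bandWidth σ ^ 2 := by positivity
  rw [abs_le]
  constructor <;> nlinarith

/-- The density-weighted self-interaction. -/
def selfMass (σ : ℝ) (D : Set ℂ) : ℝ := ∫ w in D, rho σ w * (ringLog σ + log (axDist σ w))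

lemma integrableOn_selfMass (h : SmallScale σ) (hDm : MeasurableSet D) (hD : D ⊆ ball 0 2) :
    IntegrableOn (fun w => rho σ w * (ringLog σ + log (axDist σ w))) D := by
  refine integrableOn_rho_mul h hDm hD ?_
  exact (integrableOn_const (volume_ne_top_of_subset hD)).add (integrableOn_log_axDist h hDm hD)

lemma multA_eq (h : SmallScale σ) (hDm : MeasurableSet D) (hD : D ⊆ ball 0 2) :
    multA σ D = selfMass σ D - 4 / 5 * (volume.real D - π) := by
  unfold multA selfMass kerCoeff
  rw [integral_sub (integrableOn_selfMass h hDm hD)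
    (integrableOn_const (volume_ne_top_of_subset hD)), integral_const,
    measureReal_restrict_apply_univ, smul_eq_mul]
  ring

lemma selfConst_eq (h : SmallScale σ) (hDm : MeasurableSet D) (hD : D ⊆ ball 0 2) :
    selfConst σ D = selfMass σ D - ringJ 0 * massRho σ D := by
  unfold selfConst selfMass massRho
  rw [← integral_const_mul, ← integral_sub (integrableOn_selfMass h hDm hD)
    ((integrableOn_rho h hDm hD).const_mul _)]
  congr 1; ext w; unfold ringLog; ring

lemma coreExcess_eq (h : SmallScale σ) (hDm : MeasurableSet D) (hD : D ⊆ ball 0 2) {y : ℂ}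
    (hy : 0 < axDist σ y) : coreExcess σ D y =
      logPot σ D y + (corrPot σ D y - ringJ 0 * massRho σ D) + massRho σ D * log (axDist σ y) +
        selfMass σ D * (1 - profA σ y) + 4 / 5 * (volume.real D - π) * profA σ y -
        multB σ D * profB σ y := by
  unfold coreExcess
  rw [excess_eq h hDm hD _ _ hy, multA_eq h hDm hD, selfConst_eq h hDm hD]
  ring

lemma le_massRho (h : SmallScale σ) (hD : InBand σ D) :
    2 ≤ massRho σ D ∧ massRho σ D ≤ 5 := by
  have k := massRho_bounds h hD.meas (hD.subset_two h)
  have v := abs_le.1 (abs_volume_sub_pi_le h hD)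
  have d1 := h.bandWidth_le_coarse
  have hp := pi_gt_d2
  have hp' := pi_lt_d2
  constructor <;> linarith

lemma le_selfMass (h : SmallScale σ) (hD : InBand σ D) : 2 * (-log σ) + 1 ≤ selfMass σ D := by
  have hD2 := hD.subset_two h
  have k : ∫ w in D, rho σ w * (ringLog σ - 1) ≤ selfMass σ D := by
    refine setIntegral_mono_on ((integrableOn_rho h hD.meas hD2).mul_const _)
      (integrableOn_selfMass h hD.meas hD2) hD.meas fun w hw => ?_
    have s := h.mul_norm_mem hD2 hw
    have := rho_bounds h.pos s
    have l := abs_le.1 (abs_log_axDist_le h.pos s)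
    refine mul_le_mul_of_nonneg_left ?_ (by linarith)
    linarith
  rw [integral_mul_const] at k
  have m := (le_massRho h hD).1
  have r := (ringLog_bounds h).1
  have := h.log_huge
  unfold massRho at m
  nlinarith

lemma le_multA (h : SmallScale σ) (hD : InBand σ D) : 2 * (-log σ) ≤ multA σ D := by
  rw [multA_eq h hD.meas (hD.subset_two h)]
  have v := abs_le.1 (abs_volume_sub_pi_le h hD)
  have d1 := h.bandWidth_le_coarse
  linarith [le_selfMass h hD]

lemma one_le_log_six : 1 ≤ log 6 := by
  rw [Real.le_log_iff_exp_le (by norm_num)]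
  have := Real.exp_one_lt_d9
  linarith

lemma coreExcess_neg_of_moderate (h : SmallScale σ) (hD : InBand σ D) {y : ℂ} (hy : 8 ≤ ‖y‖)
    (hy2 : σ * ‖y‖ ≤ 1 / 10 ^ 4) : coreExcess σ D y < 0 := by
  have hD2 := hD.subset_two h
  have hσ := h.pos
  have sy : σ * ‖y‖ ≤ 1 / 8 := by linarith
  have hX : 0 < axDist σ y := by linarith [(axDist_bounds hσ sy).1]
  have hfar : ∀ w ∈ D, 6 ≤ ‖y - w‖ := fun w hw => by
    have := norm_sub_norm_le y w
    linarith [norm_lt_of_subset hD2 hw]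
  rw [coreExcess_eq h hD.meas hD2 hX]
  have m := le_massRho h hD
  have c1 : logPot σ D y ≤ -2 * massRho σ D := by
    unfold logPot massRho
    rw [← integral_const_mul]
    refine setIntegral_mono_on (integrableOn_rho_mul h hD.meas hD2
      (integrableOn_neg_two_log hD.meas hD2 y)) ((integrableOn_rho h hD.meas hD2).const_mul _)
      hD.meas fun w hw => ?_
    have := rho_bounds h.pos (h.mul_norm_mem hD2 hw)
    have l := Real.log_le_log (by norm_num) (hfar w hw)
    have := one_le_log_six
    nlinarith
  have c2 : corrPot σ D y - ringJ 0 * massRho σ D ≤ 1 / 10 := by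
    unfold corrPot massRho
    rw [← integral_const_mul, ← integral_sub
      (integrableOn_rho_mul h hD.meas hD2 (integrableOn_ringJ h hD.meas hD2 hX))
      ((integrableOn_rho h hD.meas hD2).const_mul _)]
    refine (le_abs_self _).trans ((abs_setIntegral_le (volume_ne_top_of_subset hD2)
      (c := 5 / 4 * (1 / 10 ^ 3)) fun w hw => ?_).trans ?_)
    · have hw2 := h.mul_norm_mem hD2 hw
      have hXw : 0 < axDist σ w := by linarith [(axDist_bounds hσ hw2).1]
      have k := abs_ringJ_sub_le (relDist_nonneg hX hXw) (le_refl (0:ℝ))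
      rw [Real.sqrt_zero, sub_zero, abs_of_nonneg (Real.sqrt_nonneg _), sqrt_relDist hσ hX] at k
      have e : rho σ w * ringJ (relDist σ y w) - ringJ 0 * rho σ w =
        rho σ w * (ringJ (relDist σ y w) - ringJ 0) := by ring
      rw [e, abs_mul]
      have r := rho_bounds hσ hw2
      gcongr
      · rw [abs_of_pos (by linarith)]; exact r.2
      · refine k.trans ?_
        have b1 := (sqrt_axDist_bounds hσ sy).1
        have b2 := (sqrt_axDist_bounds hσ hw2).1
        have b3 : 1 / 2 ≤ √(axDist σ y) * √(axDist σ w) := by nlinarith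
        have b4 : σ * ‖y - w‖ ≤ 11 / 10 * (1 / 10 ^ 4) := by
          have n := norm_sub_le y w
          have hs : σ ≤ 1 / 10 ^ 6 := h.le.trans (by norm_num)
          have := norm_lt_of_subset hD2 hw
          nlinarith
        have : σ * ‖y - w‖ / (√(axDist σ y) * √(axDist σ w)) ≤
            11 / 10 * (1 / 10 ^ 4) / (1 / 2) := by
          gcongr
        linarith
    · have v := volume_real_le_of_subset hD2
      have := pi_lt_d2
      linarith
  have l := abs_le.1 (abs_log_axDist_le hσ sy)
  have pA := profA_bounds hσ sy
  have c3 : massRho σ D * log (axDist σ y) ≤ 5 * (1 / 10 ^ 3) := by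
    refine mul_le_mul_of_nonneg m.2 ?_ (by linarith) (by norm_num)
    linarith
  have c4 : selfMass σ D * (1 - profA σ y) ≤ 0 := by
    refine mul_nonpos_of_nonneg_of_nonpos ?_ (by linarith)
    linarith [le_selfMass h hD, h.log_large]
  have v := abs_volume_sub_pi_le h hD
  have d1 := h.bandWidth_le_coarse
  have hsq : (σ * ‖y‖) ^ 2 ≤ σ * ‖y‖ := by
    have : 0 ≤ σ * ‖y‖ := by positivity
    nlinarith
  have c5 : 4 / 5 * (volume.real D - π) * profA σ y ≤ 4 / 5 * (1 / 100) * 2 := by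
    have : 0 ≤ profA σ y := by linarith
    calc 4 / 5 * (volume.real D - π) * profA σ y ≤ 4 / 5 * (1 / 100) * profA σ y := by
          gcongr; linarith [abs_le.1 v]
      _ ≤ _ := by gcongr; linarith
  have c6 : |multB σ D * profB σ y| ≤ 600 * (2 * (1 / 10 ^ 4)) := by
    rw [abs_mul]
    gcongr
    · exact abs_multB_le h hD
    · have q1 := abs_le.1 (abs_profB_sub_le hσ sy)
      have q2 := abs_le.1 (abs_re_scale hσ sy).2.2
      rw [abs_le]
      constructor <;> linarith
  linarith [abs_le.1 c6]

lemma prof_ineq {ξ : ℝ} (hξ : 0 < ξ) : 1 ≤ ξ ^ 3 / 4 + 3 / 4 * (1 / ξ) ∧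
    ξ ≤ 2 * (ξ ^ 3 / 4 + 3 / 4 * (1 / ξ)) ∧
    |ξ ^ 3 / 2 - 1 / ξ / 2| ≤ 2 * (ξ ^ 3 / 4 + 3 / 4 * (1 / ξ)) := by
  have hi : 0 < 1 / ξ := by positivity
  have h3 : 0 < ξ ^ 3 := by positivity
  refine ⟨?_, ?_, ?_⟩
  · have : ξ ^ 3 / 4 + 3 / 4 * (1 / ξ) = (ξ ^ 4 + 3) / (4 * ξ) := by field_simp
    rw [this, one_le_div (by positivity)]
    nlinarith [sq_nonneg (ξ ^ 2 - 1), sq_nonneg (ξ - 1)]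
  · have : 2 * (ξ ^ 3 / 4 + 3 / 4 * (1 / ξ)) = (ξ ^ 4 + 3) / (2 * ξ) := by field_simp; ring
    rw [this, le_div_iff₀ (by positivity)]
    nlinarith [sq_nonneg (ξ ^ 2 - 1)]
  · rw [abs_le]; constructor <;> linarith

lemma coreExcess_neg_of_far (h : SmallScale σ) (hD : InBand σ D) {y : ℂ} (hX : 0 < axDist σ y)
    (hy2 : 1 / 10 ^ 4 ≤ σ * ‖y‖) : coreExcess σ D y < 0 := by
  have hD2 := hD.subset_two h
  have hσ := h.pos
  have hs : σ ≤ 1 / 10 ^ 6 := h.le.trans (by norm_num)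
  have hyn : 100 ≤ ‖y‖ := by
    by_contra! hc
    have : σ * ‖y‖ < 1 / 10 ^ 6 * 100 := mul_lt_mul' hs hc (norm_nonneg y) (by norm_num)
    linarith
  obtain ⟨p1, p2, p3⟩ := prof_ineq (Real.sqrt_pos.2 hX)
  have lX : log (axDist σ y) ≤ 4 * profA σ y := by
    have e : log (axDist σ y) = 2 * log √(axDist σ y) := by
      rw [Real.log_sqrt hX.le]; ring
    have := Real.log_le_self (Real.sqrt_nonneg (axDist σ y))
    unfold profA
    linarith
  have hA : 1 ≤ profA σ y := p1
  have hlogd : ∀ w ∈ D, -log σ - 20000 ≤ log ‖y - w‖ := fun w hw => by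
    have n := norm_sub_norm_le y w
    have := norm_lt_of_subset hD2 hw
    have b : 1 / (20000 * σ) ≤ ‖y - w‖ := by
      rw [div_le_iff₀ (by positivity)]
      nlinarith
    have k := Real.log_le_log (by positivity) b
    rw [one_div, Real.log_inv, Real.log_mul (by norm_num) hσ.ne'] at k
    have := Real.log_le_self (show (0:ℝ) ≤ 20000 by norm_num)
    linarith
  have hF : ∀ w ∈ D, rho σ w * ringF (relDist σ y w) ≤ 5 / 4 * (50000 * profA σ y) := fun w hw => by
    have hw2 := h.mul_norm_mem hD2 hw
    have hXw : 0 < axDist σ w := by linarith [(axDist_bounds hσ hw2).1]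
    have r := rho_bounds hσ hw2
    have n := norm_sub_norm_le y w
    have nw := norm_lt_of_subset hD2 hw
    have hyw : y ≠ w := by rintro rfl; linarith
    have hd : 0 < ‖y - w‖ := norm_pos_iff.2 (sub_ne_zero.2 hyw)
    have F := ringF_le (relDist_pos hσ hX hXw hyw)
    have J0 := abs_ringJ_zero_le
    have e : -log (relDist σ y w) = 2 * (-log σ) - 2 * log ‖y - w‖ + log (axDist σ y) +
        log (axDist σ w) := by
      unfold relDist
      rw [Real.log_div (by positivity) (by positivity), Real.log_mul (by positivity)
        (by positivity), Real.log_mul hX.ne' hXw.ne', Real.log_pow, Real.log_pow]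
      push_cast; ring
    have l := abs_le.1 (abs_log_axDist_le hσ hw2)
    have ld := hlogd w hw
    have F2 : ringF (relDist σ y w) ≤ 50000 * profA σ y := by
      refine F.trans ?_
      have : max (-log (relDist σ y w)) 0 ≤ 49000 * profA σ y := by
        refine max_le ?_ (by linarith)
        rw [e]; linarith
      linarith
    calc rho σ w * ringF (relDist σ y w) ≤ rho σ w * (50000 * profA σ y) := by
          gcongr; linarith
      _ ≤ _ := by gcongr; exact r.2
  have hV : ringPot σ D y ≤ 16 * (50000 * profA σ y) := by
    unfold ringPot
    refine (setIntegral_mono_on (integrableOn_ringPot h hD.meas hD2 hX)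
      (integrableOn_const (volume_ne_top_of_subset hD2)) hD.meas hF).trans ?_
    rw [integral_const, measureReal_restrict_apply_univ, smul_eq_mul]
    have v := volume_real_le_of_subset hD2
    have := pi_lt_d2
    have : volume.real D ≤ 12.6 := by linarith
    calc volume.real D * (5 / 4 * (50000 * profA σ y)) ≤ 12.6 * (5 / 4 * (50000 * profA σ y)) := by
          gcongr
      _ ≤ _ := by linarith
  have hL := h.log_huge
  have hb := le_multA h hD
  have hx : |multB σ D * profB σ y| ≤ 600 * (2 * profA σ y) := by
    rw [abs_mul]
    gcongr
    · exact abs_multB_le h hD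
    · exact p3
  have hbA : 2 * 10 ^ 6 * profA σ y ≤ multA σ D * profA σ y := by gcongr; linarith
  unfold coreExcess excess
  linarith [abs_le.1 hx]

/-- The core is the positivity set of its excess in the half plane. -/
lemma IsCore.mem_iff (h : SmallScale σ) (hD : IsCore σ D) {y : ℂ} :
    y ∈ D ↔ 0 < axDist σ y ∧ 0 < coreExcess σ D y := by
  rcases le_total ‖y‖ 8 with h8 | h8
  · rw [hD.mem_iff_of_norm_le h h8, and_iff_right (axDist_pos h (by linarith))]
  · refine iff_of_false (fun hc => ?_) fun hc => ?_
    · linarith [norm_lt_of_subset (hD.inBand.subset_two h) hc]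
    · rcases le_total (σ * ‖y‖) (1 / 10 ^ 4) with hs | hs
      · exact (coreExcess_neg_of_moderate h hD.inBand h8 hs).not_gt hc.2
      · exact (coreExcess_neg_of_far h hD.inBand hc.1 hs).not_gt hc.2

end

/-- The symmetric second difference of a function on the plane. -/
def secondDiff (f : ℂ → ℝ) (m v : ℂ) : ℝ := f (m + v) + f (m - v) - 2 * f m

/-- The second difference of the logarithmic kernel. -/
def logDiff (m v w : ℂ) : ℝ := -2 * (log ‖m + v - w‖ + log ‖m - v - w‖ - 2 * log ‖m - w‖)

section
variable {σ : ℝ} {D : Set ℂ}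

lemma sqrt_second_diff_bounds {α β γ d : ℝ} (hα : 9 / 10 ≤ α) (hα' : α ≤ 11 / 10)
    (hβ : 9 / 10 ≤ β) (hβ' : β ≤ 11 / 10) (hγ : 9 / 10 ≤ γ) (hγ' : γ ≤ 11 / 10)
    (h1 : α ^ 2 = γ ^ 2 + d) (h2 : β ^ 2 = γ ^ 2 - d) :
    (0 ≤ α ^ 3 + β ^ 3 - 2 * γ ^ 3 ∧ α ^ 3 + β ^ 3 - 2 * γ ^ 3 ≤ 5 * d ^ 2) ∧
    (0 ≤ 1 / α + 1 / β - 2 * (1 / γ) ∧ 1 / α + 1 / β - 2 * (1 / γ) ≤ 5 * d ^ 2) := by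
  obtain ⟨x, rfl⟩ : ∃ x, α = γ + x := ⟨α - γ, by ring⟩
  obtain ⟨y, rfl⟩ : ∃ y, β = γ - y := ⟨γ - β, by ring⟩
  have ex : x = d / (2 * γ + x) := by
    have : 2 * γ + x ≠ 0 := by linarith
    field_simp; linarith
  have ey : y = d / (2 * γ - y) := by
    have : 2 * γ - y ≠ 0 := by linarith
    field_simp; linarith
  have hx2 : x ^ 2 ≤ d ^ 2 / 3 := by
    have : 3 ≤ (2 * γ + x) ^ 2 := by nlinarith
    rw [ex, div_pow]
    exact div_le_div_of_nonneg_left (sq_nonneg d) (by norm_num) this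
  have hy2 : y ^ 2 ≤ d ^ 2 / 3 := by
    have : 3 ≤ (2 * γ - y) ^ 2 := by nlinarith
    rw [ey, div_pow]
    exact div_le_div_of_nonneg_left (sq_nonneg d) (by norm_num) this
  have hxy : 0 ≤ x * y := by
    have e : x * y = d ^ 2 / ((2 * γ + x) * (2 * γ - y)) := by
      rw [sq, ← div_mul_div_comm, ← ex, ← ey]
    rw [e]
    exact div_nonneg (sq_nonneg d) (mul_nonneg (by linarith) (by linarith))
  have rel : 2 * γ * (x - y) + x ^ 2 + y ^ 2 = 0 := by linear_combination h1 + h2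
  have e1 : (γ + x) ^ 3 + (γ - y) ^ 3 - 2 * γ ^ 3 =
      x ^ 2 * (3 / 2 * γ + x) + y ^ 2 * (3 / 2 * γ - y) := by
    linear_combination 3 / 2 * γ * rel
  have e2 : 1 / (γ + x) + 1 / (γ - y) - 2 * (1 / γ) =
      ((x ^ 2 + y ^ 2) / 2 + 2 * (x * y)) / ((γ + x) * (γ - y) * γ) := by
    have a1 : γ + x ≠ 0 := by linarith
    have a2 : γ - y ≠ 0 := by linarith
    have a3 : γ ≠ 0 := by linarith
    field_simp
    linear_combination (-1) * rel
  refine ⟨?_, ?_⟩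
  · rw [e1]
    have b1 : 0 ≤ 3 / 2 * γ + x := by linarith
    have b2 : 0 ≤ 3 / 2 * γ - y := by linarith
    refine ⟨by positivity, ?_⟩
    have c1 : x ^ 2 * (3 / 2 * γ + x) ≤ d ^ 2 / 3 * 3 := by gcongr; linarith
    have c2 : y ^ 2 * (3 / 2 * γ - y) ≤ d ^ 2 / 3 * 3 := by gcongr; linarith
    linarith [sq_nonneg d]
  · rw [e2]
    have a1 : 0 < γ + x := by linarith
    have a2 : 0 < γ - y := by linarith
    have a3 : 0 < γ := by linarith
    refine ⟨by positivity, ?_⟩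
    rw [div_le_iff₀ (by positivity)]
    have p1 : 1 / 2 ≤ (γ + x) * (γ - y) * γ := by
      calc (1:ℝ) / 2 ≤ 9 / 10 * (9 / 10) * (9 / 10) := by norm_num
        _ ≤ _ := by gcongr
    have : 2 * (x * y) ≤ x ^ 2 + y ^ 2 := by nlinarith [sq_nonneg (x - y)]
    calc (x ^ 2 + y ^ 2) / 2 + 2 * (x * y) ≤ d ^ 2 := by linarith
      _ ≤ 5 * d ^ 2 * (1 / 2) := by linarith [sq_nonneg d]
      _ ≤ _ := by gcongr

lemma log_second_diff_real {a d : ℝ} (h1 : 7 / 8 ≤ a + d) (h2 : 7 / 8 ≤ a - d) :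
    log (a + d) + log (a - d) - 2 * log a ≤ 0 ∧
      -(5 * d ^ 2) ≤ log (a + d) + log (a - d) - 2 * log a := by
  have ha : 7 / 8 ≤ a := by linarith
  have e : log (a + d) + log (a - d) - 2 * log a = log ((a + d) * (a - d) / a ^ 2) := by
    rw [Real.log_div (by nlinarith) (by positivity), Real.log_mul (by linarith) (by linarith),
      Real.log_pow]
    push_cast; ring
  have hp : 0 < (a + d) * (a - d) := mul_pos (by linarith) (by linarith)
  have hq : 1 / 2 ≤ (a + d) * (a - d) := by nlinarith
  have hpos : 0 < (a + d) * (a - d) / a ^ 2 := by positivity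
  rw [e]
  constructor
  · refine Real.log_nonpos hpos.le ?_
    rw [div_le_one (by positivity)]
    nlinarith [sq_nonneg d]
  · have k := Real.one_sub_inv_le_log_of_pos hpos
    refine le_trans ?_ k
    rw [inv_div, neg_le_sub_iff_le_add, div_le_iff₀ hp]
    nlinarith [sq_nonneg d]

lemma axDist_second (σ : ℝ) (m v : ℂ) : axDist σ (m + v) = axDist σ m + σ * v.re ∧
    axDist σ (m - v) = axDist σ m - σ * v.re := by
  unfold axDist; simp; constructor <;> ring

/-- The profiles are convex and the logarithm is concave, at the scale of second differences. -/
lemma secondDiff_profile (h : SmallScale σ) {b x M : ℝ} (hM0 : 0 ≤ M) (hM : M ≤ 5)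
    (hb : 2 * (-log σ) ≤ b) (hb' : b ≤ 100 * (-log σ)) (hx : |x| ≤ 600) {m v : ℂ}
    (hm : ‖m‖ ≤ 16) (hp : ‖m + v‖ ≤ 16) (hq : ‖m - v‖ ≤ 16) :
    secondDiff (fun y => M * log (axDist σ y) - b * profA σ y - x * profB σ y) m v ≤ 0 ∧
    -(1000 * (-log σ) * (σ * ‖v‖) ^ 2) ≤
      secondDiff (fun y => M * log (axDist σ y) - b * profA σ y - x * profB σ y) m v := by
  have hσ := h.pos
  have hL := h.log_huge
  have sm := h.mul_norm_le hm
  have sp := h.mul_norm_le hp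
  have sq := h.mul_norm_le hq
  obtain ⟨e1, e2⟩ := axDist_second σ m v
  have am := (axDist_bounds hσ sm).1
  have ap := (axDist_bounds hσ sp).1
  have aq := (axDist_bounds hσ sq).1
  have bm := sqrt_axDist_bounds hσ sm
  have bp := sqrt_axDist_bounds hσ sp
  have bq := sqrt_axDist_bounds hσ sq
  have hd : (σ * v.re) ^ 2 ≤ (σ * ‖v‖) ^ 2 := by
    rw [mul_pow, mul_pow]
    gcongr ?_ * ?_
    rw [← sq_abs v.re]
    gcongr
    exact Complex.abs_re_le_norm v
  obtain ⟨⟨c1, c2⟩, c3, c4⟩ := sqrt_second_diff_bounds (d := σ * v.re) bp.1 bp.2 bq.1 bq.2 bm.1 bm.2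
    (by rw [Real.sq_sqrt (by linarith), Real.sq_sqrt (by linarith), e1])
    (by rw [Real.sq_sqrt (by linarith), Real.sq_sqrt (by linarith), e2])
  obtain ⟨c5, c6⟩ := log_second_diff_real (a := axDist σ m) (d := σ * v.re)
    (by rw [← e1]; exact ap) (by rw [← e2]; exact aq)
  rw [← e1, ← e2] at c5 c6
  have hx' := abs_le.1 hx
  have e : secondDiff (fun y => M * log (axDist σ y) - b * profA σ y - x * profB σ y) m v =
      M * (log (axDist σ (m + v)) + log (axDist σ (m - v)) - 2 * log (axDist σ m)) -
      (b / 4 + x / 2) * (√(axDist σ (m + v)) ^ 3 + √(axDist σ (m - v)) ^ 3 -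
            2 * √(axDist σ m) ^ 3) -
      (3 / 4 * b - x / 2) * (1 / √(axDist σ (m + v)) + 1 / √(axDist σ (m - v)) -
        2 * (1 / √(axDist σ m))) := by
    unfold secondDiff profA profB; ring
  rw [e]
  have q1 : 0 ≤ b / 4 + x / 2 := by linarith
  have q2 : 0 ≤ 3 / 4 * b - x / 2 := by linarith
  constructor
  · have := mul_nonneg q1 c1
    have := mul_nonneg q2 c3
    have := mul_nonpos_of_nonneg_of_nonpos hM0 c5
    linarith
  · set t := (σ * v.re) ^ 2
    have t0 : 0 ≤ t := by positivity
    have r1 := mul_le_mul_of_nonneg_left c6 hM0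
    have r2 := mul_le_mul_of_nonneg_left c2 q1
    have r3 := mul_le_mul_of_nonneg_left c4 q2
    have r4 : (M + b) * (5 * t) ≤ 200 * (-log σ) * (5 * t) := by gcongr; linarith
    have r5 : 1000 * (-log σ) * t ≤ 1000 * (-log σ) * (σ * ‖v‖) ^ 2 := by gcongr
    linarith

lemma secondDiff_corrPot (h : SmallScale σ) (hDm : MeasurableSet D) (hD : D ⊆ ball 0 2) {m v : ℂ}
    (hm : ‖m‖ ≤ 16) (hp : ‖m + v‖ ≤ 16) (hq : ‖m - v‖ ≤ 16) :
    |secondDiff (corrPot σ D) m v| ≤ 40000 * (σ * ‖v‖ ^ 2) := by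
  have hσ := h.pos
  have j : ∀ y : ℂ, ‖y‖ ≤ 16 → IntegrableOn (fun w => rho σ w * ringJ (relDist σ y w)) D :=
    fun y hy => integrableOn_rho_mul h hDm hD (integrableOn_ringJ h hDm hD (axDist_pos h hy))
  have e : secondDiff (corrPot σ D) m v = ∫ w in D, rho σ w * (ringJ (relDist σ (m + v) w) +
      ringJ (relDist σ (m - v) w) - 2 * ringJ (relDist σ m w)) := by
    have j2 : IntegrableOn (fun w => rho σ w * ringJ (relDist σ (m + v) w) +
      rho σ w * ringJ (relDist σ (m - v) w)) D := (j _ hp).add (j _ hq)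
    unfold secondDiff corrPot
    rw [← integral_add (j _ hp) (j _ hq), ← integral_const_mul,
      ← integral_sub j2 ((j _ hm).const_mul 2)]
    exact integral_congr_ae (ae_of_all _ fun w => by ring)
  have hv := volume_ne_top_of_subset hD
  have i2 : IntegrableOn (fun w => 750 * (σ * ‖v‖ ^ 2) * (sing m w + 1)) D :=
    ((integrableOn_sing m hDm hv).add (integrableOn_const hv)).const_mul _
  rw [e, ← Real.norm_eq_abs]
  refine (norm_integral_le_of_norm_le i2 ?_).trans ?_
  · filter_upwards [ae_restrict_mem hDm, ae_ne m D] with w hw hne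
    have hw8 := h.mul_norm_mem hD hw
    have k := abs_ringJ_second_diff hσ (h.mul_norm_le hm) (h.mul_norm_le hp) (h.mul_norm_le hq) hw8
      hne
    rw [Real.norm_eq_abs, abs_mul]
    calc |rho σ w| * _ ≤ 5 / 4 * (600 * (σ * ‖v‖ ^ 2 / ‖m - w‖)) := by
          gcongr; exact abs_rho_le_mem h hD hw
      _ = 750 * (σ * ‖v‖ ^ 2) * (1 / ‖m - w‖) := by ring
      _ ≤ _ := by gcongr; exact inv_le_sing hne
  · rw [integral_const_mul, integral_add (integrableOn_sing m hDm hv) (integrableOn_const hv),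
      integral_const, measureReal_restrict_apply_univ, smul_eq_mul, mul_one]
    have k1 := integral_sing_le m hDm hv
    have k2 := volume_real_le_of_subset hD
    have k3 : volume.real D ^ (1 / 4 : ℝ) ≤ 2 := by
      refine rpow_quarter_le measureReal_nonneg (by norm_num) ?_
      linarith [pi_lt_d2]
    have : (∫ w in D, sing m w) + volume.real D ≤ 53 := by linarith [pi_lt_d2]
    have p : 0 ≤ σ * ‖v‖ ^ 2 := by positivity
    calc 750 * (σ * ‖v‖ ^ 2) * _ ≤ 750 * (σ * ‖v‖ ^ 2) * 53 := by gcongr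
      _ ≤ _ := by linarith

lemma integrableOn_logDiff {Z : Set ℂ} (hZm : MeasurableSet Z) (hZ : Z ⊆ ball 0 2) (m v : ℂ) :
    IntegrableOn (logDiff m v) Z := by
  unfold logDiff
  exact (((integrableOn_log hZm hZ).add (integrableOn_log hZm hZ)).sub
    ((integrableOn_log hZm hZ).const_mul 2)).const_mul _

lemma abs_logDiff_le_sing {m v w : ℂ} (ha : m ≠ w) (hp : m + v ≠ w) (hq : m - v ≠ w) :
    |logDiff m v w| ≤ 8 / 3 * (‖v‖ ^ (3 / 2 : ℝ) *
        (sing m w + sing (m + v) w + sing (m - v) w)) := by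
  unfold logDiff
  rw [abs_mul, abs_neg, abs_two]
  linarith [abs_log_second_diff_le_sing ha hp hq]

lemma abs_logDiff_le_of_far {m v w : ℂ} (ha : m ≠ w) (hf : 2 * ‖v‖ ≤ ‖m - w‖) :
    |logDiff m v w| ≤ 8 / 3 * (‖v‖ ^ 2 / ‖m - w‖ ^ 2) := by
  unfold logDiff
  rw [abs_mul, abs_neg, abs_two]
  linarith [abs_log_second_diff_le_of_far ha hf]

/-- A set of small measure contributes little to the second difference of the potential. -/
lemma integral_abs_logDiff_le {Z : Set ℂ} (hZ : MeasurableSet Z) (hv : volume Z ≠ ⊤) {f : ℂ → ℝ}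
    {c : ℝ} (hc0 : 0 ≤ c) (hf : ∀ w ∈ Z, |f w| ≤ c) (m v : ℂ) :
    |∫ w in Z, f w * logDiff m v w| ≤
      c * (112 * (‖v‖ ^ (3 / 2 : ℝ) * volume.real Z ^ (1 / 4 : ℝ))) := by
  have i1 := integrableOn_sing m hZ hv
  have i2 := integrableOn_sing (m + v) hZ hv
  have i3 := integrableOn_sing (m - v) hZ hv
  have i4 : IntegrableOn (fun w => c * (8 / 3 * (‖v‖ ^ (3 / 2 : ℝ) * (sing m w + sing (m + v) w +
      sing (m - v) w)))) Z := ((((i1.add i2).add i3).const_mul _).const_mul _).const_mul _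
  rw [← Real.norm_eq_abs]
  refine (norm_integral_le_of_norm_le i4 ?_).trans ?_
  · filter_upwards [ae_restrict_mem hZ, ae_ne m Z, ae_ne (m + v) Z,
      ae_ne (m - v) Z] with w hw h1 h2 h3
    rw [Real.norm_eq_abs, abs_mul]
    gcongr
    · exact hf w hw
    · exact abs_logDiff_le_sing h1 h2 h3
  · have j12 : IntegrableOn (fun w => sing m w + sing (m + v) w) Z := i1.add i2
    rw [integral_const_mul, integral_const_mul, integral_const_mul, integral_add j12 i3,
      integral_add i1 i2]
    have k1 := integral_sing_le m hZ hv
    have k2 := integral_sing_le (m + v) hZ hv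
    have k3 := integral_sing_le (m - v) hZ hv
    refine mul_le_mul_of_nonneg_left ?_ hc0
    calc 8 / 3 * (‖v‖ ^ (3 / 2 : ℝ) * _) ≤ 8 / 3 * (‖v‖ ^ (3 / 2 : ℝ) *
          (14 * volume.real Z ^ (1 / 4 : ℝ) + 14 * volume.real Z ^ (1 / 4 : ℝ) +
          14 * volume.real Z ^ (1 / 4 : ℝ))) := by gcongr
      _ = _ := by ring

lemma secondDiff_logPot (h : SmallScale σ) (hDm : MeasurableSet D) (hD : D ⊆ ball 0 2) (m v : ℂ) :
    secondDiff (logPot σ D) m v = ∫ w in D, rho σ w * logDiff m v w := by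
  have j : ∀ y : ℂ, IntegrableOn (fun w => rho σ w * (-2 * log ‖y - w‖)) D :=
    fun y => integrableOn_rho_mul h hDm hD (integrableOn_neg_two_log hDm hD y)
  have j2 : IntegrableOn (fun w => rho σ w * (-2 * log ‖m + v - w‖) +
    rho σ w * (-2 * log ‖m - v - w‖)) D := (j _).add (j _)
  unfold secondDiff logPot logDiff
  rw [← integral_add (j _) (j _), ← integral_const_mul,
    ← integral_sub j2 ((j _).const_mul 2)]
  exact integral_congr_ae (ae_of_all _ fun w => by ring)

lemma secondDiff_coreExcess_eq (h : SmallScale σ) (hD : InBand σ D) {m v : ℂ}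
    (hm : ‖m‖ ≤ 16) (hp : ‖m + v‖ ≤ 16) (hq : ‖m - v‖ ≤ 16) :
    secondDiff (coreExcess σ D) m v = secondDiff (logPot σ D) m v + secondDiff (corrPot σ D) m v +
      secondDiff (fun y => massRho σ D * log (axDist σ y) - multA σ D * profA σ y -
        multB σ D * profB σ y) m v := by
  have e : ∀ y : ℂ, ‖y‖ ≤ 16 → coreExcess σ D y = logPot σ D y + corrPot σ D y +
      (massRho σ D * log (axDist σ y) - multA σ D * profA σ y - multB σ D * profB σ y) +
      selfConst σ D := by
    intro y hy
    unfold coreExcess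
    rw [excess_eq h hD.meas (hD.subset_two h) _ _ (axDist_pos h hy)]; ring
  simp only [secondDiff]
  rw [e _ hm, e _ hp, e _ hq]; ring

end

section
variable {σ : ℝ} {D : Set ℂ}

lemma rpow_three_halves {x : ℝ} (hx : 0 ≤ x) : x ^ (3 / 2 : ℝ) = x * √x := by
  rcases hx.eq_or_lt with rfl | h
  · simp
  · rw [Real.sqrt_eq_rpow, show (3 / 2 : ℝ) = 1 + 1 / 2 by norm_num, Real.rpow_add h, Real.rpow_one]

lemma abs_integral_logDiff_le {Z : Set ℂ} (hZ : MeasurableSet Z) (hv : volume Z ≠ ⊤) {f : ℂ → ℝ}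
    {c b : ℝ} (hc0 : 0 ≤ c) (hf : ∀ w ∈ Z, |f w| ≤ c) (hb : 0 ≤ b) (hZb : volume.real Z ≤ b ^ 4)
    (m v : ℂ) : |∫ w in Z, f w * logDiff m v w| ≤ c * (112 * (‖v‖ * √‖v‖ * b)) := by
  have k := integral_abs_logDiff_le hZ hv hc0 hf m v
  rw [rpow_three_halves (norm_nonneg v)] at k
  refine k.trans ?_
  gcongr
  exact rpow_quarter_le measureReal_nonneg hb hZb

/-- The potential of a disc agrees with a quadratic polynomial up to a quadratic error in
`‖y‖ ^ 2 - R ^ 2`. -/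
lemma discPot_quadratic {R : ℝ} (hR : 0 < R) (y : ℂ) :
    0 ≤ discPot R y + 2 * π * R ^ 2 * log R + π * (‖y‖ ^ 2 - R ^ 2) ∧
    discPot R y + 2 * π * R ^ 2 * log R + π * (‖y‖ ^ 2 - R ^ 2) ≤
      π * ((‖y‖ ^ 2 - R ^ 2) ^ 2 / (2 * R ^ 2)) := by
  have hpi := pi_pos
  rcases le_total ‖y‖ R with hy | hy
  · rw [discPot_inside hy]
    constructor
    · apply le_of_eq; ring
    · have : π * (R ^ 2 - ‖y‖ ^ 2) - 2 * π * R ^ 2 * log R + 2 * π * R ^ 2 * log R +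
        π * (‖y‖ ^ 2 - R ^ 2) = 0 := by ring
      rw [this]; positivity
  · rw [discPot_outside hR.le hy]
    set s := (‖y‖ ^ 2 - R ^ 2) / R ^ 2 with hs
    have hyp : 0 < ‖y‖ := by linarith
    have s0 : 0 ≤ s := by
      rw [hs]; apply div_nonneg _ (by positivity)
      nlinarith
    have es : ‖y‖ ^ 2 - R ^ 2 = R ^ 2 * s := by rw [hs]; field_simp
    have e1 : log (1 + s) = 2 * log ‖y‖ - 2 * log R := by
      have : 1 + s = ‖y‖ ^ 2 / R ^ 2 := by rw [hs]; field_simp; ring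
      rw [this, Real.log_div (by positivity) (by positivity), Real.log_pow, Real.log_pow]
      push_cast; ring
    have e2 : -(2 * π) * R ^ 2 * log ‖y‖ + 2 * π * R ^ 2 * log R + π * (‖y‖ ^ 2 - R ^ 2) =
        π * R ^ 2 * (s - log (1 + s)) := by rw [es, e1]; ring
    have e3 : π * ((‖y‖ ^ 2 - R ^ 2) ^ 2 / (2 * R ^ 2)) = π * R ^ 2 * (s ^ 2 / 2) := by
      rw [es]; field_simp
    rw [e2, e3]
    have u1 : log (1 + s) ≤ s := by
      have := Real.log_le_sub_one_of_pos (show 0 < 1 + s by linarith); linarith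
    have u2 : s - s ^ 2 / 2 ≤ log (1 + s) := by
      refine le_trans ?_ (Real.le_log_one_add_of_nonneg s0)
      rw [le_div_iff₀ (by linarith)]
      nlinarith [pow_nonneg s0 3]
    have p : 0 ≤ π * R ^ 2 := by positivity
    exact ⟨mul_nonneg p (by linarith), mul_le_mul_of_nonneg_left (by linarith) p⟩

lemma norm_sq_add_sub (m v : ℂ) : ‖m + v‖ ^ 2 + ‖m - v‖ ^ 2 = 2 * ‖m‖ ^ 2 + 2 * ‖v‖ ^ 2 := by
  have := parallelogram_law_with_norm ℝ m v
  nlinarith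

/-- Second differences of the potential of a disc at a boundary point. -/
lemma secondDiff_discPot {m : ℂ} (h1 : 9 / 10 ≤ ‖m‖) (v : ℂ) :
    -(2 * π * ‖v‖ ^ 2) ≤ secondDiff (discPot ‖m‖) m v ∧
    secondDiff (discPot ‖m‖) m v ≤ -(2 * π * ‖v‖ ^ 2) +
      2 * ((‖m + v‖ ^ 2 - ‖m‖ ^ 2) ^ 2 + (‖m - v‖ ^ 2 - ‖m‖ ^ 2) ^ 2) := by
  have hR : 0 < ‖m‖ := by linarith
  obtain ⟨a1, a2⟩ := discPot_quadratic hR (m + v)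
  obtain ⟨b1, b2⟩ := discPot_quadratic hR (m - v)
  obtain ⟨c1, c2⟩ := discPot_quadratic hR m
  have c3 : π * ((‖m‖ ^ 2 - ‖m‖ ^ 2) ^ 2 / (2 * ‖m‖ ^ 2)) = 0 := by rw [sub_self]; simp
  rw [c3] at c2
  have hpi : π * (‖m + v‖ ^ 2 + ‖m - v‖ ^ 2) = π * (2 * ‖m‖ ^ 2 + 2 * ‖v‖ ^ 2) := by
    rw [norm_sq_add_sub]
  have q : ∀ t : ℝ, π * (t ^ 2 / (2 * ‖m‖ ^ 2)) ≤ 2 * t ^ 2 := by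
    intro t
    have : (9 / 10 : ℝ) ^ 2 ≤ ‖m‖ ^ 2 := by gcongr
    rw [mul_div_assoc', div_le_iff₀ (by positivity)]
    have : π ≤ 4 * ‖m‖ ^ 2 := by linarith [pi_lt_d2]
    nlinarith [sq_nonneg t]
  have q1 := q (‖m + v‖ ^ 2 - ‖m‖ ^ 2)
  have q2 := q (‖m - v‖ ^ 2 - ‖m‖ ^ 2)
  unfold secondDiff
  constructor <;> linarith

lemma abs_norm_sq_sub_le {m v : ℂ} (h1 : ‖m‖ ≤ 11 / 10) (hv : ‖v‖ ≤ 1 / 2) :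
    |‖m + v‖ ^ 2 - ‖m‖ ^ 2| ≤ 3 * ‖v‖ := by
  have k : |‖m + v‖ - ‖m‖| ≤ ‖v‖ := by
    have := abs_norm_sub_norm_le (m + v) m
    rwa [add_sub_cancel_left] at this
  have k2 : ‖m + v‖ + ‖m‖ ≤ 3 := by linarith [norm_add_le m v]
  rw [show ‖m + v‖ ^ 2 - ‖m‖ ^ 2 = (‖m + v‖ + ‖m‖) * (‖m + v‖ - ‖m‖) by ring, abs_mul,
    abs_of_nonneg (by positivity)]
  gcongr

lemma abs_secondDiff_discPot_le {m v : ℂ} (h1 : 9 / 10 ≤ ‖m‖) (h2 : ‖m‖ ≤ 11 / 10)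
    (hv : ‖v‖ ≤ 1 / 2) : |secondDiff (discPot ‖m‖) m v| ≤ 50 * ‖v‖ ^ 2 := by
  obtain ⟨a, b⟩ := secondDiff_discPot h1 v
  have k1 := abs_norm_sq_sub_le h2 hv
  have k2 := abs_norm_sq_sub_le h2 (v := -v) (by rwa [norm_neg])
  rw [norm_neg, ← sub_eq_add_neg] at k2
  have q : ∀ t : ℝ, |t| ≤ 3 * ‖v‖ → t ^ 2 ≤ 9 * ‖v‖ ^ 2 := by
    intro t ht
    rw [← sq_abs]
    calc |t| ^ 2 ≤ (3 * ‖v‖) ^ 2 := by gcongr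
      _ = _ := by ring
  have := q _ k1
  have := q _ k2
  have p : 2 * π * ‖v‖ ^ 2 ≤ 8 * ‖v‖ ^ 2 := by gcongr; linarith [pi_lt_d2]
  have p0 : 0 ≤ 2 * π * ‖v‖ ^ 2 := by positivity
  rw [abs_le]; constructor <;> linarith [sq_nonneg ‖v‖]

lemma secondDiff_discPot_eq {R : ℝ} (hR : R ≤ 2) (m v : ℂ) :
    secondDiff (discPot R) m v = ∫ w in ball (0:ℂ) R, logDiff m v w := by
  have hs : ball (0:ℂ) R ⊆ ball 0 2 := ball_subset_ball hR
  have j : ∀ y : ℂ, IntegrableOn (fun w => -2 * log ‖y - w‖) (ball (0:ℂ) R) :=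
    fun y => integrableOn_neg_two_log measurableSet_ball hs y
  have j2 : IntegrableOn (fun w => -2 * log ‖m + v - w‖ + -2 * log ‖m - v - w‖) (ball (0:ℂ) R) :=
    (j _).add (j _)
  unfold secondDiff discPot logDiff
  rw [← integral_add (j _) (j _), ← integral_const_mul, ← integral_sub j2 ((j _).const_mul 2)]
  exact integral_congr_ae (ae_of_all _ fun w => by ring)

lemma abs_secondDiff_logPot_sub_discPot (h : SmallScale σ) (hD : InBand σ D) {R : ℝ}
    (h1 : 1 - bandWidth σ ≤ R) (h2 : R ≤ 1 + bandWidth σ) (m v : ℂ) :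
    |secondDiff (logPot σ D) m v - secondDiff (discPot R) m v| ≤
      ‖v‖ * √‖v‖ * (1 / 10 ^ 40) := by
  have hB := InBand.ball h1 h2
  have hD2 := hD.subset_two h
  have hB2 := hB.subset_two h
  have hv := volume_ne_top_of_subset hD2
  have iD := integrableOn_logDiff hD.meas hD2 m v
  have iB := integrableOn_logDiff hB.meas hB2 m v
  rw [secondDiff_logPot h hD.meas hD2, secondDiff_discPot_eq (by linarith [h.bandWidth_le_coarse])]
  have e3 : ∫ w in D, rho σ w * logDiff m v w =
      (∫ w in D, (rho σ w - 1) * logDiff m v w) + ∫ w in D, logDiff m v w := by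
    rw [← integral_add _ iD]
    · congr 1; ext w; ring
    · refine iD.bdd_mul (c := 1) ((continuous_rho σ).sub continuous_const).aestronglyMeasurable ?_
      filter_upwards [ae_restrict_mem hD.meas] with w hw
      obtain ⟨a, b⟩ := rho_bounds h.pos (h.mul_norm_mem hD2 hw)
      rw [Real.norm_eq_abs, abs_le]; constructor <;> linarith
  have e4 := setIntegral_sub_eq hD.meas hB.meas iD iB
  have hσ := h.pos
  have hσ2 := h.le
  have vD : volume.real D ≤ 2 ^ 4 := by
    have := volume_real_le_of_subset hD2
    linarith [pi_lt_d2]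
  have b1 := abs_integral_logDiff_le hD.meas hv (c := 4 * σ) (by positivity)
    (f := fun w => rho σ w - 1) (fun w hw => by
      have k := abs_rho_sub_one_le hσ (h.mul_norm_mem hD2 hw)
      have k2 := norm_lt_of_subset hD2 hw
      nlinarith) (by norm_num) vD m v
  have aux : ∀ Z : Set ℂ, MeasurableSet Z → Z ⊆ band σ →
      |∫ w in Z, logDiff m v w| ≤ 112 * (‖v‖ * √‖v‖ * (1 / 10 ^ 45)) := by
    intro Z hZ hZs
    have b := abs_integral_logDiff_le hZ (ne_top_of_le_ne_top (band_ne_top σ) (measure_mono hZs))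
      zero_le_one (f := fun _ => 1) (fun _ _ => by simp) (by positivity)
      ((measureReal_mono hZs (band_ne_top σ)).trans h.volume_band_le) m v
    simpa only [one_mul] using b
  have b2 := aux _ (hD.meas.diff measurableSet_ball) (hD.sdiff_subset hB)
  have b3 := aux _ (measurableSet_ball.diff hD.meas) (hB.sdiff_subset hD)
  have p : 0 ≤ ‖v‖ * √‖v‖ := by positivity
  have b4 : 4 * σ * (112 * (‖v‖ * √‖v‖ * 2)) ≤ 4 * (1 / 10 ^ 202) * (112 * (‖v‖ * √‖v‖ * 2)) := by
    gcongr
  rw [e3, abs_le]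
  have b1 := abs_le.1 b1
  have b2 := abs_le.1 b2
  have b3 := abs_le.1 b3
  constructor <;> linarith

lemma le_sqrt_mul {x r : ℝ} (hx : 0 ≤ x) (hr : 0 ≤ r) (h : x ≤ r ^ 2) : x ^ 2 ≤ r * (x * √x) := by
  have k : √x ≤ r := by rw [← Real.sqrt_sq hr]; exact Real.sqrt_le_sqrt h
  have e : x = √x * √x := (Real.mul_self_sqrt hx).symm
  calc x ^ 2 = √x * (x * √x) := by linear_combination x * e
    _ ≤ _ := by gcongr

/-- Second differences of the excess near the boundary. -/
lemma abs_secondDiff_coreExcess_le (h : SmallScale σ) (hD : InBand σ D) {m v : ℂ}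
    (h1 : 1 - bandWidth σ ≤ ‖m‖) (h2 : ‖m‖ ≤ 1 + bandWidth σ) (hv : ‖v‖ ≤ 1 / 10 ^ 8) :
    |secondDiff (coreExcess σ D) m v| ≤ 1 / 100 * (‖v‖ * √‖v‖) := by
  have d := h.bandWidth_le_coarse
  have hσ := h.pos
  have hσ2 := h.le
  have hD2 := hD.subset_two h
  have np := norm_add_le m v
  have nq := norm_sub_le m v
  have hL := h.log_huge
  have k1 := abs_secondDiff_logPot_sub_discPot h hD h1 h2 m v
  have k2 := abs_secondDiff_discPot_le (m := m) (v := v) (by linarith) (by linarith) (by linarith)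
  have k3 := secondDiff_corrPot h hD.meas hD2 (m := m) (v := v) (by linarith) (by linarith)
    (by linarith)
  have k4 := secondDiff_profile h (by linarith [(le_massRho h hD).1]) (le_massRho h hD).2
    (le_multA h hD) ((abs_le.1 (abs_multA_le h hD2)).2) (abs_multB_le h hD)
    (m := m) (v := v) (by linarith) (by linarith) (by linarith)
  have e := secondDiff_coreExcess_eq h hD (m := m) (v := v) (by linarith) (by linarith)
      (by linarith)
  have q := le_sqrt_mul (norm_nonneg v) (r := 1 / 10 ^ 4) (by norm_num) (by linarith)
  set s := ‖v‖ * √‖v‖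
  have s0 : 0 ≤ s := by positivity
  have q1 : 40000 * (σ * ‖v‖ ^ 2) ≤ 40000 * (1 / 10 ^ 202 * ‖v‖ ^ 2) := by gcongr
  have q2 : 1000 * (-log σ) * (σ * ‖v‖) ^ 2 ≤ ‖v‖ ^ 2 := by
    have : 1000 * (-log σ) * (σ * ‖v‖) ^ 2 = 1000 * (σ * (-log σ)) * σ * ‖v‖ ^ 2 := by ring
    rw [this]
    have w : 1000 * (σ * (-log σ)) * σ ≤ 1000 * (1 / 10 ^ 200) * (1 / 10 ^ 202) := by
      gcongr; exact h.mul_log_small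
    calc _ ≤ 1000 * (1 / 10 ^ 200) * (1 / 10 ^ 202) * ‖v‖ ^ 2 := by gcongr
      _ ≤ _ := by linarith [sq_nonneg ‖v‖]
  rw [e, abs_le]
  have k1 := abs_le.1 k1
  have k2 := abs_le.1 k2
  have k3 := abs_le.1 k3
  constructor <;> linarith

end

/-- A planar set with short horizontal slices has small area. -/
lemma volume_le_of_slices {S : Set ℂ} (hS : MeasurableSet S) {t l : ℝ} (ht : 0 ≤ t) (hl : 0 ≤ l)
    (him : ∀ z ∈ S, |z.im| ≤ t) (hre : ∀ z ∈ S, ∀ w ∈ S, z.im = w.im → |z.re - w.re| ≤ l) :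
    volume.real S ≤ 2 * t * l := by
  have e1 := Complex.volume_preserving_equiv_real_prod.symm.measure_preimage_equiv S
  have hS' : MeasurableSet (Complex.measurableEquivRealProd.symm ⁻¹' S) :=
    Complex.measurableEquivRealProd.symm.measurable hS
  have key : volume S ≤ ENNReal.ofReal (2 * t * l) := by
    rw [← e1, Measure.volume_eq_prod, Measure.prod_apply_symm hS']
    have b : ∀ y : ℝ, volume ((fun x : ℝ => (x, y)) ⁻¹'
        (Complex.measurableEquivRealProd.symm ⁻¹' S)) ≤
        (Set.Icc (-t) t).indicator (fun _ => ENNReal.ofReal l) y := by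
      intro y
      set T := (fun x : ℝ => (x, y)) ⁻¹' (Complex.measurableEquivRealProd.symm ⁻¹' S) with hT
      have hmem : ∀ x : ℝ, x ∈ T → (⟨x, y⟩ : ℂ) ∈ S := fun x hx => hx
      by_cases hy : y ∈ Set.Icc (-t) t
      · rw [Set.indicator_of_mem hy]
        refine (Real.volume_le_diam T).trans ?_
        refine Metric.ediam_le fun a ha b hb => ?_
        rw [edist_dist, Real.dist_eq]
        exact ENNReal.ofReal_le_ofReal (hre _ (hmem a ha) _ (hmem b hb) rfl)
      · rw [Set.indicator_of_notMem hy]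
        have : T = ∅ := by
          refine Set.eq_empty_of_forall_notMem fun x hx => hy ?_
          exact abs_le.1 (him _ (hmem x hx))
        rw [this]; simp
    refine (lintegral_mono b).trans ?_
    rw [lintegral_indicator measurableSet_Icc, lintegral_const, Measure.restrict_apply_univ,
      Real.volume_Icc, ← ENNReal.ofReal_mul hl]
    apply le_of_eq; congr 1; ring
  exact ENNReal.toReal_le_of_le_ofReal (by positivity) key

lemma volume_real_preimage_mul (S : Set ℂ) {u : ℂ} (hu : ‖u‖ = 1) (hS : MeasurableSet S) :
    volume.real ((fun z => u * z) ⁻¹' S) = volume.real S := by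
  have hm : Measurable (fun z : ℂ => u * z) := by fun_prop
  have k := integral_unit_mul (S.indicator fun _ => (1:ℝ)) hu
  have e : (fun w => S.indicator (fun _ => (1:ℝ)) (u * w)) =
      ((fun z => u * z) ⁻¹' S).indicator (fun _ => (1:ℝ)) := by
    ext w
    by_cases hw : u * w ∈ S
    · rw [Set.indicator_of_mem hw, Set.indicator_of_mem (show w ∈ _ from hw)]
    · rw [Set.indicator_of_notMem hw, Set.indicator_of_notMem (show w ∉ _ from hw)]
  rw [e, integral_indicator (hm hS), integral_indicator hS] at k
  simpa using k

/-- A planar set whose slices in a fixed direction are short has small area. -/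
lemma volume_le_of_slices_dir {S : Set ℂ} (hS : MeasurableSet S) {u : ℂ} (hu : ‖u‖ = 1) {t l : ℝ}
    (ht : 0 ≤ t) (hl : 0 ≤ l) (hSt : S ⊆ ball 0 t)
    (hre : ∀ z w : ℂ, u * z ∈ S → u * w ∈ S → z.im = w.im → z.re ≤ w.re → w.re - z.re ≤ l) :
    volume.real S ≤ 2 * t * l := by
  have hm : Measurable (fun z : ℂ => u * z) := by fun_prop
  rw [← volume_real_preimage_mul S hu hS]
  refine volume_le_of_slices (hm hS) ht hl (fun z hz => ?_) fun z hz w hw hi => ?_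
  · have := hSt hz
    rw [mem_ball_zero_iff, norm_mul, hu, one_mul] at this
    exact (Complex.abs_im_le_norm z).trans this.le
  · rcases le_total z.re w.re with hc | hc
    · rw [abs_sub_comm, abs_of_nonneg (by linarith)]; exact hre z w hz hw hi hc
    · rw [abs_of_nonneg (by linarith)]; exact hre w z hw hz hi.symm hc

/-- Points whose reflections through the origin are classified alike by a set. -/
def badSet (E : Set ℂ) (r : ℝ) : Set ℂ := {v | v ∈ ball 0 r ∧ (v ∈ E ↔ -v ∈ E)}

lemma measurableSet_badSet {E : Set ℂ} (hE : MeasurableSet E) (r : ℝ) :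
    MeasurableSet (badSet E r) := by
  have h2 : MeasurableSet {v : ℂ | -v ∈ E} := measurable_neg hE
  exact measurableSet_ball.inter (MeasurableSet.iff hE h2)

/-- The integral of an even function over half of a ball, up to the bad set. -/
lemma abs_two_integral_sub_le {E : Set ℂ} (hE : MeasurableSet E) {r : ℝ} {f : ℂ → ℝ}
    (hf : ∀ v, f (-v) = f v) (hi : IntegrableOn f (ball 0 r)) :
    |2 * (∫ v in ball 0 r ∩ E, f v) - ∫ v in ball 0 r, f v| ≤ ∫ v in badSet E r, |f v| := by
  have hb : MeasurableSet (ball (0:ℂ) r) := measurableSet_ball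
  have h2 : MeasurableSet {v : ℂ | -v ∈ E} := measurable_neg hE
  have hbad := measurableSet_badSet hE r
  have hsub : badSet E r ⊆ ball 0 r := fun v hv => hv.1
  set g := (ball (0:ℂ) r ∩ E).indicator f with hg
  set g' := (ball (0:ℂ) r ∩ {v | -v ∈ E}).indicator f with hg'
  have ig : Integrable g := (integrable_indicator_iff (hb.inter hE)).2
      (hi.mono_set Set.inter_subset_left)
  have ig' : Integrable g' :=
    (integrable_indicator_iff (hb.inter h2)).2 (hi.mono_set Set.inter_subset_left)
  have ib : Integrable ((ball (0:ℂ) r).indicator f) := (integrable_indicator_iff hb).2 hi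
  have e1 : ∫ v, g' v = ∫ v, g v := by
    rw [← integral_neg_eq_self g]
    congr 1; ext v
    have hmem : v ∈ ball (0:ℂ) r ∩ {v | -v ∈ E} ↔ -v ∈ ball (0:ℂ) r ∩ E :=
      and_congr (by simp) Iff.rfl
    by_cases hv : -v ∈ ball (0:ℂ) r ∩ E
    · rw [hg, hg', Set.indicator_of_mem hv, Set.indicator_of_mem (hmem.2 hv), hf]
    · rw [hg, hg', Set.indicator_of_notMem hv, Set.indicator_of_notMem (mt hmem.1 hv)]
  have e2 : 2 * (∫ v in ball 0 r ∩ E, f v) - ∫ v in ball 0 r, f v =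
      ∫ v, (g v + g' v - (ball (0:ℂ) r).indicator f v) := by
    have ig2 : Integrable (fun v => g v + g' v) := ig.add ig'
    rw [integral_sub ig2 ib, integral_add ig ig', e1, hg, integral_indicator (hb.inter hE),
      integral_indicator hb]
    ring
  rw [e2, ← Real.norm_eq_abs, ← integral_indicator hbad]
  refine norm_integral_le_of_norm_le ((integrable_indicator_iff hbad).2 (hi.mono_set hsub).abs)
    (ae_of_all _ fun v => ?_)
  rw [Real.norm_eq_abs]
  classical
  have k1 : g v = if v ∈ ball (0:ℂ) r ∧ v ∈ E then f v else 0 := by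
    split_ifs with hc
    · exact Set.indicator_of_mem (show v ∈ ball (0:ℂ) r ∩ E from hc) _
    · exact Set.indicator_of_notMem (show v ∉ ball (0:ℂ) r ∩ E from hc) _
  have k2 : g' v = if v ∈ ball (0:ℂ) r ∧ -v ∈ E then f v else 0 := by
    split_ifs with hc
    · exact Set.indicator_of_mem (show v ∈ ball (0:ℂ) r ∩ {v | -v ∈ E} from hc) _
    · exact Set.indicator_of_notMem (show v ∉ ball (0:ℂ) r ∩ {v | -v ∈ E} from hc) _
  have k3 : (ball (0:ℂ) r).indicator f v = if v ∈ ball (0:ℂ) r then f v else 0 := by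
    split_ifs with hc
    · exact Set.indicator_of_mem hc _
    · exact Set.indicator_of_notMem hc _
  have k4 : (badSet E r).indicator (fun v => |f v|) v =
      if v ∈ ball (0:ℂ) r ∧ (v ∈ E ↔ -v ∈ E) then |f v| else 0 := by
    split_ifs with hc
    · exact Set.indicator_of_mem (show v ∈ badSet E r from hc) _
    · exact Set.indicator_of_notMem (show v ∉ badSet E r from hc) _
  rw [k1, k2, k3, k4]
  by_cases a : v ∈ ball (0:ℂ) r <;> by_cases b : v ∈ E <;> by_cases c : -v ∈ E <;>
    simp only [a, b, c, and_self, and_true, and_false, iff_self, if_true, if_false, iff_true,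
      iff_false, not_true] <;> norm_num

/-- The second difference kernel centred at its base point. -/
lemma logDiff_add (m e v : ℂ) : logDiff m e (m + v) = logDiff 0 e v := by
  unfold logDiff
  rw [show m + e - (m + v) = 0 + e - v by ring, show m - e - (m + v) = 0 - e - v by ring,
    show m - (m + v) = 0 - v by ring]

lemma logDiff_zero_neg (e v : ℂ) : logDiff 0 e (-v) = logDiff 0 e v := by
  unfold logDiff
  have a : 0 + e - -v = -(0 - e - v) := by ring
  have b : 0 - e - -v = -(0 + e - v) := by ring
  have c : (0:ℂ) - -v = -(0 - v) := by ring
  rw [a, b, c, norm_neg, norm_neg, norm_neg]; ring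

lemma abs_logDiff_zero_le {e v : ℂ} (hv : v ≠ 0) (hf : 2 * ‖e‖ ≤ ‖v‖) :
    |logDiff 0 e v| ≤ 8 / 3 * (‖e‖ ^ 2 / ‖v‖ ^ 2) := by
  have := abs_logDiff_le_of_far (m := 0) (v := e) (w := v) hv.symm (by simpa using hf)
  simpa using this

/-- Area of a set near the origin controls the integral of the second difference kernel. -/
lemma integral_logDiff_annulus {S : Set ℂ} {e : ℂ} (he : e ≠ 0)
    (hS : MeasurableSet S)
    (hvol : ∀ t, ‖e‖ ≤ t → volume.real (S ∩ ball 0 t) ≤ t ^ 2 * √t) (n : ℕ) :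
    ∫ v in S ∩ (ball 0 (2 ^ n * (2 * ‖e‖)) \ ball 0 (2 * ‖e‖)), |logDiff 0 e v| ≤
      8 / 3 * ‖e‖ ^ 2 * (14 * √(2 ^ n * (2 * ‖e‖))) := by
  have hp : 0 < ‖e‖ := norm_pos_iff.2 he
  induction n with
  | zero => simp; positivity
  | succ n ih =>
    set ρ := 2 ^ n * (2 * ‖e‖) with hρ
    have e2 : 2 ^ (n + 1) * (2 * ‖e‖) = 2 * ρ := by rw [hρ, pow_succ]; ring
    rw [e2]
    have h1 : 2 * ‖e‖ ≤ ρ := by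
      rw [hρ]; exact le_mul_of_one_le_left (by positivity) (one_le_pow₀ (by norm_num))
    have hρ0 : 0 < ρ := by linarith
    have dec : S ∩ (ball 0 (2 * ρ) \ ball 0 (2 * ‖e‖)) =
        (S ∩ (ball 0 ρ \ ball 0 (2 * ‖e‖))) ∪ (S ∩ (ball 0 (2 * ρ) \ ball 0 ρ)) := by
      ext v
      simp only [Set.mem_inter_iff, Set.mem_sdiff, mem_ball_zero_iff, Set.mem_union]
      by_cases hv : ‖v‖ < ρ
      · have : ‖v‖ < 2 * ρ := by linarith
        tauto
      · have : ¬ ‖v‖ < 2 * ‖e‖ := by linarith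
        tauto
    have dis : Disjoint (S ∩ (ball (0:ℂ) ρ \ ball 0 (2 * ‖e‖))) (S ∩ (ball 0 (2 * ρ) \ ball 0 ρ)) :=
      Set.disjoint_left.2 fun v hv hv' => hv'.2.2 hv.2.1
    have m2 : MeasurableSet (S ∩ (ball (0:ℂ) (2 * ρ) \ ball 0 ρ)) :=
      hS.inter (measurableSet_ball.diff measurableSet_ball)
    have fin : ∀ Z : Set ℂ, Z ⊆ ball (0:ℂ) (2 * ρ) → volume Z ≠ ⊤ := fun Z hZ =>
      ne_top_of_le_ne_top (volume_ball_ne_top 0 _) (measure_mono hZ)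
    have hlog : IntegrableOn (fun v => |logDiff 0 e v|) (ball 0 (2 * ρ)) := by
      unfold logDiff
      exact ((((integrableOn_log measurableSet_ball subset_rfl).add
        (integrableOn_log measurableSet_ball subset_rfl)).sub
        ((integrableOn_log measurableSet_ball subset_rfl).const_mul 2)).const_mul _).abs
    rw [dec, setIntegral_union dis m2
      (hlog.mono_set fun v hv => ball_subset_ball (by linarith) hv.2.1)
      (hlog.mono_set fun v hv => hv.2.1)]
    have b : ∫ v in S ∩ (ball 0 (2 * ρ) \ ball 0 ρ), |logDiff 0 e v| ≤
        8 / 3 * ‖e‖ ^ 2 * (4 * √(2 * ρ)) := by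
      have k := norm_setIntegral_le_of_norm_le_const (μ := volume) (f := fun v => |logDiff 0 e v|)
        (s := S ∩ (ball 0 (2 * ρ) \ ball 0 ρ)) (C := 8 / 3 * (‖e‖ ^ 2 / ρ ^ 2))
        (lt_top_iff_ne_top.2 (fin _ fun v hv => hv.2.1)) (by
          intro v hv
          have hv2 : ρ ≤ ‖v‖ := by
            have := hv.2.2; rwa [mem_ball_zero_iff, not_lt] at this
          have hv0 : v ≠ 0 := norm_pos_iff.1 (by linarith)
          rw [Real.norm_eq_abs, abs_abs]
          refine (abs_logDiff_zero_le hv0 (by linarith)).trans ?_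
          gcongr)
      have vol : volume.real (S ∩ (ball (0:ℂ) (2 * ρ) \ ball 0 ρ)) ≤ (2 * ρ) ^ 2 * √(2 * ρ) :=
        (measureReal_mono (Set.inter_subset_inter_right S Set.sdiff_subset)
          (fin _ Set.inter_subset_right)).trans (hvol _ (by linarith))
      refine (le_abs_self _).trans (k.trans ?_)
      calc 8 / 3 * (‖e‖ ^ 2 / ρ ^ 2) * _ ≤
            8 / 3 * (‖e‖ ^ 2 / ρ ^ 2) * ((2 * ρ) ^ 2 * √(2 * ρ)) := by
            gcongr
        _ = _ := by field_simp; ring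
    have s2 : √(2 * ρ) = √2 * √ρ := Real.sqrt_mul (by norm_num) _
    have s3 : 14 / 10 ≤ √2 := Real.le_sqrt_of_sq_le (by norm_num)
    have s4 := mul_le_mul_of_nonneg_right s3 (Real.sqrt_nonneg ρ)
    have : 14 * √ρ + 4 * √(2 * ρ) ≤ 14 * √(2 * ρ) := by rw [s2]; linarith
    have p := mul_le_mul_of_nonneg_left this (show 0 ≤ 8 / 3 * ‖e‖ ^ 2 by positivity)
    linarith

lemma integral_logDiff_core {S : Set ℂ} (hS : MeasurableSet S) {e : ℂ} (he : ‖e‖ ≤ 1 / 10 ^ 90)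
    (hvol : ∀ t, ‖e‖ ≤ t → volume.real (S ∩ ball 0 t) ≤ t ^ 2 * √t) :
    ∫ v in S ∩ ball 0 (2 * ‖e‖), |logDiff 0 e v| ≤ 1 / 100 * ‖e‖ ^ 2 := by
  have hm : MeasurableSet (S ∩ ball (0:ℂ) (2 * ‖e‖)) := hS.inter measurableSet_ball
  have hp := norm_nonneg e
  have k := abs_integral_logDiff_le hm (ne_top_of_le_ne_top (volume_ball_ne_top 0 _)
    (measure_mono Set.inter_subset_right)) (f := fun v => (SignType.sign (logDiff 0 e v) : ℝ))
    (c := 1) (b := √‖e‖ * (1 / 10 ^ 10)) zero_le_one (fun v _ => by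
      rcases lt_trichotomy (logDiff 0 e v) 0 with q | q | q <;> simp [q]) (by positivity) (by
      have q1 := hvol (2 * ‖e‖) (by linarith)
      have q2 : √(2 * ‖e‖) ≤ 1 / 10 ^ 44 := by
        rw [Real.sqrt_le_left (by norm_num)]; linarith
      have q3 : (√‖e‖ * (1 / 10 ^ 10)) ^ 4 = ‖e‖ ^ 2 * (1 / 10 ^ 40) := by
        rw [mul_pow, show (4:ℕ) = 2 * 2 by norm_num, pow_mul, Real.sq_sqrt hp]; norm_num
      rw [q3]
      calc _ ≤ (2 * ‖e‖) ^ 2 * (1 / 10 ^ 44) := q1.trans (by gcongr)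
        _ ≤ _ := by linarith [sq_nonneg ‖e‖]) 0 e
  have e1 : ∀ v, (SignType.sign (logDiff 0 e v) : ℝ) * logDiff 0 e v = |logDiff 0 e v| :=
    fun v => sign_mul_self _
  simp only [e1] at k
  refine (le_abs_self _).trans (k.trans ?_)
  have : ‖e‖ * √‖e‖ * (√‖e‖ * (1 / 10 ^ 10)) = ‖e‖ ^ 2 * (1 / 10 ^ 10) := by
    linear_combination ‖e‖ * (1 / 10 ^ 10) * Real.mul_self_sqrt hp
  rw [this]
  linarith [sq_nonneg ‖e‖]

/-- Thin sets near the boundary contribute little to second differences. -/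
lemma integral_abs_logDiff_thin {S : Set ℂ} (hS : MeasurableSet S) {e : ℂ} (he0 : e ≠ 0)
    (he : ‖e‖ ≤ 1 / 10 ^ 90) (hSr : S ⊆ ball 0 (1 / 10 ^ 8))
    (hvol : ∀ t, ‖e‖ ≤ t → t ≤ 1 / 10 ^ 8 → volume.real (S ∩ ball 0 t) ≤ t ^ 2 * √t) :
    ∫ v in S, |logDiff 0 e v| ≤ 1 / 10 * ‖e‖ ^ 2 := by
  have hp : 0 < ‖e‖ := norm_pos_iff.2 he0
  have hvol' : ∀ t, ‖e‖ ≤ t → volume.real (S ∩ ball 0 t) ≤ t ^ 2 * √t := by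
    intro t ht
    rcases le_total t (1 / 10 ^ 8) with hc | hc
    · exact hvol t ht hc
    · have : S ∩ ball 0 t = S ∩ ball 0 (1 / 10 ^ 8) := by
        rw [Set.inter_eq_left.2 hSr, Set.inter_eq_left.2 (hSr.trans (ball_subset_ball hc))]
      rw [this]
      refine (hvol _ (by linarith) le_rfl).trans ?_
      gcongr
  obtain ⟨n, hn1, hn2⟩ := exists_nat_pow_near (x := 1 / 10 ^ 8 / (2 * ‖e‖)) (y := (2:ℝ))
    (by rw [le_div_iff₀ (by positivity)]; linarith) (by norm_num)
  rw [div_lt_iff₀ (by positivity)] at hn2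
  rw [le_div_iff₀ (by positivity)] at hn1
  have k1 := integral_logDiff_annulus he0 hS hvol' (n + 1)
  have k2 := integral_logDiff_core hS he hvol'
  set ρ := 2 ^ (n + 1) * (2 * ‖e‖) with hρ
  have hρ2 : ρ ≤ 2 / 10 ^ 8 := by rw [hρ, pow_succ]; linarith
  have hρ3 : 2 * ‖e‖ ≤ ρ := by linarith
  have dec : S = (S ∩ ball 0 (2 * ‖e‖)) ∪ (S ∩ (ball 0 ρ \ ball 0 (2 * ‖e‖))) := by
    ext v
    simp only [Set.mem_inter_iff, Set.mem_sdiff, mem_ball_zero_iff, Set.mem_union]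
    constructor
    · intro hv
      have := mem_ball_zero_iff.1 (hSr hv)
      have : ‖v‖ < ρ := by linarith
      tauto
    · tauto
  have dis : Disjoint (S ∩ ball (0:ℂ) (2 * ‖e‖)) (S ∩ (ball 0 ρ \ ball 0 (2 * ‖e‖))) :=
    Set.disjoint_left.2 fun v hv hv' => hv'.2.2 hv.2
  have m2 : MeasurableSet (S ∩ (ball (0:ℂ) ρ \ ball 0 (2 * ‖e‖))) :=
    hS.inter (measurableSet_ball.diff measurableSet_ball)
  have hlog : IntegrableOn (fun v => |logDiff 0 e v|) S :=
    (integrableOn_logDiff hS (hSr.trans (ball_subset_ball (by norm_num))) 0 e).abs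
  have s : √ρ ≤ 2 / 10 ^ 4 := by
    rw [Real.sqrt_le_left (by norm_num)]; linarith
  rw [dec, setIntegral_union dis m2 (hlog.mono_set Set.inter_subset_left)
    (hlog.mono_set Set.inter_subset_left)]
  have k3 : 8 / 3 * ‖e‖ ^ 2 * (14 * √ρ) ≤ 8 / 3 * ‖e‖ ^ 2 * (14 * (2 / 10 ^ 4)) := by gcongr
  linarith [sq_nonneg ‖e‖]

section
variable {σ : ℝ} {D : Set ℂ}

lemma badSet_inter_ball_subset (E : Set ℂ) (r t : ℝ) : badSet E r ∩ ball 0 t ⊆ badSet E t :=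
  fun _ hv => ⟨hv.2, hv.1.2⟩

lemma norm_direction {m : ℂ} (hm : m ≠ 0) : ‖m / (‖m‖ : ℂ)‖ = 1 := by
  rw [norm_div, Complex.norm_real, norm_norm, div_self (norm_ne_zero_iff.2 hm)]

lemma norm_add_direction_mul {m : ℂ} (hm : m ≠ 0) (z : ℂ) :
    ‖m + m / (‖m‖ : ℂ) * z‖ = ‖(‖m‖ : ℂ) + z‖ := by
  have h0 : (‖m‖ : ℂ) ≠ 0 := by exact_mod_cast norm_ne_zero_iff.2 hm
  have e : m + m / (‖m‖ : ℂ) * z = m / (‖m‖ : ℂ) * ((‖m‖ : ℂ) + z) := by field_simp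
  rw [e, norm_mul, norm_direction hm, one_mul]

lemma norm_real_add_sq (R : ℝ) (z : ℂ) : ‖(R : ℂ) + z‖ ^ 2 = R ^ 2 + 2 * R * z.re + ‖z‖ ^ 2 := by
  rw [Complex.sq_norm, Complex.sq_norm, Complex.normSq_apply, Complex.normSq_apply]
  simp
  ring

/-- The disc with a given boundary point is nearly half of any small ball around that point. -/
lemma volume_badSet_disc {m : ℂ} (h1 : 9 / 10 ≤ ‖m‖) {t : ℝ} (ht0 : 0 ≤ t) (ht : t ≤ 1 / 10 ^ 8) :
    volume.real (badSet {v | m + v ∈ ball 0 ‖m‖} t) ≤ t ^ 2 * √t := by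
  have hm0 : m ≠ 0 := fun hc => by rw [hc, norm_zero] at h1; linarith
  have hme : MeasurableSet {v : ℂ | m + v ∈ ball (0:ℂ) ‖m‖} :=
    (measurable_const_add m) measurableSet_ball
  have key : ∀ z : ℂ, m / (‖m‖ : ℂ) * z ∈ badSet {v | m + v ∈ ball 0 ‖m‖} t → |z.re| ≤ t ^ 2 := by
    rintro z ⟨hz, hiff⟩
    rw [mem_ball_zero_iff, norm_mul, norm_direction hm0, one_mul] at hz
    have hz2 : ‖z‖ ^ 2 ≤ t ^ 2 := by gcongr
    have a1 : m / (‖m‖ : ℂ) * z ∈ {v | m + v ∈ ball 0 ‖m‖} ↔ 2 * ‖m‖ * z.re + ‖z‖ ^ 2 < 0 := by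
      have : m / (‖m‖ : ℂ) * z ∈ {v | m + v ∈ ball 0 ‖m‖} ↔ ‖m + m / (‖m‖ : ℂ) * z‖ < ‖m‖ :=
        mem_ball_zero_iff
      rw [this, norm_add_direction_mul hm0, ← sq_lt_sq₀ (norm_nonneg _) (norm_nonneg _),
        norm_real_add_sq]
      constructor <;> intro <;> linarith
    have a2 : -(m / (‖m‖ : ℂ) * z) ∈ {v | m + v ∈ ball 0 ‖m‖} ↔
        -(2 * ‖m‖ * z.re) + ‖z‖ ^ 2 < 0 := by
      have : -(m / (‖m‖ : ℂ) * z) ∈ {v | m + v ∈ ball 0 ‖m‖} ↔ ‖m + m / (‖m‖ : ℂ) * (-z)‖ <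
          ‖m‖ := by
        rw [mul_neg]; exact mem_ball_zero_iff
      rw [this, norm_add_direction_mul hm0, ← sq_lt_sq₀ (norm_nonneg _) (norm_nonneg _),
        norm_real_add_sq, norm_neg, Complex.neg_re]
      constructor <;> intro <;> linarith
    rw [a1, a2] at hiff
    have n0 := sq_nonneg ‖z‖
    have c1 : ¬ (2 * ‖m‖ * z.re + ‖z‖ ^ 2 < 0) := fun hc => by linarith [hiff.1 hc]
    have c2 : ¬ (-(2 * ‖m‖ * z.re) + ‖z‖ ^ 2 < 0) := fun hc => by linarith [hiff.2 hc]
    rw [abs_le]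
    constructor
    · by_contra! hc
      nlinarith
    · by_contra! hc
      nlinarith
  have v := volume_le_of_slices_dir (measurableSet_badSet hme t) (norm_direction hm0) ht0
    (l := 2 * t ^ 2) (by positivity) (fun v hv => hv.1) (fun z w hz hw _ _ => by
      have := abs_le.1 (key z hz)
      have := abs_le.1 (key w hw)
      linarith)
  have hs : √t ≤ 1 / 10 ^ 4 := by
    rw [show (1 / 10 ^ 4 : ℝ) = √(1 / 10 ^ 8) by
      rw [show (1 / 10 ^ 8 : ℝ) = (1 / 10 ^ 4) ^ 2 by norm_num, Real.sqrt_sq (by norm_num)]]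
    exact Real.sqrt_le_sqrt ht
  have e := Real.mul_self_sqrt ht0
  have s0 := Real.sqrt_nonneg t
  refine v.trans ?_
  calc 2 * t * (2 * t ^ 2) = t ^ 2 * (4 * (√t * √t)) := by rw [e]; ring
    _ ≤ t ^ 2 * √t := by gcongr; nlinarith

/-- The norm grows almost linearly along the radial direction. -/
lemma norm_real_add_sub_ge {R t : ℝ} (h1 : 9 / 10 ≤ R) (ht : t ≤ 1 / 100)
    {z w : ℂ} (hz : ‖z‖ ≤ t) (hw : ‖w‖ ≤ t) (him : z.im = w.im) (hre : z.re ≤ w.re) :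
    ‖(R : ℂ) + z‖ ≤ ‖(R : ℂ) + w‖ ∧
      9 / 10 * (w.re - z.re) ≤ ‖(R : ℂ) + w‖ - ‖(R : ℂ) + z‖ := by
  have e1 : ‖(R : ℂ) + z‖ ^ 2 = (R + z.re) ^ 2 + z.im ^ 2 := by
    rw [Complex.sq_norm, Complex.normSq_apply]; simp; ring
  have e2 : ‖(R : ℂ) + w‖ ^ 2 = (R + w.re) ^ 2 + w.im ^ 2 := by
    rw [Complex.sq_norm, Complex.normSq_apply]; simp; ring
  rw [him] at e1
  have b1 := norm_add_le (R : ℂ) z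
  have b2 := norm_add_le (R : ℂ) w
  rw [Complex.norm_real, Real.norm_eq_abs, abs_of_nonneg (by linarith)] at b1 b2
  have c1 := abs_le.1 ((Complex.abs_re_le_norm z).trans hz)
  have c2 := abs_le.1 ((Complex.abs_re_le_norm w).trans hw)
  have n1 := norm_nonneg ((R : ℂ) + z)
  have n2 := norm_nonneg ((R : ℂ) + w)
  have e : (‖(R : ℂ) + w‖ - ‖(R : ℂ) + z‖) * (‖(R : ℂ) + w‖ + ‖(R : ℂ) + z‖) =
      (w.re - z.re) * (2 * R + w.re + z.re) := by linear_combination e2 - e1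
  have k : 0 ≤ (w.re - z.re) * (2 * R + w.re + z.re) :=
    mul_nonneg (by linarith) (by linarith)
  have le : ‖(R : ℂ) + z‖ ≤ ‖(R : ℂ) + w‖ := by
    by_contra! hc
    nlinarith
  refine ⟨le, ?_⟩
  by_contra! hc
  have s : ‖(R : ℂ) + w‖ + ‖(R : ℂ) + z‖ ≤ 2 * R + 2 * t := by linarith
  have k2 : (‖(R : ℂ) + w‖ - ‖(R : ℂ) + z‖) * (‖(R : ℂ) + w‖ + ‖(R : ℂ) + z‖) ≤
      (‖(R : ℂ) + w‖ - ‖(R : ℂ) + z‖) * (2 * R + 2 * t) :=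
    mul_le_mul_of_nonneg_left s (by linarith)
  have k3 : (‖(R : ℂ) + w‖ - ‖(R : ℂ) + z‖) * (2 * R + 2 * t) <
      9 / 10 * (w.re - z.re) * (2 * R + 2 * t) :=
    mul_lt_mul_of_pos_right hc (by linarith [norm_nonneg z])
  nlinarith

/-- A core is nearly half of small balls around almost touching points. -/
lemma volume_badSet_core (h : SmallScale σ) (hD : IsCore σ D) {m : ℂ}
    (h1 : 1 - bandWidth σ ≤ ‖m‖) (h2 : ‖m‖ ≤ 1 + bandWidth σ) {t : ℝ} (ht0 : 0 ≤ t)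
    (ht : t ≤ 1 / 10 ^ 8) (hu0 : coreExcess σ D m ≤ 0)
    (hu : -(1 / 100 * (t * √t)) ≤ coreExcess σ D m) :
    volume.real (badSet {v | m + v ∈ D} t) ≤ t ^ 2 * √t := by
  have d := h.bandWidth_le_coarse
  have hm0 : m ≠ 0 := fun hc => by rw [hc, norm_zero] at h1; linarith
  have hme : MeasurableSet {v : ℂ | m + v ∈ D} := (measurable_const_add m) hD.inBand.meas
  have ts : 0 ≤ t * √t := by positivity
  have near : ∀ v : ℂ, ‖v‖ < t → ‖m + v‖ ≤ 8 := fun v hv => by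
    linarith [norm_add_le m v]
  have key : ∀ v ∈ badSet {v | m + v ∈ D} t, |coreExcess σ D (m + v)| ≤ 3 / 100 * (t * √t) := by
    rintro v ⟨hv, hiff⟩
    rw [mem_ball_zero_iff] at hv
    have hiff' : m + v ∈ D ↔ m + -v ∈ D := hiff
    rw [hD.mem_iff_of_norm_le h (near v hv),
      hD.mem_iff_of_norm_le h (near (-v) (by rwa [norm_neg])), ← sub_eq_add_neg] at hiff'
    have k := abs_secondDiff_coreExcess_le h hD.inBand h1 h2 (v := v) (by linarith)
    have kt : ‖v‖ * √‖v‖ ≤ t * √t := by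
      have := Real.sqrt_le_sqrt hv.le
      gcongr
    unfold secondDiff at k
    have k' := abs_le.1 k
    rw [abs_le]
    by_cases c : 0 < coreExcess σ D (m + v)
    · have := hiff'.1 c
      constructor <;> linarith
    · have c2 : ¬ 0 < coreExcess σ D (m - v) := fun hc => c (hiff'.2 hc)
      constructor <;> linarith
  have v := volume_le_of_slices_dir (measurableSet_badSet hme t) (norm_direction hm0) ht0
    (l := 1 / 2 * (t * √t)) (by positivity) (fun v hv => hv.1) (fun z w hz hw him hre => by
      have a1 := abs_le.1 (key _ hz)
      have a2 := abs_le.1 (key _ hw)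
      have nz := mem_ball_zero_iff.1 hz.1
      have nw := mem_ball_zero_iff.1 hw.1
      have m1 := near _ nw
      rw [norm_mul, norm_direction hm0, one_mul] at nz nw
      have g := norm_real_add_sub_ge (R := ‖m‖) (by linarith) (by linarith) nz.le nw.le him hre
      rw [← norm_add_direction_mul hm0, ← norm_add_direction_mul hm0] at g
      have lo : 1 / 2 ≤ ‖m + m / (‖m‖ : ℂ) * w‖ := by
        have := norm_sub_le (m + m / (‖m‖ : ℂ) * w) (m / (‖m‖ : ℂ) * w)
        rw [add_sub_cancel_right, norm_mul (m / (‖m‖ : ℂ)) w, norm_direction hm0, one_mul] at this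
        linarith
      have dec := coreExcess_decay h hD.inBand g.1 lo m1
      have e : ‖m + m / (‖m‖ : ℂ) * z - (m + m / (‖m‖ : ℂ) * w)‖ = w.re - z.re := by
        rw [show m + m / (‖m‖ : ℂ) * z - (m + m / (‖m‖ : ℂ) * w) = m / (‖m‖ : ℂ) * (z - w) by ring,
          norm_mul, norm_direction hm0, one_mul]
        have : z - w = ((z.re - w.re : ℝ) : ℂ) := by
          apply Complex.ext <;> simp [him]
        rw [this, Complex.norm_real, Real.norm_eq_abs, abs_sub_comm, abs_of_nonneg (by linarith)]
      rw [e] at dec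
      norm_num at dec g ⊢
      linarith)
  refine v.trans (le_of_eq ?_)
  ring

end

section
variable {σ : ℝ} {D : Set ℂ}

lemma setIntegral_inter_ball_eq (Z : Set ℂ) (m e : ℂ) (r : ℝ) :
    ∫ w in Z ∩ ball m r, logDiff m e w = ∫ v in ball 0 r ∩ {v | m + v ∈ Z}, logDiff 0 e v := by
  have k := (measurePreserving_add_left (volume : Measure ℂ) m).setIntegral_preimage_emb
    (measurableEmbedding_addLeft m) (logDiff m e) (Z ∩ ball m r)
  rw [← k]
  simp only [logDiff_add]
  congr 2
  ext v
  constructor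
  · rintro ⟨a, b⟩
    refine ⟨?_, a⟩
    rw [mem_ball_iff_norm] at b
    rw [mem_ball_zero_iff]
    simpa using b
  · rintro ⟨a, b⟩
    refine ⟨b, ?_⟩
    rw [mem_ball_zero_iff] at a
    show m + v ∈ ball m r
    rw [mem_ball_iff_norm]
    simpa using a

/-- Near an almost touching point, a core and the disc through that point have almost the same
second difference integrals. -/
lemma abs_integral_logDiff_near_le (h : SmallScale σ) (hD : IsCore σ D) {m e : ℂ}
    (h1 : 1 - bandWidth σ ≤ ‖m‖) (h2 : ‖m‖ ≤ 1 + bandWidth σ) (he0 : e ≠ 0) (he : ‖e‖ ≤ 1 / 10 ^ 90)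
    (hu0 : coreExcess σ D m ≤ 0) (hu : -(1 / 100 * (‖e‖ * √‖e‖)) ≤ coreExcess σ D m) :
    |(∫ w in D ∩ ball m (1 / 10 ^ 8), logDiff m e w) -
      ∫ w in ball 0 ‖m‖ ∩ ball m (1 / 10 ^ 8), logDiff m e w| ≤ 1 / 10 * ‖e‖ ^ 2 := by
  have d := h.bandWidth_le_coarse
  have hi : IntegrableOn (logDiff 0 e) (ball 0 (1 / 10 ^ 8)) :=
    integrableOn_logDiff measurableSet_ball (ball_subset_ball (by norm_num)) 0 e
  have mD : MeasurableSet {v : ℂ | m + v ∈ D} := (measurable_const_add m) hD.inBand.meas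
  have mB : MeasurableSet {v : ℂ | m + v ∈ ball (0:ℂ) ‖m‖} :=
    (measurable_const_add m) measurableSet_ball
  have kD := abs_two_integral_sub_le mD (logDiff_zero_neg e) hi
  have kB := abs_two_integral_sub_le mB (logDiff_zero_neg e) hi
  have tD := integral_abs_logDiff_thin (measurableSet_badSet mD (1 / 10 ^ 8)) he0 he
    (fun v hv => hv.1) fun t ht1 ht2 => by
      refine (measureReal_mono (badSet_inter_ball_subset _ _ t)
        (ne_top_of_le_ne_top (volume_ball_ne_top 0 t) (measure_mono fun v hv => hv.1))).trans ?_
      refine volume_badSet_core h hD h1 h2 ((norm_nonneg e).trans ht1) ht2 hu0 (le_trans ?_ hu)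
      have := Real.sqrt_le_sqrt ht1
      have t0 : 0 ≤ t := (norm_nonneg e).trans ht1
      rw [neg_le_neg_iff]
      gcongr
  have tB := integral_abs_logDiff_thin (measurableSet_badSet mB (1 / 10 ^ 8)) he0 he
    (fun v hv => hv.1) fun t ht1 ht2 => by
      refine (measureReal_mono (badSet_inter_ball_subset _ _ t)
        (ne_top_of_le_ne_top (volume_ball_ne_top 0 t) (measure_mono fun v hv => hv.1))).trans ?_
      exact volume_badSet_disc (by linarith) ((norm_nonneg e).trans ht1) ht2
  rw [setIntegral_inter_ball_eq, setIntegral_inter_ball_eq]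
  have a := abs_le.1 (kD.trans tD)
  have b := abs_le.1 (kB.trans tB)
  rw [abs_le]
  constructor <;> linarith

/-- The second difference integrals of sets in the band almost agree away from the base point. -/
lemma abs_integral_logDiff_far_le (h : SmallScale σ) {D' : Set ℂ} (hD : InBand σ D)
    (hD' : InBand σ D') {m e : ℂ} (he : ‖e‖ ≤ 1 / 10 ^ 90) :
    |(∫ w in D \ ball m (1 / 10 ^ 8), logDiff m e w) -
      ∫ w in D' \ ball m (1 / 10 ^ 8), logDiff m e w| ≤ 1 / 10 * ‖e‖ ^ 2 := by
  have half : ∀ {A B : Set ℂ}, InBand σ A → InBand σ B →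
      |∫ w in (A \ ball m (1 / 10 ^ 8)) \ (B \ ball m (1 / 10 ^ 8)), logDiff m e w| ≤
        1 / 20 * ‖e‖ ^ 2 := by
    intro A B hA hB
    have sub : (A \ ball m (1 / 10 ^ 8)) \ (B \ ball m (1 / 10 ^ 8)) ⊆ band σ := by
      rintro w ⟨⟨w1, w2⟩, w3⟩
      exact hA.sdiff_subset hB ⟨w1, fun hc => w3 ⟨hc, w2⟩⟩
    have hv := ne_top_of_le_ne_top (band_ne_top σ) (measure_mono sub)
    have k := abs_setIntegral_le hv (f := logDiff m e) (c := 8 / 3 * 10 ^ 16 * ‖e‖ ^ 2) (by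
      rintro w ⟨⟨w1, w2⟩, w3⟩
      rw [mem_ball_iff_norm, not_lt, norm_sub_rev] at w2
      have hne : m ≠ w := fun hc => by
        rw [hc, sub_self, norm_zero] at w2; norm_num at w2
      have f := abs_logDiff_le_of_far (v := e) hne (by norm_num at he w2 ⊢; linarith)
      refine f.trans ?_
      have : ‖e‖ ^ 2 / ‖m - w‖ ^ 2 ≤ ‖e‖ ^ 2 / (1 / 10 ^ 8) ^ 2 := by gcongr
      refine (mul_le_mul_of_nonneg_left this (by norm_num)).trans (le_of_eq ?_)
      norm_num
      ring)
    have v := (measureReal_mono sub (band_ne_top σ)).trans h.volume_band_le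
    refine k.trans ?_
    calc 8 / 3 * 10 ^ 16 * ‖e‖ ^ 2 * _ ≤ 8 / 3 * 10 ^ 16 * ‖e‖ ^ 2 * (1 / 10 ^ 45) ^ 4 := by
          gcongr
      _ = ‖e‖ ^ 2 * (8 / 3 * 10 ^ 16 * (1 / 10 ^ 45) ^ 4) := by ring
      _ ≤ ‖e‖ ^ 2 * (1 / 20) := by gcongr; norm_num
      _ = _ := by ring
  have m1 : MeasurableSet (ball m (1 / 10 ^ 8)) := measurableSet_ball
  rw [setIntegral_sub_eq (hD.meas.diff m1) (hD'.meas.diff m1)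
    (integrableOn_logDiff (hD.meas.diff m1) (Set.sdiff_subset.trans (hD.subset_two h)) m e)
    (integrableOn_logDiff (hD'.meas.diff m1) (Set.sdiff_subset.trans (hD'.subset_two h)) m e)]
  have a := abs_le.1 (half hD hD')
  have b := abs_le.1 (half hD' hD)
  rw [abs_le]
  constructor <;> linarith

/-- Replacing the density by its value at the base point. -/
lemma abs_integral_rho_sub_logDiff_le (h : SmallScale σ) (hDm : MeasurableSet D) (hD : D ⊆ ball 0 2)
    {m e : ℂ} (hm : ‖m‖ ≤ 2) (he : ‖e‖ ≤ 1 / 10 ^ 90) :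
    |∫ w in D, (rho σ w - rho σ m) * logDiff m e w| ≤ 1 / 10 * ‖e‖ ^ 2 := by
  have hσ := h.pos
  have hσ2 := h.le
  have p := norm_nonneg e
  have hv := volume_ne_top_of_subset hD
  have lip : ∀ w ∈ D, |rho σ w - rho σ m| ≤ 4 * (σ * ‖w - m‖) := fun w hw =>
    abs_cube_sub_le hσ (h.mul_norm_mem hD hw) (h.mul_norm_le (by linarith))
  have ii : IntegrableOn (fun w => (rho σ w - rho σ m) * logDiff m e w) D := by
    have := (integrableOn_rho_mul h hDm hD (integrableOn_logDiff hDm hD m e)).sub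
      ((integrableOn_logDiff hDm hD m e).const_mul (rho σ m))
    refine this.congr (ae_of_all _ fun w => ?_)
    simp only [Pi.sub_apply]
    ring
  have mb : MeasurableSet (ball m (2 * ‖e‖)) := measurableSet_ball
  have sp := integral_inter_add_sdiff mb ii
  have near := abs_integral_logDiff_le (hDm.inter mb)
    (ne_top_of_le_ne_top hv (measure_mono Set.inter_subset_left)) (c := 8 * (σ * ‖e‖)) (b := 2)
    (f := fun w => rho σ w - rho σ m) (by positivity) (fun w hw => by
      refine (lip w hw.1).trans ?_
      have := mem_ball_iff_norm.1 hw.2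
      nlinarith) (by norm_num) (by
      refine (measureReal_mono Set.inter_subset_right (volume_ball_ne_top m _)).trans ?_
      rw [volume_real_ball _ (by positivity)]
      have := pi_lt_four
      have : (2 * ‖e‖) ^ 2 ≤ 1 := by
        have : 2 * ‖e‖ ≤ 1 := by norm_num at he ⊢; linarith
        nlinarith
      nlinarith [pi_pos]) m e
  have far : |∫ w in D \ ball m (2 * ‖e‖), (rho σ w - rho σ m) * logDiff m e w| ≤
      500 * σ * ‖e‖ ^ 2 := by
    have mf := hDm.diff mb
    have vf := ne_top_of_le_ne_top hv (measure_mono (Set.sdiff_subset (t := ball m (2 * ‖e‖))))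
    have is := integrableOn_sing m mf vf
    have ib : IntegrableOn (fun w => 11 * σ * ‖e‖ ^ 2 * (sing m w + 1)) (D \ ball m (2 * ‖e‖)) :=
      (is.add (integrableOn_const vf)).const_mul _
    rw [← Real.norm_eq_abs]
    refine (norm_integral_le_of_norm_le ib ?_).trans ?_
    · filter_upwards [ae_ne m (D \ ball m (2 * ‖e‖)), ae_restrict_mem mf] with w hne hw
      have w2 := hw.2
      rw [mem_ball_iff_norm, not_lt, norm_sub_rev] at w2
      rw [Real.norm_eq_abs, abs_mul]
      have np : 0 < ‖m - w‖ := norm_pos_iff.2 (sub_ne_zero.2 hne)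
      have l := lip w hw.1
      rw [norm_sub_rev] at l
      have f := abs_logDiff_le_of_far hne w2
      have g := inv_le_sing hne
      calc |rho σ w - rho σ m| * |logDiff m e w| ≤
          4 * (σ * ‖m - w‖) * (8 / 3 * (‖e‖ ^ 2 / ‖m - w‖ ^ 2)) := by gcongr
        _ = 32 / 3 * (σ * ‖e‖ ^ 2) * (1 / ‖m - w‖) := by field_simp; ring
        _ ≤ 11 * (σ * ‖e‖ ^ 2) * (sing m w + 1) := by
          have := sing_nonneg m w
          gcongr
          norm_num
        _ = _ := by ring
    · rw [integral_const_mul, integral_add is (integrableOn_const vf), integral_const,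
        measureReal_restrict_apply_univ, smul_eq_mul, mul_one]
      have v0 : volume.real (D \ ball m (2 * ‖e‖)) ≤ 4 * π :=
        (measureReal_mono Set.sdiff_subset hv).trans (volume_real_le_of_subset hD)
      have hp := pi_lt_d2
      have s := (integral_sing_le m mf vf)
      have q := rpow_quarter_le (b := 2) measureReal_nonneg (by norm_num)
        (v0.trans (by norm_num at hp ⊢; linarith))
      have : (∫ w in D \ ball m (2 * ‖e‖), sing m w) + volume.real (D \ ball m (2 * ‖e‖)) ≤ 45 := by
        norm_num at hp
        linarith
      calc 11 * σ * ‖e‖ ^ 2 * _ ≤ 11 * σ * ‖e‖ ^ 2 * 45 := by gcongr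
        _ ≤ _ := by nlinarith [mul_nonneg hσ.le (sq_nonneg ‖e‖)]
  rw [← sp]
  refine (abs_add_le _ _).trans ((add_le_add near far).trans ?_)
  have s1 : √‖e‖ ≤ 1 := Real.sqrt_le_one.2 (he.trans (by norm_num))
  calc 8 * (σ * ‖e‖) * (112 * (‖e‖ * √‖e‖ * 2)) + 500 * σ * ‖e‖ ^ 2
      ≤ 8 * (σ * ‖e‖) * (112 * (‖e‖ * 1 * 2)) + 500 * σ * ‖e‖ ^ 2 := by gcongr
    _ = 2292 * σ * ‖e‖ ^ 2 := by ring
    _ ≤ _ := by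
      gcongr
      norm_num at hσ2 ⊢
      linarith

lemma norm_sq_add_sub_le_of_coreExcess_le (h : SmallScale σ) (hD : InBand σ D) {m v : ℂ}
    (h2 : ‖m‖ ≤ 2) (hm : 1 / 2 ≤ ‖m‖)
    (hs : ‖m + v‖ ≤ 2) (hle : coreExcess σ D m ≤ coreExcess σ D (m + v)) :
    ‖m + v‖ ^ 2 - ‖m‖ ^ 2 ≤ 1 / 10 ^ 30 * ‖v‖ := by
  rcases le_total ‖m + v‖ ‖m‖ with hc | hc
  · have : ‖m + v‖ ^ 2 ≤ ‖m‖ ^ 2 := by gcongr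
    have : 0 ≤ 1 / 10 ^ 30 * ‖v‖ := by positivity
    linarith
  · have k := coreExcess_decay h hD hc (by linarith) (by linarith)
    rw [show m - (m + v) = -v by ring, norm_neg] at k
    have a : ‖m + v‖ - ‖m‖ ≤ ‖v‖ * (2 / 10 ^ 35) := by norm_num at k ⊢; linarith
    calc ‖m + v‖ ^ 2 - ‖m‖ ^ 2 = (‖m + v‖ - ‖m‖) * (‖m + v‖ + ‖m‖) := by ring
      _ ≤ ‖v‖ * (2 / 10 ^ 35) * 4 :=
        mul_le_mul a (by linarith) (by positivity) (by positivity)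
      _ = ‖v‖ * (8 / 10 ^ 35) := by ring
      _ ≤ ‖v‖ * (1 / 10 ^ 30) := mul_le_mul_of_nonneg_left (by norm_num) (norm_nonneg v)
      _ = _ := by ring

lemma integral_logDiff_le (h : SmallScale σ) (hD : IsCore σ D) {m e : ℂ}
    (h1 : 1 - bandWidth σ ≤ ‖m‖) (h2 : ‖m‖ ≤ 1 + bandWidth σ) (he0 : e ≠ 0) (he : ‖e‖ ≤ 1 / 10 ^ 90)
    (hu0 : coreExcess σ D m ≤ 0) (hp : 0 < coreExcess σ D (m + e))
    (hq : coreExcess σ D m ≤ coreExcess σ D (m - e)) :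
    ∫ w in D, logDiff m e w ≤ -(5 * ‖e‖ ^ 2) := by
  have d := h.bandWidth_le_coarse
  have hσ := h.pos
  have hσ2 := h.le
  have n0 : 0 < ‖e‖ := norm_pos_iff.2 he0
  have he3 : ‖e‖ ≤ 1 / 10 ^ 8 := he.trans (by norm_num)
  have he4 : ‖e‖ ≤ 1 := he.trans (by norm_num)
  have hD2 := hD.inBand.subset_two h
  have np := norm_add_le m e
  have nq := norm_sub_le m e
  have rough := abs_le.1 (abs_secondDiff_coreExcess_le h hD.inBand h1 h2 he3)
  have hlow : -(1 / 100 * (‖e‖ * √‖e‖)) ≤ coreExcess σ D m := by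
    unfold secondDiff at rough
    linarith
  have near := abs_le.1 (abs_integral_logDiff_near_le h hD h1 h2 he0 he hu0 hlow)
  have hB := InBand.ball h1 h2
  have far := abs_le.1 (abs_integral_logDiff_far_le h hD.inBand hB (m := m) he)
  have mb : MeasurableSet (ball m (1 / 10 ^ 8)) := measurableSet_ball
  have sD := integral_inter_add_sdiff mb (integrableOn_logDiff hD.inBand.meas hD2 m e)
  have sB := integral_inter_add_sdiff mb (integrableOn_logDiff hB.meas (hB.subset_two h) m e)
  rw [← secondDiff_discPot_eq (by linarith) m e] at sB
  have disc := (secondDiff_discPot (m := m) (by linarith) e).2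
  have tp := norm_sq_add_sub_le_of_coreExcess_le h hD.inBand (m := m) (v := e) (by linarith)
    (by linarith) (by linarith) (hu0.trans hp.le)
  have tq := norm_sq_add_sub_le_of_coreExcess_le h hD.inBand (m := m) (v := -e) (by linarith)
    (by linarith) (by rw [← sub_eq_add_neg]; linarith) (by rwa [← sub_eq_add_neg])
  rw [← sub_eq_add_neg, norm_neg] at tq
  have par := norm_sq_add_sub m e
  have sq : ∀ x : ℝ, x ≤ 1 / 10 ^ 30 * ‖e‖ → -(1 / 10 ^ 30 * ‖e‖) ≤ x →
      x ^ 2 ≤ 1 / 100 * ‖e‖ ^ 2 := by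
    intro x hx hx'
    calc x ^ 2 ≤ (1 / 10 ^ 30 * ‖e‖) ^ 2 := sq_le_sq' hx' hx
      _ = (1 / 10 ^ 30) ^ 2 * ‖e‖ ^ 2 := by ring
      _ ≤ _ := by gcongr; norm_num
  have e2 := sq_nonneg ‖e‖
  have qp := sq _ tp (by linarith)
  have qq := sq _ tq (by linarith)
  have := pi_gt_three
  have : 6 * ‖e‖ ^ 2 ≤ 2 * π * ‖e‖ ^ 2 := by gcongr; linarith
  linarith

/-- The excess is strictly midpoint concave at almost touching points. -/
lemma secondDiff_coreExcess_neg (h : SmallScale σ) (hD : IsCore σ D) {m e : ℂ}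
    (h1 : 1 - bandWidth σ ≤ ‖m‖) (h2 : ‖m‖ ≤ 1 + bandWidth σ) (he0 : e ≠ 0) (he : ‖e‖ ≤ 1 / 10 ^ 90)
    (hu0 : coreExcess σ D m ≤ 0) (hp : 0 < coreExcess σ D (m + e))
    (hq : coreExcess σ D m ≤ coreExcess σ D (m - e)) : secondDiff (coreExcess σ D) m e < 0 := by
  have d := h.bandWidth_le_coarse
  have hσ := h.pos
  have hσ2 := h.le
  have n0 : 0 < ‖e‖ := norm_pos_iff.2 he0
  have hD2 := hD.inBand.subset_two h
  have np := norm_add_le m e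
  have nq := norm_sub_le m e
  have he4 : ‖e‖ ≤ 1 := he.trans (by norm_num)
  have main := integral_logDiff_le h hD h1 h2 he0 he hu0 hp hq
  have dens := abs_le.1 (abs_integral_rho_sub_logDiff_le h hD.inBand.meas hD2 (m := m)
      (by linarith) he)
  have il := integrableOn_logDiff hD.inBand.meas hD2 m e
  have split : ∫ w in D, rho σ w * logDiff m e w =
      rho σ m * (∫ w in D, logDiff m e w) + ∫ w in D, (rho σ w - rho σ m) * logDiff m e w := by
    have e1 : (fun w => (rho σ w - rho σ m) * logDiff m e w) =
      fun w => rho σ w * logDiff m e w - rho σ m * logDiff m e w := by ext w; ring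
    rw [e1, integral_sub (integrableOn_rho_mul h hD.inBand.meas hD2 il) (il.const_mul _),
      integral_const_mul]
    ring
  have rm := (rho_bounds hσ (h.mul_norm_le (show ‖m‖ ≤ 16 by linarith))).1
  have cp := abs_le.1 (secondDiff_corrPot h hD.inBand.meas hD2 (m := m) (v := e) (by linarith)
    (by linarith) (by linarith))
  have mass := le_massRho h hD.inBand
  have pr := (secondDiff_profile h (M := massRho σ D) (by linarith) mass.2 (le_multA h hD.inBand)
    ((le_abs_self _).trans (abs_multA_le h hD2)) (abs_multB_le h hD.inBand) (m := m) (v := e)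
    (by linarith) (by linarith) (by linarith)).1
  rw [secondDiff_coreExcess_eq h hD.inBand (by linarith) (by linarith) (by linarith),
    secondDiff_logPot h hD.inBand.meas hD2, split]
  have f1 : rho σ m * (∫ w in D, logDiff m e w) ≤ -(3 * ‖e‖ ^ 2) := by nlinarith
  have f2 : 40000 * (σ * ‖e‖ ^ 2) ≤ ‖e‖ ^ 2 := by
    have : 40000 * σ ≤ 1 := by norm_num at hσ2 ⊢; linarith
    nlinarith
  have : 0 < ‖e‖ ^ 2 := by positivity
  linarith

lemma IsCore.convex (h : SmallScale σ) (hD : IsCore σ D) : Convex ℝ D := by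
  have d0 := h.bandWidth_pos
  have d1 := h.bandWidth_le
  have d2 := h.bandWidth_le_coarse
  have cb : Convex ℝ (ball (0:ℂ) (1 + bandWidth σ)) := convex_ball _ _
  rw [convex_iff_segment_subset]
  intro p hp q hq x hx
  by_contra hxD
  have inb : ∀ t ∈ Set.Icc (0:ℝ) 1, ‖p + (t:ℂ) * (q - p)‖ < 1 + bandWidth σ := by
    intro t ht
    have := cb.add_smul_sub_mem (hD.inBand.outer hp) (hD.inBand.outer hq) ht
    rwa [mem_ball_zero_iff, Complex.real_smul] at this
  have hc : ContinuousOn (fun t : ℝ => coreExcess σ D (p + (t:ℂ) * (q - p))) (Set.Icc 0 1) := by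
    refine (continuousOn_excess h hD.inBand (abs_multA_le' h (hD.inBand.subset_two h))
      (abs_multB_le' h hD.inBand)).comp (by fun_prop) fun t ht => ?_
    rw [mem_closedBall_zero_iff]
    linarith [inb t ht]
  obtain ⟨t, ht, hmin⟩ := isCompact_Icc.exists_isMinOn (Set.nonempty_Icc.2 zero_le_one) hc
  have hmin' : ∀ s ∈ Set.Icc (0:ℝ) 1,
      coreExcess σ D (p + (t:ℂ) * (q - p)) ≤
          coreExcess σ D (p + (s:ℂ) * (q - p)) := fun s hs => hmin hs
  have memD : ∀ s ∈ Set.Icc (0:ℝ) 1,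
      (p + (s:ℂ) * (q - p) ∈ D ↔ 0 < coreExcess σ D (p + (s:ℂ) * (q - p))) :=
    fun s hs => hD.mem_iff_of_norm_le h (by linarith [inb s hs])
  set m := p + (t:ℂ) * (q - p) with hm
  have hu0 : coreExcess σ D m ≤ 0 := by
    rw [segment_eq_image'] at hx
    obtain ⟨s, hs, rfl⟩ := hx
    simp only [Complex.real_smul] at hxD
    rw [memD s hs, not_lt] at hxD
    exact (hmin' s hs).trans hxD
  have hmD : m ∉ D := fun hc => hu0.not_gt ((memD t ht).1 hc)
  have hm1 : 1 - bandWidth σ ≤ ‖m‖ := by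
    by_contra! hc
    exact hmD (hD.inBand.inner (mem_ball_zero_iff.2 hc))
  have fin : ∀ e : ℂ, m + e ∈ D → (∃ s ∈ Set.Icc (0:ℝ) 1, m - e = p + (s:ℂ) * (q - p)) → False := by
    rintro e he ⟨s, hs, hse⟩
    have ne := mem_ball_zero_iff.1 (hD.inBand.outer he)
    have nm := inb s hs
    rw [← hse] at nm
    have hmin_s := hmin' s hs
    rw [← hse] at hmin_s
    have he0 : e ≠ 0 := fun hc => hmD (by rwa [hc, add_zero] at he)
    have par := norm_sq_add_sub m e
    have hsm : ‖e‖ ≤ 1 / 10 ^ 90 := by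
      refine (sq_le_sq₀ (norm_nonneg _) (by positivity)).1 ?_
      have a1 : ‖m + e‖ ^ 2 ≤ (1 + bandWidth σ) ^ 2 := by gcongr
      have a2 : ‖m - e‖ ^ 2 ≤ (1 + bandWidth σ) ^ 2 := by gcongr
      have a3 : (1 - bandWidth σ) ^ 2 ≤ ‖m‖ ^ 2 := pow_le_pow_left₀ (by linarith) hm1 2
      have : ‖e‖ ^ 2 ≤ 4 * bandWidth σ := by linarith
      refine this.trans ?_
      norm_num at d1 ⊢
      linarith
    have hpos := (hD.mem_iff_of_norm_le h (by linarith : ‖m + e‖ ≤ 8)).1 he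
    have := secondDiff_coreExcess_neg h hD hm1 (inb t ht).le he0 hsm hu0 hpos hmin_s
    unfold secondDiff at this
    linarith
  rcases le_total t (1 / 2) with hc | hc
  · refine fin (-((t:ℂ) * (q - p))) (by simpa [hm] using hp)
      ⟨2 * t, ⟨by linarith [ht.1], by linarith⟩, ?_⟩
    rw [hm]; push_cast; ring
  · refine fin ((1 - (t:ℂ)) * (q - p)) ?_ ⟨2 * t - 1, ⟨by linarith, by linarith [ht.2]⟩, ?_⟩
    · rwa [show m + (1 - (t:ℂ)) * (q - p) = q by rw [hm]; ring]
    · rw [hm]; push_cast; ring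

end

section
variable {σ : ℝ} {D : Set ℂ}

lemma continuous_logPot (h : SmallScale σ) (hDm : MeasurableSet D) (hD : D ⊆ ball 0 2) :
    Continuous (logPot σ D) := by
  have hv := volume_ne_top_of_subset hD
  have lip : ∀ y z, dist (logPot σ D y) (logPot σ D z) ≤
      5 / 4 * (56 * volume.real D ^ (1 / 4 : ℝ) + 4 * volume.real D) * dist y z := by
    intro y z
    have k := abs_integral_log_diff_le hDm hv (c := 5 / 4) (by norm_num)
      (fun w hw => abs_rho_le_mem h hD hw) y z
    rw [Real.dist_eq, dist_eq_norm]
    unfold logPot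
    rw [← integral_sub (integrableOn_rho_mul h hDm hD (integrableOn_neg_two_log hDm hD y))
      (integrableOn_rho_mul h hDm hD (integrableOn_neg_two_log hDm hD z))]
    simp only [mul_sub] at k ⊢
    linarith
  refine continuous_iff_continuousAt.2 fun y => tendsto_iff_dist_tendsto_zero.2 ?_
  refine squeeze_zero (fun _ => dist_nonneg) (fun z => lip z y) ?_
  have : Continuous fun z => 5 / 4 * (56 * volume.real D ^ (1 / 4 : ℝ) + 4 * volume.real D) *
      dist z y := by fun_prop
  simpa using this.tendsto y

lemma abs_sqrt_relDist_sub_le_of_pos (hσ : 0 < σ) {y z w : ℂ} (hy : 0 < axDist σ y)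
    (hz : 0 < axDist σ z) (hw : σ * ‖w‖ ≤ 1 / 8) (hw2 : ‖w‖ ≤ 2) :
    |√(relDist σ z w) - √(relDist σ y w)| ≤
      2 * σ * (‖z - y‖ / √(axDist σ z) + (‖y‖ + 2) * |1 / √(axDist σ z) - 1 / √(axDist σ y)|) := by
  obtain ⟨b1, b2⟩ := sqrt_axDist_bounds hσ hw
  have sy := Real.sqrt_pos.2 hy
  have sz := Real.sqrt_pos.2 hz
  have sw : 0 < √(axDist σ w) := by linarith
  rw [sqrt_relDist hσ hy, sqrt_relDist hσ hz]
  have e : σ * ‖z - w‖ / (√(axDist σ z) * √(axDist σ w)) -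
      σ * ‖y - w‖ / (√(axDist σ y) * √(axDist σ w)) =
      σ / √(axDist σ w) * ((‖z - w‖ - ‖y - w‖) / √(axDist σ z) +
        ‖y - w‖ * (1 / √(axDist σ z) - 1 / √(axDist σ y))) := by
    field_simp
    ring
  have i1 : σ / √(axDist σ w) ≤ 2 * σ := by
    rw [div_le_iff₀ sw]
    nlinarith
  have i2 : |‖z - w‖ - ‖y - w‖| ≤ ‖z - y‖ := by
    have := abs_norm_sub_norm_le (z - w) (y - w)
    rwa [sub_sub_sub_cancel_right] at this
  have i3 : ‖y - w‖ ≤ ‖y‖ + 2 := (norm_sub_le _ _).trans (by linarith)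
  rw [e, abs_mul, abs_of_pos (div_pos hσ sw)]
  refine mul_le_mul i1 ((abs_add_le _ _).trans (add_le_add ?_ ?_)) (abs_nonneg _) (by positivity)
  · rw [abs_div, abs_of_pos sz]
    gcongr
  · rw [abs_mul, abs_norm]
    gcongr

lemma continuousOn_corrPot (h : SmallScale σ) (hDm : MeasurableSet D) (hD : D ⊆ ball 0 2) :
    ContinuousOn (corrPot σ D) {y | 0 < axDist σ y} := by
  have hσ := h.pos
  intro y hy
  have hy' : 0 < axDist σ y := hy
  set g : ℂ → ℝ := fun z => 2 * σ *
    (‖z - y‖ / √(axDist σ z) + (‖y‖ + 2) * |1 / √(axDist σ z) - 1 / √(axDist σ y)|) with hg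
  have gc : ContinuousAt g y := by
    have c := (continuous_axDist σ).continuousAt (x := y)
    have n : √(axDist σ y) ≠ 0 := (Real.sqrt_pos.2 hy').ne'
    have c1 : ContinuousAt (fun z => √(axDist σ z)) y := c.sqrt
    have c2 : ContinuousAt (fun z => ‖z - y‖) y := by fun_prop
    exact continuousAt_const.mul ((c2.div c1 n).add
      (continuousAt_const.mul ((continuousAt_const.div c1 n).sub continuousAt_const).abs))
  have g0 : g y = 0 := by simp [hg]
  refine tendsto_iff_dist_tendsto_zero.2 ?_
  have lim : Tendsto (fun z => 5 / 4 * (4 * g z) * volume.real D)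
      (nhdsWithin y {y | 0 < axDist σ y}) (nhds 0) := by
    have := ((gc.const_mul 4).const_mul (5 / 4)).mul_const (volume.real D)
    have := this.tendsto
    rw [g0] at this
    simpa using this.mono_left nhdsWithin_le_nhds
  refine squeeze_zero' (Eventually.of_forall fun _ => dist_nonneg) ?_ lim
  filter_upwards [self_mem_nhdsWithin] with z hz
  have hz' : 0 < axDist σ z := hz
  rw [Real.dist_eq]
  unfold corrPot
  rw [← integral_sub (integrableOn_rho_mul h hDm hD (integrableOn_ringJ h hDm hD hz'))
    (integrableOn_rho_mul h hDm hD (integrableOn_ringJ h hDm hD hy'))]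
  refine abs_setIntegral_le (volume_ne_top_of_subset hD) fun w hw => ?_
  have hX := axDist_pos h (w := w) ((norm_lt_of_subset hD hw).le.trans (by norm_num))
  rw [← mul_sub, abs_mul]
  refine mul_le_mul (abs_rho_le_mem h hD hw) ((abs_ringJ_sub_le (relDist_nonneg hz' hX)
    (relDist_nonneg hy' hX)).trans ?_) (abs_nonneg _) (by norm_num)
  have := abs_sqrt_relDist_sub_le_of_pos hσ hy' hz' (h.mul_norm_mem hD hw)
      (norm_lt_of_subset hD hw).le
  linarith

lemma continuousOn_ringPot (h : SmallScale σ) (hDm : MeasurableSet D) (hD : D ⊆ ball 0 2) :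
    ContinuousOn (ringPot σ D) {y | 0 < axDist σ y} := by
  have k : ContinuousOn (fun y => logPot σ D y + corrPot σ D y +
      massRho σ D * log (axDist σ y) + selfConst σ D) {y | 0 < axDist σ y} := by
    refine (((continuous_logPot h hDm hD).continuousOn.add (continuousOn_corrPot h hDm hD)).add
      (continuousOn_const.mul ((continuous_axDist σ).continuousOn.log ?_))).add continuousOn_const
    exact fun y hy => (show 0 < axDist σ y from hy).ne'
  exact k.congr fun y hy => ringPot_eq h hDm hD hy

lemma IsCore.isOpen (h : SmallScale σ) (hD : IsCore σ D) : IsOpen D := by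
  have hD2 := hD.inBand.subset_two h
  have hc := (continuousOn_excess h hD.inBand (abs_multA_le' h hD2)
    (abs_multB_le' h hD.inBand)).mono (ball_subset_closedBall.trans
      (closedBall_subset_closedBall (show (8:ℝ) ≤ 16 by norm_num)))
  have ho := hc.isOpen_inter_preimage isOpen_ball isOpen_Ioi (t := Set.Ioi 0)
  convert ho using 1
  ext y
  constructor
  · intro hy
    have := norm_lt_of_subset hD2 hy
    exact ⟨mem_ball_zero_iff.2 (by linarith), (hD.mem_iff_of_norm_le h (by linarith)).1 hy⟩
  · rintro ⟨h1, h2⟩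
    exact (hD.mem_iff_of_norm_le h (mem_ball_zero_iff.1 h1).le).2 h2

/-- Leading order of the speed multiplier of a core. -/
def speedCoeff (σ : ℝ) : ℝ := π / 2 * (-log σ + (ringJ 0 / 2 + dipoleConst))

lemma abs_selfMass_sub_le (h : SmallScale σ) (hD : InBand σ D) :
    |selfMass σ D - π * ringLog σ| ≤ 300 * (σ * (-log σ)) := by
  have hD2 := hD.subset_two h
  have hσ := h.pos
  have hL := h.log_large
  have rl := ringLog_bounds h
  have hv := volume_ne_top_of_subset hD2
  have e : selfMass σ D - π * ringLog σ =
      (∫ w in D, (rho σ w * (ringLog σ + log (axDist σ w)) - ringLog σ)) +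
        (volume.real D - π) * ringLog σ := by
    rw [integral_sub (integrableOn_selfMass h hD.meas hD2) (integrableOn_const hv), integral_const,
      measureReal_restrict_apply_univ, smul_eq_mul]
    unfold selfMass
    ring
  have b1 : |∫ w in D, (rho σ w * (ringLog σ + log (axDist σ w)) - ringLog σ)| ≤
      16 * (σ * (-log σ)) * volume.real D := by
    refine abs_setIntegral_le hv fun w hw => ?_
    have s := h.mul_norm_mem hD2 hw
    have n := (norm_lt_of_subset hD2 hw).le
    have r1 := abs_rho_sub_one_le hσ s
    have r2 := abs_rho_le_mem h hD2 hw
    have l := abs_log_axDist_le hσ s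
    have sn : σ * ‖w‖ ≤ σ * 2 := by gcongr
    rw [show rho σ w * (ringLog σ + log (axDist σ w)) - ringLog σ =
      (rho σ w - 1) * ringLog σ + rho σ w * log (axDist σ w) by ring]
    have a1 : |(rho σ w - 1) * ringLog σ| ≤ 4 * σ * (5 / 2 * (-log σ)) := by
      rw [abs_mul, abs_of_pos (by linarith : 0 < ringLog σ)]
      exact mul_le_mul (by linarith) rl.2 (by linarith) (by linarith)
    have a2 : |rho σ w * log (axDist σ w)| ≤ 5 / 4 * (4 * σ) := by
      rw [abs_mul]
      exact mul_le_mul r2 (by linarith) (abs_nonneg _) (by norm_num)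
    refine (abs_add_le _ _).trans ?_
    nlinarith
  have b2 : |(volume.real D - π) * ringLog σ| ≤ 10 * bandWidth σ * (5 / 2 * (-log σ)) := by
    rw [abs_mul, abs_of_pos (by linarith : 0 < ringLog σ)]
    exact mul_le_mul (abs_volume_sub_pi_le h hD) rl.2 (by linarith)
      (by linarith [h.bandWidth_pos])
  have v := volume_real_le_of_subset hD2
  have p := pi_lt_d2
  have d := h.bandWidth_le_mul
  have sl : 0 < σ * (-log σ) := by nlinarith
  rw [e]
  refine (abs_add_le _ _).trans ((add_le_add b1 b2).trans ?_)
  have c1 : 16 * (σ * (-log σ)) * volume.real D ≤ 16 * (σ * (-log σ)) * 16 := by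
    gcongr; norm_num at p ⊢; linarith
  have c2 : bandWidth σ * (-log σ) ≤ σ * (-log σ) := by
    have : bandWidth σ ≤ σ := by norm_num at d; linarith
    nlinarith
  nlinarith

lemma abs_multA_multB_sub_speedCoeff_le (h : SmallScale σ) (hD : InBand σ D) :
    |multA σ D / 4 + multB σ D / 2 - speedCoeff σ| ≤ 2 * 10 ^ 6 * (σ * (-log σ)) := by
  have hD2 := hD.subset_two h
  have hσ := h.pos
  have hL := h.log_large
  have v := abs_le.1 (abs_volume_sub_pi_le h hD)
  have dc := abs_dipoleConst_le
  have r : |(∫ w in D, w.re) / σ| ≤ 30 * (10 ^ 5 * (σ * (-log σ))) := by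
    rw [abs_div, abs_of_pos hσ, div_le_iff₀ hσ]
    have := abs_integral_re_le h hD
    unfold bandWidth at this
    linarith
  have m := abs_le.1 (abs_selfMass_sub_le h hD)
  have r' := abs_le.1 r
  have d : bandWidth σ ≤ σ := by
    have := h.bandWidth_le_mul
    norm_num at this
    linarith
  have dv : |dipoleConst * (volume.real D - π)| ≤ 40 * (10 * bandWidth σ) := by
    rw [abs_mul]
    exact mul_le_mul dc (abs_volume_sub_pi_le h hD) (abs_nonneg _) (by norm_num)
  have dv' := abs_le.1 dv
  have sl : σ * 100 ≤ σ * (-log σ) := by gcongr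
  rw [multA_eq h hD.meas hD2, multB_eq hD.meas hD2]
  unfold speedCoeff
  unfold ringLog at m
  have e : (selfMass σ D - 4 / 5 * (volume.real D - π)) / 4 +
      ((∫ w in D, w.re) / σ + dipoleConst * volume.real D) / 2 -
      π / 2 * (-log σ + (ringJ 0 / 2 + dipoleConst)) =
      (selfMass σ D - π * (2 * (-log σ) + ringJ 0)) / 4 - (volume.real D - π) / 5 +
      ((∫ w in D, w.re) / σ) / 2 + dipoleConst * (volume.real D - π) / 2 := by ring
  rw [e, abs_le]
  constructor <;> linarith

lemma abs_integral_axDist_sub_pi_le (h : SmallScale σ) (hD : InBand σ D) :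
    |(∫ w in D, axDist σ w) - π| ≤ 100 * σ := by
  have hD2 := hD.subset_two h
  have hσ := h.pos
  have v := abs_le.1 (abs_volume_sub_pi_le h hD)
  have r := abs_le.1 (abs_integral_re_le h hD)
  have d : bandWidth σ ≤ σ := by
    have := h.bandWidth_le_mul
    norm_num at this
    linarith
  have e : ∫ w in D, axDist σ w = volume.real D + σ * ∫ w in D, w.re := by
    unfold axDist
    have ic : IntegrableOn (fun _ : ℂ => (1:ℝ)) D :=
      integrableOn_const (volume_ne_top_of_subset hD2)
    rw [integral_add ic
      ((integrableOn_re hD.meas hD2).const_mul σ), integral_const_mul, integral_const,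
      measureReal_restrict_apply_univ]
    simp
  have hs : σ ≤ 1 := h.le_coarse.trans (by norm_num)
  have d0 := h.bandWidth_pos
  rw [e, abs_le]
  constructor <;> nlinarith

/-- Existence of a vortex core in rescaled coordinates. -/
theorem exists_core_profile (h : SmallScale σ) : ∃ (D : Set ℂ) (β m : ℝ),
    InBand σ D ∧ IsOpen D ∧ ConjSymm D ∧ Convex ℝ D ∧ 0 < m ∧
      |β - speedCoeff σ| ≤ 2 * 10 ^ 6 * (σ * (-log σ)) ∧
      ∀ y, y ∈ D ↔ 0 < axDist σ y ∧
        β * √(axDist σ y) ^ 3 + m / √(axDist σ y) < ringPot σ D y := by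
  obtain ⟨D, hD⟩ := exists_isCore h
  refine ⟨D, multA σ D / 4 + multB σ D / 2, 3 / 4 * multA σ D - multB σ D / 2, hD.inBand,
    hD.isOpen h, hD.symm, hD.convex h, ?_, abs_multA_multB_sub_speedCoeff_le h hD.inBand,
    fun y => ?_⟩
  · have := le_multA h hD.inBand
    have := abs_le.1 (abs_multB_le h hD.inBand)
    have := h.log_huge
    linarith
  · rw [hD.mem_iff h]
    refine and_congr_right fun hy => ?_
    have e : coreExcess σ D y = ringPot σ D y -
        ((multA σ D / 4 + multB σ D / 2) * √(axDist σ y) ^ 3 +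
          (3 / 4 * multA σ D - multB σ D / 2) / √(axDist σ y)) := by
      unfold coreExcess excess profA profB
      ring
    rw [e, sub_pos]

end

section
variable {a σ : ℝ} {D : Set ℂ}

/-- The point of the half plane with rescaled coordinate `y` about the centre `(a, 0)`. -/
def ringMap (a σ : ℝ) (y : ℂ) : Plane := mk2 (a * axDist σ y) (a * σ * y.im)

/-- Rescaled coordinate of a point of the plane about the centre `(a, 0)`. -/
def ringCoord (a σ : ℝ) (x : Plane) : ℂ := ⟨(x 0 - a) / (a * σ), x 1 / (a * σ)⟩

lemma mk2_zero (s t : ℝ) : mk2 s t 0 = s := rfl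

lemma mk2_one (s t : ℝ) : mk2 s t 1 = t := rfl

lemma mk2_eta (x : Plane) : mk2 (x 0) (x 1) = x := by
  ext i; fin_cases i <;> rfl

lemma ringCoord_ringMap (ha : a ≠ 0) (hσ : σ ≠ 0) (y : ℂ) : ringCoord a σ (ringMap a σ y) = y := by
  unfold ringCoord ringMap axDist
  apply Complex.ext
  · simp only [mk2_zero]; field_simp; ring
  · simp only [mk2_one]; field_simp

lemma mul_axDist_ringCoord (ha : a ≠ 0) (hσ : σ ≠ 0) (x : Plane) :
    a * axDist σ (ringCoord a σ x) = x 0 := by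
  unfold ringCoord axDist
  field_simp
  ring

lemma ringMap_ringCoord (ha : a ≠ 0) (hσ : σ ≠ 0) (x : Plane) :
    ringMap a σ (ringCoord a σ x) = x := by
  conv_rhs => rw [← mk2_eta x]
  unfold ringMap
  rw [mul_axDist_ringCoord ha hσ]
  congr 1
  unfold ringCoord
  field_simp

lemma continuous_ringCoord (a σ : ℝ) : Continuous (ringCoord a σ) := by
  have : ringCoord a σ = fun x =>
      (((x 0 - a) / (a * σ) : ℝ) : ℂ) + (((x 1) / (a * σ) : ℝ) : ℂ) * Complex.I := by
    ext x
    exact Complex.mk_eq_add_mul_I _ _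
  rw [this]
  fun_prop

lemma norm_sub_mk2 (hs : 0 < a * σ) (x : Plane) :
    ‖x - mk2 a 0‖ = a * σ * ‖ringCoord a σ x‖ := by
  have e : ‖x - mk2 a 0‖ = √((x 0 - a) ^ 2 + (x 1) ^ 2) := by
    rw [EuclideanSpace.norm_eq]
    simp [Fin.sum_univ_two, mk2_zero, mk2_one]
  rw [e, Complex.norm_def, Complex.normSq_mk]
  rw [← Real.sqrt_sq hs.le, ← Real.sqrt_mul (sq_nonneg _)]
  congr 1
  unfold ringCoord
  have ha : a ≠ 0 := fun hc => by simp [hc] at hs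
  have hσ : σ ≠ 0 := fun hc => by simp [hc] at hs
  field_simp

lemma convex_preimage_ringCoord (hD : Convex ℝ D) : Convex ℝ (ringCoord a σ ⁻¹' D) := by
  intro x hx y hy s t hs ht hst
  have e : ringCoord a σ (s • x + t • y) = s • ringCoord a σ x + t • ringCoord a σ y := by
    have hs' : s = 1 - t := by linarith
    unfold ringCoord
    apply Complex.ext
    · simp [hs']; ring
    · simp; ring
  rw [Set.mem_preimage, e]
  exact hD hx hy hs ht hst

lemma setIntegral_preimage_ringCoord (hs : 0 < a * σ) (hDm : MeasurableSet D) (f : Plane → ℝ) :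
    ∫ x in ringCoord a σ ⁻¹' D, f x = (a * σ) ^ 2 * ∫ y in D, f (ringMap a σ y) := by
  have ha : a ≠ 0 := fun hc => by simp [hc] at hs
  have hσ : σ ≠ 0 := fun hc => by simp [hc] at hs
  set E := Complex.orthonormalBasisOneI.repr with hE
  set g : Plane → ℝ := (ringCoord a σ ⁻¹' D).indicator f with hg
  have hA : MeasurableSet (ringCoord a σ ⁻¹' D) := (continuous_ringCoord a σ).measurable hDm
  have mp : MeasurePreserving E := E.measurePreserving
  have e1 : ∫ x, g x = ∫ z, g (E z) :=
    (mp.integral_comp E.toHomeomorph.measurableEmbedding g).symm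
  have e2 : ∫ z, g (E z) = ∫ z, g (E (a + z)) :=
    (integral_add_left_eq_self (fun z => g (E z)) (a:ℂ)).symm
  have e3 := Measure.integral_comp_smul (volume : Measure ℂ) (fun z => g (E (a + z))) (a * σ)
  have em : ∀ y : ℂ, E (a + (a * σ) • y) = ringMap a σ y := by
    intro y
    rw [← mk2_eta (E _)]
    unfold ringMap axDist
    congr 1
    · simp [hE, Complex.orthonormalBasisOneI_repr_apply]; ring
    · simp [hE, Complex.orthonormalBasisOneI_repr_apply]
  simp only [em, Complex.finrank_real_complex] at e3
  have e4 : ∀ y, g (ringMap a σ y) = D.indicator (fun y => f (ringMap a σ y)) y := by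
    intro y
    by_cases hy : y ∈ D
    · rw [Set.indicator_of_mem hy, hg,
        Set.indicator_of_mem (show ringMap a σ y ∈ ringCoord a σ ⁻¹' D by
          rwa [Set.mem_preimage, ringCoord_ringMap ha hσ])]
    · rw [Set.indicator_of_notMem hy, hg,
        Set.indicator_of_notMem (show ringMap a σ y ∉ ringCoord a σ ⁻¹' D by
          rwa [Set.mem_preimage, ringCoord_ringMap ha hσ])]
  rw [← integral_indicator hA, e1, e2, ← integral_indicator hDm]
  simp only [e4] at e3
  rw [e3, abs_of_pos (by positivity), smul_eq_mul, ← mul_assoc, mul_inv_cancel₀ (by positivity),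
    one_mul]

lemma Gstar_ringMap (ha : 0 < a) {y w : ℂ} (hy : 0 < axDist σ y) (hw : 0 < axDist σ w) :
    Gstar (ringMap a σ y) (ringMap a σ w) =
      a ^ 2 / (4 * π) * √(axDist σ y) * (rho σ w * ringF (relDist σ y w)) := by
  unfold Gstar ringF rho
  rw [← intervalIntegral.integral_const_mul, ← intervalIntegral.integral_const_mul,
    ← intervalIntegral.integral_const_mul]
  congr 1
  ext θ
  simp only [ringMap, mk2_zero, mk2_one]
  have sy := Real.sqrt_pos.2 hy
  have sw := Real.sqrt_pos.2 hw
  have qy := Real.sq_sqrt hy.le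
  have qw := Real.sq_sqrt hw.le
  have e : (a * σ * y.im - a * σ * w.im) ^ 2 + (a * axDist σ y) ^ 2 + (a * axDist σ w) ^ 2 -
      2 * (a * axDist σ y) * (a * axDist σ w) * cos θ =
      (a * √(axDist σ y) * √(axDist σ w)) ^ 2 * (relDist σ y w + 2 - 2 * cos θ) := by
    have n : ‖y - w‖ ^ 2 = (y.re - w.re) ^ 2 + (y.im - w.im) ^ 2 := by
      rw [← Complex.normSq_eq_norm_sq, Complex.normSq_apply]
      simp; ring
    rw [mul_pow _ (√(axDist σ w)), mul_pow _ (√(axDist σ y)), qy, qw]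
    unfold relDist
    rw [n]
    have h1 : axDist σ y ≠ 0 := hy.ne'
    have h2 : axDist σ w ≠ 0 := hw.ne'
    have h3 : axDist σ y - axDist σ w = σ * (y.re - w.re) := by unfold axDist; ring
    have h4 : (σ * (y.re - w.re)) ^ 2 = (axDist σ y - axDist σ w) ^ 2 := by rw [h3]
    field_simp
    linear_combination -h4
  rw [e, Real.sqrt_mul (sq_nonneg _), Real.sqrt_sq (by positivity)]
  rcases eq_or_ne (√(relDist σ y w + 2 - 2 * cos θ)) 0 with h0 | h0
  · simp [h0]
  have hp := pi_pos.ne'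
  have s4 : √(axDist σ w) ^ 4 = axDist σ w ^ 2 := by
    rw [show √(axDist σ w) ^ 4 = (√(axDist σ w) ^ 2) ^ 2 by ring, qw]
  field_simp
  rw [qy, s4]
  ring_nf

end

section
variable {a σ ε W β m : ℝ} {D : Set ℂ}

/-- Stream function generated by the set with rescaled shape `D` about the centre `(a, 0)`. -/
def ringStream (a σ ε : ℝ) (D : Set ℂ) (x : Plane) : ℝ :=
  (∫ x' in ringCoord a σ ⁻¹' D, Gstar x x') / ε ^ 2

lemma axDist_ringCoord_pos (ha : 0 < a) (hσ : 0 < σ) {x : Plane} :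
    0 < axDist σ (ringCoord a σ x) ↔ x ∈ halfPlane := by
  have := mul_axDist_ringCoord ha.ne' hσ.ne' x
  show _ ↔ 0 < x 0
  rw [← this]
  exact (mul_pos_iff_of_pos_left ha).symm

lemma ringStream_eq (h : SmallScale σ) (ha : 0 < a) (hDm : MeasurableSet D) (hD : D ⊆ ball 0 2)
    {x : Plane} (hx : x ∈ halfPlane) : ringStream a σ ε D x =
      a ^ 4 * σ ^ 2 / (4 * π * ε ^ 2) * √(axDist σ (ringCoord a σ x)) *
        ringPot σ D (ringCoord a σ x) := by
  have hσ := h.pos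
  have hX := (axDist_ringCoord_pos ha hσ).2 hx
  have e : ∫ w in D, Gstar x (ringMap a σ w) =
      a ^ 2 / (4 * π) * √(axDist σ (ringCoord a σ x)) * ringPot σ D (ringCoord a σ x) := by
    unfold ringPot
    rw [← integral_const_mul]
    refine setIntegral_congr_fun hDm fun w hw => ?_
    have hw' := axDist_pos h (w := w) ((norm_lt_of_subset hD hw).le.trans (by norm_num))
    have := Gstar_ringMap (σ := σ) ha hX hw'
    rwa [ringMap_ringCoord ha.ne' hσ.ne'] at this
  unfold ringStream
  rw [setIntegral_preimage_ringCoord (mul_pos ha hσ) hDm, e]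
  ring

lemma crossSection_ringStream (h : SmallScale σ) (ha : 0 < a) (hε : 0 < ε)
    (hDm : MeasurableSet D) (hD : D ⊆ ball 0 2)
    (hmem : ∀ y, y ∈ D ↔ 0 < axDist σ y ∧
      β * √(axDist σ y) ^ 3 + m / √(axDist σ y) < ringPot σ D y)
    (hβ : β * a ^ 2 * σ ^ 2 = 2 * π * W * log (1 / ε) * ε ^ 2) :
    crossSection (ringStream a σ ε D) ε W (m * (a ^ 4 * σ ^ 2 / (4 * π * ε ^ 2))) =
      ringCoord a σ ⁻¹' D := by
  have hσ := h.pos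
  ext x
  rw [Set.mem_preimage, hmem, axDist_ringCoord_pos ha hσ]
  refine and_congr_right fun hx => ?_
  rw [ringStream_eq h ha hDm hD hx]
  have hX := (axDist_ringCoord_pos ha hσ).2 hx
  have ex := mul_axDist_ringCoord ha.ne' hσ.ne' x
  set X := axDist σ (ringCoord a σ x) with hXdef
  set V := ringPot σ D (ringCoord a σ x)
  have sX := Real.sqrt_pos.2 hX
  have qX := Real.sq_sqrt hX.le
  have hp := pi_pos
  set N := a ^ 4 * σ ^ 2 / (4 * π * ε ^ 2) with hN
  have Npos : 0 < N := by positivity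
  have eW : W / 2 * (x 0) ^ 2 * log (1 / ε) = N * √X * (β * √X ^ 3) := by
    have q4 : √X * √X ^ 3 = X ^ 2 := by
      rw [show √X * √X ^ 3 = (√X ^ 2) ^ 2 by ring, qX]
    calc W / 2 * (x 0) ^ 2 * log (1 / ε) = 2 * π * W * log (1 / ε) * ε ^ 2 *
          (a ^ 2 * X ^ 2 / (4 * π * ε ^ 2)) := by
          rw [← ex]; field_simp; ring
      _ = β * a ^ 2 * σ ^ 2 * (a ^ 2 * (√X * √X ^ 3) / (4 * π * ε ^ 2)) := by rw [hβ, q4]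
      _ = _ := by rw [hN]; ring
  have eμ : m * N = N * √X * (m / √X) := by field_simp
  rw [eW, eμ, lt_sub_iff_add_lt, ← mul_add, mul_lt_mul_iff_right₀ (by positivity), add_comm]

lemma continuousOn_ringStream (h : SmallScale σ) (ha : 0 < a) (hDm : MeasurableSet D)
    (hD : D ⊆ ball 0 2) : ContinuousOn (ringStream a σ ε D) halfPlane := by
  have hc := continuous_ringCoord a σ
  have k : ContinuousOn (fun x => a ^ 4 * σ ^ 2 / (4 * π * ε ^ 2) *
      √(axDist σ (ringCoord a σ x)) * ringPot σ D (ringCoord a σ x)) halfPlane := by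
    refine (continuous_const.mul ((continuous_axDist σ).comp hc).sqrt).continuousOn.mul ?_
    exact (continuousOn_ringPot h hDm hD).comp hc.continuousOn
      fun x hx => (axDist_ringCoord_pos ha h.pos).2 hx
  exact k.congr fun x hx => ringStream_eq h ha hDm hD hx

lemma preimage_ringCoord_subset_closedBall (h : SmallScale σ) (ha : 0 < a) (hD : D ⊆ ball 0 2) :
    ringCoord a σ ⁻¹' D ⊆ closedBall (mk2 a 0) (a * σ * 2) := by
  intro x hx
  have hs := mul_pos ha h.pos
  rw [mem_closedBall, dist_eq_norm, norm_sub_mk2 hs]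
  gcongr
  exact (norm_lt_of_subset hD hx).le

lemma isVortexRingStream_ringStream (h : SmallScale σ) (ha : 0 < a) (hε : 0 < ε)
    (hDm : MeasurableSet D) (hD : D ⊆ ball 0 2)
    (hmem : ∀ y, y ∈ D ↔ 0 < axDist σ y ∧
      β * √(axDist σ y) ^ 3 + m / √(axDist σ y) < ringPot σ D y)
    (hβ : β * a ^ 2 * σ ^ 2 = 2 * π * W * log (1 / ε) * ε ^ 2) :
    IsVortexRingStream (ringStream a σ ε D) ε W (m * (a ^ 4 * σ ^ 2 / (4 * π * ε ^ 2))) := by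
  have hA := crossSection_ringStream h ha hε hDm hD hmem hβ
  have hs := mul_pos ha h.pos
  have sub := preimage_ringCoord_subset_closedBall h ha hD
  refine ⟨continuousOn_ringStream h ha hDm hD, ?_, ?_, fun x _ => by rw [hA]; rfl⟩
  · rw [hA]
    exact isBounded_closedBall.subset sub
  · rw [hA]
    refine (closure_minimal sub isClosed_closedBall).trans fun x hx => ?_
    rw [mem_closedBall, dist_eq_norm, norm_sub_mk2 hs, mul_le_mul_iff_right₀ hs] at hx
    exact (axDist_ringCoord_pos ha h.pos).1 (axDist_pos h (by linarith))

lemma Gstar_reflect (s t u v : ℝ) :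
    Gstar (mk2 s (-t)) (mk2 u v) = Gstar (mk2 s t) (mk2 u (-v)) := by
  unfold Gstar
  simp only [mk2_zero, mk2_one]
  rw [show (-t - v) ^ 2 = (t - -v) ^ 2 by ring]

lemma centralized_ringStream (ha : 0 < a) (hσ : 0 < σ) (hDm : MeasurableSet D)
    (hs : ConjSymm D) : Centralized (ringStream a σ ε D) := by
  intro s t
  unfold ringStream
  rw [setIntegral_preimage_ringCoord (mul_pos ha hσ) hDm,
    setIntegral_preimage_ringCoord (mul_pos ha hσ) hDm, ← setIntegral_conj hs]
  congr 3
  ext y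
  unfold ringMap
  rw [Gstar_reflect, axDist_conj]
  simp

lemma circulation_ringStream (h : SmallScale σ) (ha : 0 < a) (hε : 0 < ε)
    (hDm : MeasurableSet D) (hD : D ⊆ ball 0 2)
    (hmem : ∀ y, y ∈ D ↔ 0 < axDist σ y ∧
      β * √(axDist σ y) ^ 3 + m / √(axDist σ y) < ringPot σ D y)
    (hβ : β * a ^ 2 * σ ^ 2 = 2 * π * W * log (1 / ε) * ε ^ 2) :
    circulation (ringStream a σ ε D) ε W (m * (a ^ 4 * σ ^ 2 / (4 * π * ε ^ 2))) =
      a ^ 3 * σ ^ 2 / ε ^ 2 * ∫ y in D, axDist σ y := by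
  unfold circulation
  rw [crossSection_ringStream h ha hε hDm hD hmem hβ,
    setIntegral_preimage_ringCoord (mul_pos ha h.pos) hDm]
  simp only [ringMap, mk2_zero]
  rw [integral_const_mul]
  ring

lemma ball_subset_preimage_ringCoord (ha : 0 < a) (hσ : 0 < σ) {r R : ℝ} (hD : ball 0 R ⊆ D)
    (hr : r ≤ a * σ * R) : ball (mk2 a 0) r ⊆ ringCoord a σ ⁻¹' D := by
  intro x hx
  have hs := mul_pos ha hσ
  rw [mem_ball, dist_eq_norm, norm_sub_mk2 hs] at hx
  exact hD (mem_ball_zero_iff.2 ((mul_lt_mul_iff_right₀ hs).1 (hx.trans_le hr)))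

lemma preimage_ringCoord_subset_ball (ha : 0 < a) (hσ : 0 < σ) {r R : ℝ} (hD : D ⊆ ball 0 R)
    (hr : a * σ * R ≤ r) : ringCoord a σ ⁻¹' D ⊆ ball (mk2 a 0) r := by
  intro x hx
  have hs := mul_pos ha hσ
  rw [mem_ball, dist_eq_norm, norm_sub_mk2 hs]
  exact ((mul_lt_mul_iff_right₀ hs).2 (mem_ball_zero_iff.1 (hD hx))).trans_le hr

end

lemma abs_sub_one_le_abs_sq_sub_one {x : ℝ} (hx : 0 ≤ x) : |x - 1| ≤ |x ^ 2 - 1| := by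
  rw [show x ^ 2 - 1 = (x - 1) * (x + 1) by ring, abs_mul, abs_of_nonneg (by linarith : 0 ≤ x + 1)]
  exact le_mul_of_one_le_right (abs_nonneg _) (by linarith)

lemma sqrt_ratio_bounds {b β η : ℝ} (hb : 0 < b) (hη : η ≤ 1 / 4) (h : |β - b| ≤ η * b) :
    0 < √(b / β) ∧ √(b / β) ^ 2 * β = b ∧ √(b / β) ≤ 3 / 2 ∧ |√(b / β) - 1| ≤ 2 * η ∧
      |√(b / β) ^ 3 - 1| ≤ 7 * η ∧ |√(b / β) * √(√(b / β)) - 1| ≤ 7 * η := by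
  have h' := abs_le.1 h
  have hβ : 3 / 4 * b ≤ β := by nlinarith
  have hβ0 : 0 < β := by linarith
  have l0 : 0 < √(b / β) := Real.sqrt_pos.2 (by positivity)
  have sq : √(b / β) ^ 2 = b / β := Real.sq_sqrt (by positivity)
  set l := √(b / β) with hl
  have η0 : 0 ≤ η := by
    by_contra! hc
    have := (abs_nonneg _).trans h
    nlinarith
  have d : |l ^ 2 - 1| ≤ 4 / 3 * η := by
    rw [sq, show b / β - 1 = (b - β) / β by field_simp, abs_div, abs_of_pos hβ0,
      div_le_iff₀ hβ0, abs_sub_comm]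
    nlinarith
  have d1 := (abs_sub_one_le_abs_sq_sub_one l0.le).trans d
  have d1' := abs_le.1 d1
  have l1 : l ≤ 3 / 2 := by linarith
  have d3 : |l ^ 3 - 1| ≤ 7 * η := by
    rw [show l ^ 3 - 1 = (l - 1) * (l ^ 2 + l + 1) by ring, abs_mul,
      abs_of_pos (by positivity : 0 < l ^ 2 + l + 1)]
    calc |l - 1| * (l ^ 2 + l + 1) ≤ 4 / 3 * η * 5 := by
          refine mul_le_mul d1 (by nlinarith) (by positivity) (by positivity)
      _ ≤ 7 * η := by linarith
  refine ⟨l0, by rw [sq]; field_simp, l1, by linarith, d3, ?_⟩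
  refine (abs_sub_one_le_abs_sq_sub_one (by positivity)).trans ?_
  rwa [mul_pow, Real.sq_sqrt l0.le, ← pow_succ]

/-- Solvability of the equation relating the core scale to the speed. -/
lemma exists_scale {q : ℝ} (hq : 0 < q) (c : ℝ) : ∃ K : ℝ, 0 < K ∧ ∀ L, 2 * K ≤ L →
    ∃ r, q / 2 ≤ r ∧ r ≤ 2 * q ∧ |c - 3 * log r| ≤ K ∧
      r ^ 2 * (L - 3 * log r + c) = q ^ 2 * L := by
  set K := 3 * (|log (q / 2)| + |log (2 * q)|) + |c| + 1 with hK
  have k1 := abs_nonneg (log (q / 2))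
  have k2 := abs_nonneg (log (2 * q))
  have hc := abs_nonneg c
  have bd : ∀ r, q / 2 ≤ r → r ≤ 2 * q → |c - 3 * log r| ≤ K := by
    intro r h1 h2
    have g1 := Real.log_le_log (by positivity) h1
    have g2 := Real.log_le_log (by linarith) h2
    have a1 := neg_abs_le (log (q / 2))
    have a2 := le_abs_self (log (2 * q))
    have a3 := neg_abs_le c
    have a4 := le_abs_self c
    rw [abs_le]
    constructor <;> linarith
  refine ⟨K, by linarith, fun L hL => ?_⟩
  have hc : ContinuousOn (fun r => r ^ 2 * (L - 3 * log r + c)) (Set.Icc (q / 2) (2 * q)) := by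
    have : ContinuousOn log (Set.Icc (q / 2) (2 * q)) :=
      Real.continuousOn_log.mono fun r hr => by
        have := hr.1
        exact (show 0 < r by linarith).ne'
    fun_prop
  have lo := abs_le.1 (bd (q / 2) le_rfl (by linarith))
  have hi := abs_le.1 (bd (2 * q) (by linarith) le_rfl)
  have hL0 : 0 < L := by linarith
  have hq2 : 0 < q ^ 2 := by positivity
  have mem : q ^ 2 * L ∈ Set.Icc ((q / 2) ^ 2 * (L - 3 * log (q / 2) + c))
      ((2 * q) ^ 2 * (L - 3 * log (2 * q) + c)) := by
    constructor
    · calc (q / 2) ^ 2 * (L - 3 * log (q / 2) + c) ≤ (q / 2) ^ 2 * (4 * L) := by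
            refine mul_le_mul_of_nonneg_left (by linarith) (by positivity)
        _ = q ^ 2 * L := by ring
    · calc q ^ 2 * L ≤ (2 * q) ^ 2 * (L / 2) := by nlinarith
        _ ≤ _ := mul_le_mul_of_nonneg_left (by linarith) (by positivity)
  obtain ⟨r, hr, he⟩ := intermediate_value_Icc (by linarith) hc mem
  exact ⟨r, hr.1, hr.2, bd r hr.1 hr.2, he⟩

lemma exists_smallScale : ∃ η : ℝ, 0 < η ∧ ∀ σ, 0 < σ → σ ≤ η → SmallScale σ := by
  have h1 := tendsto_log_nhdsGT_zero.eventually_le_atBot (-10 ^ 6)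
  have h2 : Tendsto (fun σ : ℝ => log σ * σ ^ (1:ℝ)) (nhdsWithin 0 (Set.Ioi 0)) (nhds 0) :=
    tendsto_log_mul_rpow_nhdsGT_zero one_pos
  have h3 := h2.eventually (Ici_mem_nhds (show (-(1 / 10 ^ 200) : ℝ) < 0 by norm_num))
  obtain ⟨u, hu, hs⟩ := mem_nhdsGT_iff_exists_Ioc_subset.1 (h1.and h3)
  refine ⟨u, hu, fun σ h0 hσ => ?_⟩
  obtain ⟨a, b⟩ := hs ⟨h0, hσ⟩
  have hlog : -(1 / 10 ^ 200) ≤ log σ * σ ^ (1:ℝ) := b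
  rw [Real.rpow_one] at hlog
  refine ⟨h0, by linarith, ?_⟩
  rw [show σ * -log σ = -(log σ * σ) by ring]
  exact neg_le.1 hlog

/-- Elementary radius bounds: a near-one factor and a thin band cost a multiple of the scale. -/
lemma ratio_band_bounds {ρ δ σ X : ℝ} (hσ0 : 0 < σ) (hσ : σ ≤ 1 / 10 ^ 202)
    (h1 : |ρ - 1| ≤ 7 * (4 * 10 ^ 6 * σ)) (hδ0 : 0 < δ) (hδ : δ ≤ σ) (hX : 10 ^ 8 * σ ≤ X) :
    1 - X ≤ ρ * (1 - δ) ∧ ρ * (1 + δ) ≤ 1 + X := by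
  have h1' := abs_le.1 h1
  have hs : σ ≤ 1 / 10 ^ 10 := hσ.trans (by norm_num)
  have hρ : ρ ≤ 2 := by norm_num at hs; linarith
  have hρ0 : 0 ≤ ρ := by norm_num at hs; linarith
  have : ρ * δ ≤ 2 * σ := mul_le_mul hρ hδ hδ0.le (by norm_num)
  constructor <;> linarith

lemma abs_speed_defect_le {P l e L K Q ε σ : ℝ} (hP : 0 < P) (hL : 1 ≤ L) (hKL : 2 * K ≤ L)
    (he : |e| ≤ K) (hl : |l - 1| ≤ 2 * (4 * 10 ^ 6 * σ)) (hQ : 0 < Q)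
    (hσ : σ ≤ 8 * Q * ε) (hε : ε * L ≤ 1) :
    |P * ((l - 1) + l * (e / L))| ≤ P * (10 ^ 9 * Q + K) / L := by
  have hL0 : 0 < L := by linarith
  have hK0 : 0 ≤ K := (abs_nonneg e).trans he
  have hd := abs_nonneg (l - 1)
  have el : |e / L| ≤ K / L := by rw [abs_div, abs_of_pos hL0]; gcongr
  have kl : K / L ≤ 1 := by rw [div_le_one hL0]; linarith
  have t : |(l - 1) * (e / L)| ≤ |l - 1| := by
    rw [abs_mul]
    exact mul_le_of_le_one_right hd (el.trans kl)
  have s : |l - 1| * L ≤ 128 * 10 ^ 6 * Q := by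
    have h1 : |l - 1| ≤ 64 * 10 ^ 6 * Q * ε := by linarith
    have h2 : |l - 1| * L ≤ 64 * 10 ^ 6 * Q * ε * L := mul_le_mul_of_nonneg_right h1 hL0.le
    have h3 : Q * (ε * L) ≤ Q * 1 := mul_le_mul_of_nonneg_left hε hQ.le
    linarith
  rw [abs_mul, abs_of_pos hP, mul_div_assoc]
  refine mul_le_mul_of_nonneg_left ?_ hP.le
  have d : |l - 1| ≤ 128 * 10 ^ 6 * Q / L := by rwa [le_div_iff₀ hL0]
  calc |(l - 1) + l * (e / L)| = |((l - 1) + (l - 1) * (e / L)) + e / L| := by congr 1; ring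
    _ ≤ |l - 1| + |(l - 1) * (e / L)| + |e / L| :=
      (abs_add_le _ _).trans (add_le_add_left (abs_add_le _ _) _)
    _ ≤ 2 * (128 * 10 ^ 6 * Q / L) + K / L := by linarith
    _ = (256 * 10 ^ 6 * Q + K) / L := by ring
    _ ≤ (10 ^ 9 * Q + K) / L := by gcongr; norm_num

lemma mul_log_one_div_le_one {ε : ℝ} (hε : 0 < ε) : ε * log (1 / ε) ≤ 1 := by
  have := Real.log_le_sub_one_of_pos (one_div_pos.2 hε)
  calc ε * log (1 / ε) ≤ ε * (1 / ε - 1) := mul_le_mul_of_nonneg_left this hε.le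
    _ ≤ 1 := by field_simp; linarith

set_option maxHeartbeats 800000 in
/-- A steady ring whose core has scale `σ = ε r³`, when `r` solves the scale equation. -/
lemma exists_ring_of_scale {p q K ε r : ℝ} (hp : 0 < p) (hq : 0 < q) (hε : 0 < ε)
    (hL1 : 1 ≤ log (1 / ε)) (hKL : 2 * K ≤ log (1 / ε)) (hr1 : q / 2 ≤ r) (hr2 : r ≤ 2 * q)
    (hrK : |(ringJ 0 / 2 + dipoleConst) - 3 * log r| ≤ K)
    (hr : r ^ 2 * (log (1 / ε) - 3 * log r + (ringJ 0 / 2 + dipoleConst)) = q ^ 2 * log (1 / ε))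
    (h : SmallScale (ε * r ^ 3)) :
    ∃ (ψ : Plane → ℝ) (μ z : ℝ), 0 < μ ∧ 0 < z ∧
      IsVortexRingStream ψ ε (q ^ 2 * p ^ 2 / 4) μ ∧ Centralized ψ ∧
      Convex ℝ (crossSection ψ ε (q ^ 2 * p ^ 2 / 4) μ) ∧
      ball (mk2 z 0) (√(p ^ 3 / z) * ε * (1 - 10 ^ 9 * q ^ 3 * ε * log (1 / ε))) ⊆
        crossSection ψ ε (q ^ 2 * p ^ 2 / 4) μ ∧
      crossSection ψ ε (q ^ 2 * p ^ 2 / 4) μ ⊆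
        ball (mk2 z 0) (√(p ^ 3 / z) * ε * (1 + 10 ^ 9 * q ^ 3 * ε * log (1 / ε))) ∧
      |z - p / q ^ 2| ≤ p / q ^ 2 * (10 ^ 9 * q ^ 3 + K) / log (1 / ε) ∧
      |circulation ψ ε (q ^ 2 * p ^ 2 / 4) μ - π * p ^ 3| ≤ p ^ 3 * (10 ^ 10 * q ^ 3) * ε := by
  set L := log (1 / ε) with hLdef
  set c := ringJ 0 / 2 + dipoleConst with hc
  set σ := ε * r ^ 3 with hσdef
  have hr0 : 0 < r := by linarith
  have hσ := h.pos
  have hL0 : 0 < L := by linarith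
  have hrK' := abs_le.1 hrK
  have hπ := pi_gt_three
  have hπ' := pi_lt_d2
  have logσ : -log σ = L - 3 * log r := by
    rw [hσdef, Real.log_mul hε.ne' (by positivity), Real.log_pow, hLdef, one_div, Real.log_inv]
    push_cast
    ring
  have hc46 : |c| ≤ 46 := by
    have h1 := abs_le.1 abs_ringJ_zero_le
    have h2 := abs_le.1 abs_dipoleConst_le
    rw [hc, abs_le]
    constructor <;> linarith
  have hc46' := abs_le.1 hc46
  have hΛ := h.log_large
  have bdef : speedCoeff σ = π / 2 * (L - 3 * log r + c) := by unfold speedCoeff; rw [logσ]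
  have b0 : 0 < speedCoeff σ := by
    rw [bdef]
    have : 0 < L - 3 * log r + c := by linarith
    positivity
  have br : speedCoeff σ * r ^ 2 = π / 2 * (q ^ 2 * L) := by rw [bdef, ← hr]; ring
  obtain ⟨D, β, m, hD, hopen, hconj, hconv, hm, hβ, hmem⟩ := exists_core_profile h
  have hD2 := hD.subset_two h
  have hDm := hD.meas
  have hrel : |β - speedCoeff σ| ≤ 4 * 10 ^ 6 * σ * speedCoeff σ := by
    refine hβ.trans ?_
    have : -log σ ≤ 2 * speedCoeff σ := by
      rw [bdef, logσ]
      rw [logσ] at hΛ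
      nlinarith
    calc 2 * 10 ^ 6 * (σ * -log σ) ≤ 2 * 10 ^ 6 * (σ * (2 * speedCoeff σ)) := by gcongr
      _ = _ := by ring
  have hσs : σ ≤ 1 / 10 ^ 202 := h.le
  obtain ⟨l0, lsq, l32, d1, d3, dr⟩ := sqrt_ratio_bounds b0
    (by norm_num at hσs ⊢; linarith : 4 * 10 ^ 6 * σ ≤ 1 / 4) hrel
  set l := √(speedCoeff σ / β) with hl
  set a := p * l / r ^ 2 with ha
  have a0 : 0 < a := by positivity
  have hW : β * a ^ 2 * σ ^ 2 = 2 * π * (q ^ 2 * p ^ 2 / 4) * L * ε ^ 2 := by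
    have e : β * a ^ 2 * σ ^ 2 = l ^ 2 * β * (p ^ 2 * ε ^ 2 * r ^ 2) := by
      rw [ha, hσdef]
      field_simp
    rw [e, lsq]
    linear_combination (p ^ 2 * ε ^ 2) * br
  have cross := crossSection_ringStream h a0 hε hDm hD2 hmem hW
  have hscale : a * σ = √(p ^ 3 / a) * ε * (l * √l) := by
    have sl := Real.sqrt_pos.2 l0
    have ql := Real.sq_sqrt l0.le
    have e : p ^ 3 / a = (p * r / √l) ^ 2 := by
      rw [div_pow, ql, ha]
      field_simp
    rw [e, Real.sqrt_sq (by positivity), ha, hσdef]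
    field_simp
  have hδ : bandWidth σ ≤ σ := by
    have := h.bandWidth_le_mul
    norm_num at this
    linarith
  have hδ0 := h.bandWidth_pos
  have hσq : σ ≤ 8 * q ^ 3 * ε := by
    have : r ^ 3 ≤ (2 * q) ^ 3 := by gcongr
    rw [hσdef]
    nlinarith
  have hσL : 10 ^ 8 * σ ≤ 10 ^ 9 * q ^ 3 * ε * L := by
    have : 10 ^ 9 * q ^ 3 * ε * 1 ≤ 10 ^ 9 * q ^ 3 * ε * L := by gcongr
    have : 0 < q ^ 3 * ε := by positivity
    linarith
  have rb := ratio_band_bounds hσ hσs dr hδ0 hδ hσL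
  have hsq : 0 ≤ √(p ^ 3 / a) * ε := by positivity
  refine ⟨ringStream a σ ε D, m * (a ^ 4 * σ ^ 2 / (4 * π * ε ^ 2)), a, by positivity, a0,
    isVortexRingStream_ringStream h a0 hε hDm hD2 hmem hW, centralized_ringStream a0 hσ hDm hconj,
    by rw [cross]; exact convex_preimage_ringCoord hconv, ?_, ?_, ?_, ?_⟩
  · rw [cross]
    refine ball_subset_preimage_ringCoord a0 hσ hD.inner ?_
    rw [hscale, mul_assoc _ (l * √l)]
    refine mul_le_mul_of_nonneg_left ?_ hsq
    exact rb.1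
  · rw [cross]
    refine preimage_ringCoord_subset_ball a0 hσ hD.outer ?_
    rw [hscale, mul_assoc _ (l * √l)]
    refine mul_le_mul_of_nonneg_left ?_ hsq
    exact rb.2
  · have ea : a - p / q ^ 2 = p / q ^ 2 * ((l - 1) + l * ((c - 3 * log r) / L)) := by
      have e1 : 1 / r ^ 2 = (1 + (c - 3 * log r) / L) / q ^ 2 := by
        field_simp
        linear_combination -hr
      rw [ha, mul_div_assoc, ← mul_one_div l, e1]
      ring
    rw [ea]
    exact abs_speed_defect_le (by positivity) hL1 hKL (by rwa [hc]) d1 (by positivity) hσq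
      (mul_log_one_div_le_one hε)
  · rw [circulation_ringStream h a0 hε hDm hD2 hmem hW]
    have ec : a ^ 3 * σ ^ 2 / ε ^ 2 = p ^ 3 * l ^ 3 := by
      rw [ha, hσdef]
      field_simp
    have i := abs_integral_axDist_sub_pi_le h hD
    have l3 : l ^ 3 ≤ 4 := by
      calc l ^ 3 ≤ (3 / 2) ^ 3 := by gcongr
        _ ≤ 4 := by norm_num
    rw [ec, show p ^ 3 * l ^ 3 * (∫ y in D, axDist σ y) - π * p ^ 3 =
      p ^ 3 * (l ^ 3 * ((∫ y in D, axDist σ y) - π) + (l ^ 3 - 1) * π) by ring, abs_mul,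
      abs_of_pos (by positivity : 0 < p ^ 3), mul_assoc (p ^ 3)]
    refine mul_le_mul_of_nonneg_left ((abs_add_le _ _).trans ?_) (by positivity)
    rw [abs_mul, abs_mul, abs_of_pos pi_pos, abs_of_pos (by positivity : 0 < l ^ 3)]
    have t1 : l ^ 3 * |(∫ y in D, axDist σ y) - π| ≤ 4 * (100 * σ) := by gcongr
    have t2 : |l ^ 3 - 1| * π ≤ 7 * (4 * 10 ^ 6 * σ) * 4 := by
      refine mul_le_mul d3 ?_ pi_pos.le (by positivity)
      norm_num at hπ'
      linarith
    have : 0 < q ^ 3 * ε := by positivity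
    linarith

/-- Rings for all small `ε`, with the constants normalised by `p³ = κ / π` and
`q² p² = 4 W`. -/
lemma exists_ring_family {p q : ℝ} (hp : 0 < p) (hq : 0 < q) :
    ∃ ε₀ K : ℝ, 0 < ε₀ ∧ 0 < K ∧ ∀ ε ∈ Set.Ioc (0 : ℝ) ε₀,
    ∃ (ψ : Plane → ℝ) (μ z : ℝ), 0 < μ ∧ 0 < z ∧
      IsVortexRingStream ψ ε (q ^ 2 * p ^ 2 / 4) μ ∧ Centralized ψ ∧
      Convex ℝ (crossSection ψ ε (q ^ 2 * p ^ 2 / 4) μ) ∧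
      ball (mk2 z 0) (√(p ^ 3 / z) * ε * (1 - 10 ^ 9 * q ^ 3 * ε * log (1 / ε))) ⊆
        crossSection ψ ε (q ^ 2 * p ^ 2 / 4) μ ∧
      crossSection ψ ε (q ^ 2 * p ^ 2 / 4) μ ⊆
        ball (mk2 z 0) (√(p ^ 3 / z) * ε * (1 + 10 ^ 9 * q ^ 3 * ε * log (1 / ε))) ∧
      |z - p / q ^ 2| ≤ p / q ^ 2 * (10 ^ 9 * q ^ 3 + K) / log (1 / ε) ∧
      |circulation ψ ε (q ^ 2 * p ^ 2 / 4) μ - π * p ^ 3| ≤ p ^ 3 * (10 ^ 10 * q ^ 3) * ε := by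
  obtain ⟨K, hK, hscale⟩ := exists_scale hq (ringJ 0 / 2 + dipoleConst)
  obtain ⟨η, hη, hsmall⟩ := exists_smallScale
  refine ⟨min (exp (-(2 * K + 1))) (η / (8 * q ^ 3)), K, by positivity, hK, fun ε hε => ?_⟩
  have hε0 : 0 < ε := hε.1
  have hL : 2 * K + 1 ≤ log (1 / ε) := by
    rw [one_div, Real.log_inv]
    have := (Real.log_le_iff_le_exp hε0).2 (hε.2.trans (min_le_left _ _))
    linarith
  obtain ⟨r, hr1, hr2, hrK, hr⟩ := hscale (log (1 / ε)) (by linarith)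
  have hr0 : 0 < r := by linarith
  have hσ : ε * r ^ 3 ≤ η := by
    have h1 := (le_div_iff₀ (by positivity)).1 (hε.2.trans (min_le_right _ _))
    have h2 : r ^ 3 ≤ (2 * q) ^ 3 := by gcongr
    have h3 := mul_le_mul_of_nonneg_left h2 hε0.le
    linarith
  exact exists_ring_of_scale hp hq hε0 (by linarith) (by linarith) hr1 hr2 hrK hr
    (hsmall _ (by positivity) hσ)

end VortexRing

/-- **Existence with precise localization of the cross-section** (Proposition 2.1).
For every `κ > 0` and `W > 0` there is a family of centralized steady vortex rings whose
convex cross-sections are pinched between two balls of radii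
`√(κ/(π z₁)) ε (1 ∓ L ε ln(1/ε))` centered at `(z₁(ε), 0)`, where
`|z₁(ε) − κ/(4πW)| ≤ C/ln(1/ε)`, and whose circulations converge to `κ`. -/
theorem existence_vortex_ring_localized (κ W : ℝ) (hκ : 0 < κ) (hW : 0 < W) :
    ∃ ε₀ L₁ L₂ C : ℝ, 0 < ε₀ ∧ 0 < L₁ ∧ 0 < L₂ ∧ 0 < C ∧
      ∃ ψ : ℝ → Plane → ℝ, ∃ μ : ℝ → ℝ, ∃ z₁ : ℝ → ℝ,
        (∀ ε ∈ Set.Ioc (0 : ℝ) ε₀,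
          0 < μ ε ∧ 0 < z₁ ε ∧
          IsVortexRingStream (ψ ε) ε W (μ ε) ∧
          Centralized (ψ ε) ∧
          Convex ℝ (crossSection (ψ ε) ε W (μ ε)) ∧
          Metric.ball (mk2 (z₁ ε) 0)
              (Real.sqrt (κ / (π * z₁ ε)) * ε * (1 - L₁ * ε * Real.log (1 / ε)))
            ⊆ crossSection (ψ ε) ε W (μ ε) ∧
          crossSection (ψ ε) ε W (μ ε)
            ⊆ Metric.ball (mk2 (z₁ ε) 0)
                (Real.sqrt (κ / (π * z₁ ε)) * ε * (1 + L₂ * ε * Real.log (1 / ε))) ∧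
          |z₁ ε - κ / (4 * π * W)| ≤ C / Real.log (1 / ε)) ∧
        Filter.Tendsto (fun ε => circulation (ψ ε) ε W (μ ε))
          (nhdsWithin 0 (Set.Ioc 0 ε₀)) (nhds κ) := by
  set p : ℝ := (κ / π) ^ (1 / 3 : ℝ) with hp
  have p0 : 0 < p := by positivity
  have p3 : p ^ 3 = κ / π := by
    rw [hp, ← Real.rpow_natCast, ← Real.rpow_mul (by positivity)]
    norm_num
  set q : ℝ := 2 * √W / p with hq
  have q0 : 0 < q := by positivity
  have q2 : q ^ 2 = 4 * W / p ^ 2 := by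
    rw [hq, div_pow, mul_pow, Real.sq_sqrt hW.le]
    norm_num
  have eW : q ^ 2 * p ^ 2 / 4 = W := by
    rw [q2]
    field_simp
  have ez : p / q ^ 2 = κ / (4 * π * W) := by
    rw [q2, show p / (4 * W / p ^ 2) = p ^ 3 / (4 * W) by field_simp, p3]
    field_simp
  have eκ : π * p ^ 3 = κ := by
    rw [p3]
    field_simp
  obtain ⟨ε₀, K, hε₀, hK, hfam⟩ := VortexRing.exists_ring_family p0 q0
  rw [eW, eκ, ez, p3] at hfam
  choose! ψ μ z hμ hz hψ hcent hconv hin hout hloc hcirc using hfam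
  refine ⟨ε₀, 10 ^ 9 * q ^ 3, 10 ^ 9 * q ^ 3, κ / (4 * π * W) * (10 ^ 9 * q ^ 3 + K), hε₀,
    by positivity, by positivity, by positivity, ψ, μ, z, fun ε hε => ?_, ?_⟩
  · have hin' := hin ε hε
    have hout' := hout ε hε
    rw [div_div] at hin' hout'
    exact ⟨hμ ε hε, hz ε hε, hψ ε hε, hcent ε hε, hconv ε hε, hin', hout', hloc ε hε⟩
  · have lim : Filter.Tendsto (fun ε : ℝ => κ / π * (10 ^ 10 * q ^ 3) * ε)
        (nhdsWithin 0 (Set.Ioc 0 ε₀)) (nhds 0) := by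
      have h : Continuous fun ε : ℝ => κ / π * (10 ^ 10 * q ^ 3) * ε := by fun_prop
      exact (h.tendsto' 0 0 (by simp)).mono_left nhdsWithin_le_nhds
    rw [tendsto_iff_norm_sub_tendsto_zero]
    refine squeeze_zero' (Filter.Eventually.of_forall fun _ => norm_nonneg _) ?_ lim
    filter_upwards [self_mem_nhdsWithin] with ε hε
    exact hcirc ε hε
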